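/- Let f and g be conjugate elements of Thompson's group F with ℓ(f) = i, ℓ(g) = j, and i ≤ j. Then there exists h ∈ F with h⁻¹fh = g and ℓ(h) ≤ 13i² + j² + 27i + 3j + 20. -/

import Mathlib

noncomputable section

open Set

noncomputable section

open Set

def x0fun : ℝ → ℝ := fun t =>
  if t < 0 then t
  else if t ≤ 1/2 then t / 2
  else if t ≤ 3/4 then t - 1/4
  else if t ≤ 1 then 2 * t - 1
  else t

def x0inv : ℝ → ℝ := fun t =>
  if t < 0 then t
  else if t ≤ 1/4 then 2 * t
  else if t ≤ 1/2 then t + 1/4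
  else if t ≤ 1 then (t + 1) / 2
  else t

/-- The generator `x₀` of Thompson's group `F`, as a permutation of `ℝ`
(the identity outside `[0,1]`). -/
def x0 : Equiv.Perm ℝ where
  toFun := x0fun
  invFun := x0inv
  left_inv := by
    intro t
    show x0inv (x0fun t) = t
    unfold x0fun
    split_ifs <;> (unfold x0inv; split_ifs <;> linarith)
  right_inv := by
    intro t
    show x0fun (x0inv t) = t
    unfold x0inv
    split_ifs <;> (unfold x0fun; split_ifs <;> linarith)

def x1fun : ℝ → ℝ := fun t =>
  if t < 0 then t
  else if t ≤ 1/2 then t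
  else if t ≤ 3/4 then t / 2 + 1/4
  else if t ≤ 7/8 then t - 1/8
  else if t ≤ 1 then 2 * t - 1
  else t

def x1inv : ℝ → ℝ := fun t =>
  if t < 0 then t
  else if t ≤ 1/2 then t
  else if t ≤ 5/8 then 2 * t - 1/2
  else if t ≤ 3/4 then t + 1/8
  else if t ≤ 1 then (t + 1) / 2
  else t

set_option maxHeartbeats 2000000 in
/-- The generator `x₁` of Thompson's group `F`, as a permutation of `ℝ`
(the identity outside `[0,1]`). -/
def x1 : Equiv.Perm ℝ where
  toFun := x1fun
  invFun := x1inv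
  left_inv := by
    intro t
    show x1inv (x1fun t) = t
    unfold x1fun
    split_ifs <;> (unfold x1inv; split_ifs <;> linarith)
  right_inv := by
    intro t
    show x1fun (x1inv t) = t
    unfold x1inv
    split_ifs <;> (unfold x1fun; split_ifs <;> linarith)

/-- Thompson's group `F`: the subgroup generated by `x₀` and `x₁`. -/
def ThompsonF : Subgroup (Equiv.Perm ℝ) :=
  Subgroup.closure ({x0, x1} : Set (Equiv.Perm ℝ))

/-- Word length with respect to the generating set `{x₀, x₁}`. -/
def wordLength (f : Equiv.Perm ℝ) : ℕ :=
  sInf {n | ∃ w : List (Equiv.Perm ℝ), w.length = n ∧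
    (∀ g ∈ w, g ∈ ({x0, x1, x0⁻¹, x1⁻¹} : Set (Equiv.Perm ℝ))) ∧ w.prod = f}

namespace Thompson

/-- Charts: parametrisations of subsets of the line by the unit interval `[0,1)`. -/
abbrev Chart := ↥(Ico (0 : ℝ) 1) → ℝ

/-- The affine map attached to a binary word. -/
def dyad : List Bool → ℝ → ℝ
  | [], s => s
  | b :: u, s => (dyad u s + if b then 1 else 0) / 2

/-- The standard dyadic interval attached to a binary word. -/
def cell (u : List Bool) : Set ℝ := Ico (dyad u 0) (dyad u 1)

@[simp] lemma dyad_nil (s : ℝ) : dyad [] s = s := rfl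

lemma dyad_append (u v : List Bool) (s : ℝ) : dyad (u ++ v) s = dyad u (dyad v s) := by
  induction u with
  | nil => rfl
  | cons b u ih => simp [dyad, ih]

lemma dyad_eq (u : List Bool) (s : ℝ) : dyad u s = dyad u 0 + s / 2 ^ u.length := by
  induction u with
  | nil => simp
  | cons b u ih => simp only [dyad, List.length_cons, pow_succ]; rw [ih]; field_simp; ring

lemma dyad_strictMono (u : List Bool) : StrictMono (dyad u) := by
  intro s t h
  rw [dyad_eq u s, dyad_eq u t]
  have : (0 : ℝ) < 2 ^ u.length := by positivity
  gcongr

lemma dyad_nonneg (u : List Bool) {s : ℝ} (hs : 0 ≤ s) : 0 ≤ dyad u s := by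
  induction u with
  | nil => simpa
  | cons b u ih => simp only [dyad]; split_ifs <;> linarith

lemma dyad_le_one (u : List Bool) {s : ℝ} (hs : s ≤ 1) : dyad u s ≤ 1 := by
  induction u with
  | nil => simpa
  | cons b u ih => simp only [dyad]; split_ifs <;> linarith

lemma dyad_mem (u : List Bool) {s : ℝ} (hs : s ∈ Ico (0 : ℝ) 1) : dyad u s ∈ Ico (0 : ℝ) 1 :=
  ⟨dyad_nonneg u hs.1, (dyad_strictMono u hs.2).trans_le (dyad_le_one u le_rfl)⟩

/-- The standard chart attached to a binary word. -/
def std (u : List Bool) : Chart := fun s => dyad u s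

/-- The restriction of a chart to a standard dyadic subinterval. -/
def sub (y : Chart) (v : List Bool) : Chart := fun s => y ⟨dyad v s, dyad_mem v s.2⟩

@[simp] lemma sub_nil (y : Chart) : sub y [] = y := rfl

lemma sub_sub (y : Chart) (u v : List Bool) : sub (sub y u) v = sub y (u ++ v) := by
  funext s; simp [sub, dyad_append]

lemma std_sub (u v : List Bool) : sub (std u) v = std (u ++ v) := by
  funext s; simp [sub, std, dyad_append]

lemma smul_sub (h : Equiv.Perm ℝ) (y : Chart) (v : List Bool) : h • sub y v = sub (h • y) v := rfl

@[simp] lemma smul_chart_apply (h : Equiv.Perm ℝ) (y : Chart) (s) : (h • y) s = h (y s) := rfl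

lemma range_sub_subset (y : Chart) (v : List Bool) : range (sub y v) ⊆ range y := by
  rintro _ ⟨s, rfl⟩; exact ⟨_, rfl⟩

lemma range_std (u : List Bool) : range (std u) = cell u := by
  ext x
  constructor
  · rintro ⟨s, rfl⟩
    exact ⟨(dyad_strictMono u).monotone s.2.1, dyad_strictMono u s.2.2⟩
  · rintro ⟨h0, h1⟩
    have hp : (0 : ℝ) < 2 ^ u.length := by positivity
    refine ⟨⟨(x - dyad u 0) * 2 ^ u.length, ?_, ?_⟩, ?_⟩
    · have : 0 ≤ x - dyad u 0 := by linarith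
      positivity
    · rw [dyad_eq u 1] at h1
      have : x - dyad u 0 < 1 / 2 ^ u.length := by linarith
      rwa [lt_div_iff₀ hp] at this
    · simp only [std]
      rw [dyad_eq]; field_simp; ring

lemma lo_mem_cell (u : List Bool) : dyad u 0 ∈ cell u :=
  ⟨le_rfl, dyad_strictMono u one_pos⟩

lemma cell_append_subset (u v : List Bool) : cell (u ++ v) ⊆ cell u := by
  rw [← range_std, ← range_std, ← std_sub]; exact range_sub_subset _ _

lemma cell_subset_unit (u : List Bool) : cell u ⊆ Ico 0 1 := cell_append_subset [] u

lemma mem_cell_cons (b : Bool) (u : List Bool) (x : ℝ) :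
    x ∈ cell (b :: u) ↔ 2 * x - (if b then 1 else 0) ∈ cell u := by
  simp only [cell, dyad, mem_Ico]
  constructor <;> rintro ⟨h1, h2⟩ <;> constructor <;> linarith

lemma prefix_or_prefix {u v : List Bool} {x : ℝ} (hu : x ∈ cell u) (hv : x ∈ cell v) :
    u <+: v ∨ v <+: u := by
  induction u generalizing v x with
  | nil => exact Or.inl List.nil_prefix
  | cons b u ih =>
    cases v with
    | nil => exact Or.inr List.nil_prefix
    | cons c v =>
      rw [mem_cell_cons] at hu hv
      have h1 := cell_subset_unit _ hu
      have h2 := cell_subset_unit _ hv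
      have hbc : b = c := by
        cases b <;> cases c <;> simp at h1 h2 ⊢ <;> linarith [h1.1, h1.2, h2.1, h2.2]
      subst hbc
      rcases ih hu hv with h | h
      · exact Or.inl (List.cons_prefix_cons.2 ⟨rfl, h⟩)
      · exact Or.inr (List.cons_prefix_cons.2 ⟨rfl, h⟩)

lemma abs_sub_lt_of_mem_cell {u : List Bool} {x y : ℝ} (hx : x ∈ cell u) (hy : y ∈ cell u) :
    |x - y| < 1 / 2 ^ u.length := by
  have := dyad_eq u 1
  rw [abs_lt]; constructor <;> linarith [hx.1, hx.2, hy.1, hy.2]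

lemma length_bound {x y : ℝ} (hxy : x ≠ y) :
    ∃ n : ℕ, ∀ u, x ∈ cell u → y ∈ cell u → u.length < n := by
  obtain ⟨n, hn⟩ := exists_pow_lt_of_lt_one (abs_pos.2 (sub_ne_zero.2 hxy))
    (show (1 / 2 : ℝ) < 1 by norm_num)
  refine ⟨n, fun u hx hy => ?_⟩
  by_contra h
  push Not at h
  have h1 := abs_sub_lt_of_mem_cell hx hy
  have h2 : (1 / 2 : ℝ) ^ u.length ≤ (1 / 2) ^ n :=
    pow_le_pow_of_le_one (by norm_num) (by norm_num) h
  rw [one_div_pow] at h2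
  linarith

lemma prefix_of_cell_subset {u v : List Bool} (h : cell v ⊆ cell u) : u <+: v := by
  rcases prefix_or_prefix (h (lo_mem_cell v)) (lo_mem_cell v) with h' | ⟨w, rfl⟩
  · exact h'
  · have h1 : dyad v 0 ∈ cell (v ++ w) := h (lo_mem_cell v)
    have e1 := dyad_eq v 1
    have e2 := dyad_eq (v ++ w) 1
    have h2 : dyad (v ++ w) 1 ≥ dyad v 1 := by
      by_contra hlt
      push Not at hlt
      have : dyad (v ++ w) 1 ∈ cell v :=
        ⟨by linarith [h1.2], hlt⟩
      exact (h this).2.ne rfl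
    have h3 := cell_append_subset v w (lo_mem_cell _)
    have h4 : (1 : ℝ) / 2 ^ v.length ≤ 1 / 2 ^ (v ++ w).length := by linarith [h3.1, h1.1]
    rw [one_div_le_one_div (by positivity) (by positivity)] at h4
    have h5 := (pow_le_pow_iff_right₀ (one_lt_two : (1 : ℝ) < 2)).1 h4
    rw [List.length_append] at h5
    have : w = [] := List.length_eq_zero_iff.1 (by omega)
    simp [this]

lemma std_injective : Function.Injective std := by
  intro u v h
  have h1 : cell u = cell v := by rw [← range_std, ← range_std, h]
  exact (prefix_of_cell_subset h1.ge).eq_of_length_le (prefix_of_cell_subset h1.le).length_le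

lemma exists_word {x : ℝ} (hx : x ∈ Ico (0 : ℝ) 1) (n : ℕ) :
    ∃ u : List Bool, u.length = n ∧ x ∈ cell u := by
  induction n generalizing x with
  | zero => exact ⟨[], rfl, hx⟩
  | succ n ih =>
    by_cases h : x < 1 / 2
    · obtain ⟨u, hu, hm⟩ := ih (x := 2 * x - 0) ⟨by linarith [hx.1], by linarith⟩
      exact ⟨false :: u, by simp [hu], by rw [mem_cell_cons]; simpa using hm⟩
    · obtain ⟨u, hu, hm⟩ := ih (x := 2 * x - 1) ⟨by linarith, by linarith [hx.2]⟩
      exact ⟨true :: u, by simp [hu], by rw [mem_cell_cons]; simpa using hm⟩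

/-- The binary words whose standard chart is not carried to a standard chart. -/
def bad (h : Equiv.Perm ℝ) : Set (List Bool) := {u | h • std u ∉ range std}

/-- Dyadic piecewise affine homeomorphisms of the unit interval, described through their
action on standard charts. -/
structure IsPL (h : Equiv.Perm ℝ) : Prop where
  mono : StrictMono h
  supp : ∀ x, x ∉ Ico (0 : ℝ) 1 → h x = x
  fin : (bad h).Finite

lemma not_mem_bad {h : Equiv.Perm ℝ} {u : List Bool} : u ∉ bad h ↔ ∃ v, h • std u = std v := by
  simp only [bad, mem_ofPred_eq, not_not, mem_range]
  exact exists_congr fun _ => eq_comm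

lemma smul_std_append {h : Equiv.Perm ℝ} {u v : List Bool} (e : h • std u = std v)
    (w : List Bool) : h • std (u ++ w) = std (v ++ w) := by
  rw [← std_sub, ← std_sub, smul_sub, e]

lemma image_cell {h : Equiv.Perm ℝ} {u v : List Bool} (e : h • std u = std v) {x : ℝ} :
    h x ∈ cell v ↔ x ∈ cell u := by
  rw [← range_std, ← range_std, ← e]
  constructor
  · rintro ⟨s, hs⟩; exact ⟨s, h.injective hs⟩
  · rintro ⟨s, rfl⟩; exact ⟨s, rfl⟩

lemma smul_std_inv {h : Equiv.Perm ℝ} {u v : List Bool} (e : h • std u = std v) :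
    h⁻¹ • std v = std u := by rw [← e, inv_smul_smul]

/-- A chart contained in a standard chart carried to a standard chart is standard exactly when
its image is. -/
lemma mem_std_iff {f : Equiv.Perm ℝ} {u v : List Bool} (e : f • std u = std v) {y : Chart}
    (hy : range y ⊆ cell u) : y ∈ range std ↔ f • y ∈ range std := by
  constructor
  · rintro ⟨a, rfl⟩
    rw [range_std] at hy
    obtain ⟨w, rfl⟩ := prefix_of_cell_subset hy
    exact ⟨v ++ w, (smul_std_append e w).symm⟩
  · rintro ⟨a, ha⟩
    have : cell a ⊆ cell v := by
      rw [← range_std, ha]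
      rintro _ ⟨s, rfl⟩
      exact (image_cell e).2 (hy ⟨s, rfl⟩)
    obtain ⟨w, rfl⟩ := prefix_of_cell_subset this
    refine ⟨u ++ w, ?_⟩
    rw [← smul_left_cancel_iff f, smul_std_append e, ha]

lemma bad_mul_subset (h k : Equiv.Perm ℝ) :
    bad (h * k) ⊆ bad k ∪ {u | ∃ v ∈ bad h, k • std u = std v} := by
  intro u hu
  by_cases hk : u ∈ bad k
  · exact Or.inl hk
  · obtain ⟨v, hv⟩ := not_mem_bad.1 hk
    refine Or.inr ⟨v, ?_, hv⟩
    rw [bad, mem_ofPred_eq, mul_smul, hv] at hu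
    exact hu

lemma finite_preimage_words (k : Equiv.Perm ℝ) {B : Set (List Bool)} (hB : B.Finite) :
    {u | ∃ v ∈ B, k • std u = std v}.Finite := by
  have hinj : Function.Injective fun u => k • std u :=
    (MulAction.injective k).comp std_injective
  refine ((hB.image std).preimage hinj.injOn).subset ?_
  rintro u ⟨v, hv, e⟩
  exact ⟨v, hv, e.symm⟩

lemma IsPL.one : IsPL 1 where
  mono := strictMono_id
  supp _ _ := rfl
  fin := by
    have : bad 1 = ∅ := by
      ext u; simp [bad]
    rw [this]; exact finite_empty

lemma IsPL.mul {h k : Equiv.Perm ℝ} (hh : IsPL h) (hk : IsPL k) : IsPL (h * k) where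
  mono := hh.mono.comp hk.mono
  supp x hx := by rw [Equiv.Perm.mul_apply, hk.supp x hx, hh.supp x hx]
  fin := (hk.fin.union (finite_preimage_words k hh.fin)).subset (bad_mul_subset h k)

lemma x0_apply (t : ℝ) : x0 t = x0fun t := rfl
lemma x1_apply (t : ℝ) : x1 t = x1fun t := rfl
lemma x0_inv_apply (t : ℝ) : x0⁻¹ t = x0inv t := rfl
lemma x1_inv_apply (t : ℝ) : x1⁻¹ t = x1inv t := rfl

lemma x0_std_zero : x0 • std [false] = std [false, false] := by
  funext ⟨s, h0, h1⟩
  simp only [smul_chart_apply, x0_apply, x0fun, std, dyad]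
  split_ifs <;> first | linarith | simp_all

lemma x0_std_one_zero : x0 • std [true, false] = std [false, true] := by
  funext ⟨s, h0, h1⟩
  simp only [smul_chart_apply, x0_apply, x0fun, std, dyad, if_true, Bool.false_eq_true, if_false]
  split_ifs <;> linarith

lemma x0_std_one_one : x0 • std [true, true] = std [true] := by
  funext ⟨s, h0, h1⟩
  simp only [smul_chart_apply, x0_apply, x0fun, std, dyad, if_true]
  split_ifs <;> linarith

lemma x1_std_zero : x1 • std [false] = std [false] := by
  funext ⟨s, h0, h1⟩
  simp only [smul_chart_apply, x1_apply, x1fun, std, dyad, Bool.false_eq_true, if_false]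
  split_ifs <;> linarith

lemma x1_std_one_zero : x1 • std [true, false] = std [true, false, false] := by
  funext ⟨s, h0, h1⟩
  simp only [smul_chart_apply, x1_apply, x1fun, std, dyad, if_true, Bool.false_eq_true, if_false]
  split_ifs <;> linarith

lemma x1_std_one_one_zero : x1 • std [true, true, false] = std [true, false, true] := by
  funext ⟨s, h0, h1⟩
  simp only [smul_chart_apply, x1_apply, x1fun, std, dyad, if_true, Bool.false_eq_true, if_false]
  split_ifs <;> linarith

lemma x1_std_one_one_one : x1 • std [true, true, true] = std [true, true] := by
  funext ⟨s, h0, h1⟩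
  simp only [smul_chart_apply, x1_apply, x1fun, std, dyad, if_true]
  split_ifs <;> linarith

lemma not_mem_bad_append {h : Equiv.Perm ℝ} {u v : List Bool} (e : h • std u = std v)
    (w : List Bool) : u ++ w ∉ bad h := not_mem_bad.2 ⟨_, smul_std_append e w⟩

lemma bad_x0 : bad x0 ⊆ {[], [true]} := by
  intro u hu
  rcases u with _ | ⟨_ | _, u⟩
  · simp
  · exact absurd hu (not_mem_bad_append x0_std_zero u)
  rcases u with _ | ⟨_ | _, u⟩
  · simp
  · exact absurd hu (not_mem_bad_append x0_std_one_zero u)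
  · exact absurd hu (not_mem_bad_append x0_std_one_one u)

lemma bad_x0_inv : bad x0⁻¹ ⊆ {[], [false]} := by
  intro u hu
  rcases u with _ | ⟨_ | _, u⟩
  · simp
  · rcases u with _ | ⟨_ | _, u⟩
    · simp
    · exact absurd hu (not_mem_bad_append (smul_std_inv x0_std_zero) u)
    · exact absurd hu (not_mem_bad_append (smul_std_inv x0_std_one_zero) u)
  · exact absurd hu (not_mem_bad_append (smul_std_inv x0_std_one_one) u)

lemma bad_x1 : bad x1 ⊆ {[], [true], [true, true]} := by
  intro u hu
  rcases u with _ | ⟨_ | _, u⟩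
  · simp
  · exact absurd hu (not_mem_bad_append x1_std_zero u)
  rcases u with _ | ⟨_ | _, u⟩
  · simp
  · exact absurd hu (not_mem_bad_append x1_std_one_zero u)
  rcases u with _ | ⟨_ | _, u⟩
  · simp
  · exact absurd hu (not_mem_bad_append x1_std_one_one_zero u)
  · exact absurd hu (not_mem_bad_append x1_std_one_one_one u)

lemma bad_x1_inv : bad x1⁻¹ ⊆ {[], [true], [true, false]} := by
  intro u hu
  rcases u with _ | ⟨_ | _, u⟩
  · simp
  · exact absurd hu (not_mem_bad_append (smul_std_inv x1_std_zero) u)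
  rcases u with _ | ⟨_ | _, u⟩
  · simp
  · rcases u with _ | ⟨_ | _, u⟩
    · simp
    · exact absurd hu (not_mem_bad_append (smul_std_inv x1_std_one_zero) u)
    · exact absurd hu (not_mem_bad_append (smul_std_inv x1_std_one_one_zero) u)
  · exact absurd hu (not_mem_bad_append (smul_std_inv x1_std_one_one_one) u)

lemma isPL_x0 : IsPL x0 where
  mono a b h := by
    simp only [x0_apply, x0fun]
    split_ifs <;> linarith
  supp x hx := by
    simp only [x0_apply, x0fun]
    rw [mem_Ico] at hx
    split_ifs <;> first | rfl | (exfalso; apply hx; constructor <;> linarith) | skip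
    have : x = 1 := by by_contra h; exact hx ⟨by linarith, by grind⟩
    linarith
  fin := (Set.toFinite _).subset bad_x0

lemma isPL_x1 : IsPL x1 where
  mono a b h := by
    simp only [x1_apply, x1fun]
    split_ifs <;> linarith
  supp x hx := by
    simp only [x1_apply, x1fun]
    rw [mem_Ico] at hx
    split_ifs <;> first | rfl | (exfalso; apply hx; constructor <;> linarith) | skip
    have : x = 1 := by by_contra h; exact hx ⟨by linarith, by grind⟩
    linarith
  fin := (Set.toFinite _).subset bad_x1

lemma IsPL.inv_of_finite {h : Equiv.Perm ℝ} (hh : IsPL h) (hf : (bad h⁻¹).Finite) :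
    IsPL h⁻¹ where
  mono a b hab := by
    by_contra hle
    push Not at hle
    have := hh.mono.monotone hle
    simp only [Equiv.Perm.coe_inv, Equiv.apply_symm_apply] at this
    linarith
  supp x hx := by rw [Equiv.Perm.inv_eq_iff_eq, hh.supp x hx]
  fin := hf

lemma mem_bad_of_ne {h : Equiv.Perm ℝ} {u : List Bool}
    (hne : h (dyad u (1 / 2)) - h (dyad u 0) ≠ 2 * (h (dyad u (3 / 4)) - h (dyad u (1 / 2)))) :
    u ∈ bad h := by
  by_contra hu
  obtain ⟨v, hv⟩ := not_mem_bad.1 hu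
  have e : ∀ s ∈ Ico (0 : ℝ) 1, h (dyad u s) = dyad v s := fun s hs => congrFun hv ⟨s, hs⟩
  apply hne
  rw [e _ (by norm_num), e _ (by norm_num), e _ (by norm_num), dyad_eq v (1 / 2),
    dyad_eq v (3 / 4)]
  ring

/-- The generators and their inverses. -/
def Gen : Set (Equiv.Perm ℝ) := {x0, x1, x0⁻¹, x1⁻¹}

lemma isPL_gen {s : Equiv.Perm ℝ} (hs : s ∈ Gen) : IsPL s := by
  rcases hs with rfl | rfl | rfl | rfl
  · exact isPL_x0
  · exact isPL_x1
  · exact isPL_x0.inv_of_finite ((Set.toFinite _).subset bad_x0_inv)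
  · exact isPL_x1.inv_of_finite ((Set.toFinite _).subset bad_x1_inv)

lemma inv_mem_gen {s : Equiv.Perm ℝ} (hs : s ∈ Gen) : s⁻¹ ∈ Gen := by
  rcases hs with rfl | rfl | rfl | rfl <;> simp [Gen]

/-- The nonstandard words of `f` together with the two words `[]` and `[true]`. -/
def badp (f : Equiv.Perm ℝ) : Set (List Bool) := bad f ∪ {[], [true]}

lemma ncard_badp_mul_le {f s : Equiv.Perm ℝ} (hf : (bad f).Finite) {A C : Finset (List Bool)}
    (hA : bad s ∪ {[], [true]} ⊆ A) (hC : (C : Set (List Bool)) ⊆ bad s⁻¹ ∩ {[], [true]})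
    (hc : A.card ≤ C.card + 1) : (badp (f * s)).ncard ≤ (badp f).ncard + 1 := by
  have hfin : (badp f).Finite := hf.union (Set.toFinite _)
  have key : ∀ u ∈ badp (f * s) \ A, ∃ v, v ∈ badp f \ C ∧ s • std u = std v := by
    rintro u ⟨hu, huA⟩
    have h1 : u ∉ bad s ∪ {[], [true]} := fun h => huA (hA h)
    rcases hu with hu | hu
    · obtain ⟨v, hv⟩ := not_mem_bad.1 fun h => h1 (Or.inl h)
      refine ⟨v, ⟨Or.inl ?_, fun h => ?_⟩, hv⟩
      · rwa [bad, mem_ofPred_eq, mul_smul, hv] at hu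
      · exact (hC h).1 ⟨u, (smul_std_inv hv).symm⟩
    · exact absurd (Or.inr hu) h1
  choose! F hF1 hF2 using key
  have hinj : InjOn F (badp (f * s) \ A) := by
    intro u hu u' hu' h
    have := (hF2 u hu).trans ((congrArg std h).trans (hF2 u' hu').symm)
    exact std_injective (smul_left_cancel _ this)
  have h1 : (badp (f * s) \ A).ncard ≤ (badp f \ C).ncard :=
    ncard_le_ncard_of_injOn F hF1 hinj hfin.sdiff
  have h2 : (badp (f * s)).ncard ≤ (badp (f * s) \ A).ncard + (A : Set (List Bool)).ncard := by
    have hfin' : (badp (f * s) \ (A : Set (List Bool))).Finite :=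
      Set.Finite.of_injOn (fun u hu => hF1 u hu) hinj hfin.sdiff
    refine (ncard_le_ncard ?_ (hfin'.union (Finset.finite_toSet A))).trans (ncard_union_le _ _)
    intro u hu
    by_cases h : u ∈ (A : Set (List Bool))
    · exact Or.inr h
    · exact Or.inl ⟨hu, h⟩
  have h3 : (C : Set (List Bool)) ⊆ badp f := fun u hu => Or.inr (hC hu).2
  have h4 := ncard_sdiff_add_ncard_of_subset h3 hfin
  rw [ncard_coe_finset] at h2 h4
  omega

lemma ncard_badp_mul_gen_le {f s : Equiv.Perm ℝ} (hf : (bad f).Finite) (hs : s ∈ Gen) :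
    (badp (f * s)).ncard ≤ (badp f).ncard + 1 := by
  have m1 : [] ∈ bad x0⁻¹ := mem_bad_of_ne (by norm_num [dyad, x0_inv_apply, x0inv])
  have m2 : [] ∈ bad x0 := mem_bad_of_ne (by norm_num [dyad, x0_apply, x0fun])
  have m3 : [true] ∈ bad x0 := mem_bad_of_ne (by norm_num [dyad, x0_apply, x0fun])
  have m4 : [] ∈ bad x1⁻¹ := mem_bad_of_ne (by norm_num [dyad, x1_inv_apply, x1inv])
  have m5 : [true] ∈ bad x1⁻¹ := mem_bad_of_ne (by norm_num [dyad, x1_inv_apply, x1inv])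
  have m6 : [] ∈ bad x1 := mem_bad_of_ne (by norm_num [dyad, x1_apply, x1fun])
  have m7 : [true] ∈ bad x1 := mem_bad_of_ne (by norm_num [dyad, x1_apply, x1fun])
  have two : ∀ {B : Set (List Bool)}, [] ∈ B → [true] ∈ B →
      ((({[], [true]} : Finset (List Bool)) : Set (List Bool)) ⊆ B ∩ {[], [true]}) := by
    intro B h1 h2 u hu
    simp only [Finset.coe_insert, Finset.coe_singleton, mem_insert_iff, mem_singleton_iff] at hu
    rcases hu with rfl | rfl
    · exact ⟨h1, by simp⟩
    · exact ⟨h2, by simp⟩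
  rcases hs with rfl | rfl | rfl | rfl
  · refine ncard_badp_mul_le hf (A := {[], [true]}) (C := {[]}) ?_ ?_ (by decide)
    · exact union_subset (bad_x0.trans (by simp)) (by simp)
    · simpa using m1
  · refine ncard_badp_mul_le hf (A := {[], [true], [true, true]}) (C := {[], [true]}) ?_
      (two m4 m5) (by decide)
    exact union_subset (bad_x1.trans (by simp)) (by simp [insert_subset_iff])
  · refine ncard_badp_mul_le hf (A := {[], [false], [true]}) (C := {[], [true]}) ?_
      (two (by simpa using m2) (by simpa using m3)) (by decide)
    exact union_subset (bad_x0_inv.trans (by simp [insert_subset_iff])) (by simp [insert_subset_iff])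
  · refine ncard_badp_mul_le hf (A := {[], [true], [true, false]}) (C := {[], [true]}) ?_
      (two (by simpa using m6) (by simpa using m7)) (by decide)
    exact union_subset (bad_x1_inv.trans (by simp)) (by simp [insert_subset_iff])

lemma isPL_prod {w : List (Equiv.Perm ℝ)} (hw : ∀ s ∈ w, s ∈ Gen) : IsPL w.prod := by
  induction w with
  | nil => exact IsPL.one
  | cons s w ih =>
    rw [List.prod_cons]
    exact (isPL_gen (hw s (by simp))).mul (ih fun t ht => hw t (by simp [ht]))

lemma ncard_badp_prod_le {w : List (Equiv.Perm ℝ)} (hw : ∀ s ∈ w, s ∈ Gen) :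
    (badp w.prod).ncard ≤ w.length + 2 := by
  induction w using List.reverseRecOn with
  | nil =>
    have : bad 1 = ∅ := by ext u; simp [bad]
    rw [List.prod_nil, badp, this, empty_union]
    exact (ncard_insert_le _ _).trans (by simp)
  | append_singleton w s ih =>
    have hw' : ∀ t ∈ w, t ∈ Gen := fun t ht => hw t (by simp [ht])
    rw [List.prod_append, List.prod_singleton, List.length_append, List.length_singleton]
    have := ncard_badp_mul_gen_le (isPL_prod hw').fin (hw s (by simp))
    have := ih hw'
    omega

lemma wordLength_le {w : List (Equiv.Perm ℝ)} (hw : ∀ s ∈ w, s ∈ Gen) :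
    wordLength w.prod ≤ w.length := Nat.sInf_le ⟨w, rfl, hw, rfl⟩

lemma prod_mem {w : List (Equiv.Perm ℝ)} (hw : ∀ s ∈ w, s ∈ Gen) : w.prod ∈ ThompsonF := by
  refine Subgroup.list_prod_mem _ fun s hs => ?_
  have h0 : x0 ∈ ThompsonF := Subgroup.subset_closure (by simp)
  have h1 : x1 ∈ ThompsonF := Subgroup.subset_closure (by simp)
  rcases hw s hs with rfl | rfl | rfl | rfl
  exacts [h0, h1, inv_mem h0, inv_mem h1]

lemma exists_inv_word {w : List (Equiv.Perm ℝ)} (hw : ∀ s ∈ w, s ∈ Gen) :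
    ∃ w' : List (Equiv.Perm ℝ), w'.length = w.length ∧ (∀ s ∈ w', s ∈ Gen) ∧
      w'.prod = w.prod⁻¹ := by
  refine ⟨(w.map fun x => x⁻¹).reverse, by simp, ?_, (List.prod_inv_reverse w).symm⟩
  intro s hs
  simp only [List.mem_reverse, List.mem_map] at hs
  obtain ⟨t, ht, rfl⟩ := hs
  exact inv_mem_gen (hw t ht)

lemma exists_word_of_mem {f : Equiv.Perm ℝ} (hf : f ∈ ThompsonF) :
    ∃ w : List (Equiv.Perm ℝ), (∀ s ∈ w, s ∈ Gen) ∧ w.prod = f := by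
  induction hf using Subgroup.closure_induction with
  | mem x hx =>
    refine ⟨[x], ?_, by simp⟩
    rcases hx with rfl | rfl <;> simp [Gen]
  | one => exact ⟨[], by simp, rfl⟩
  | mul x y _ _ hx hy =>
    obtain ⟨w, hw, rfl⟩ := hx
    obtain ⟨w', hw', rfl⟩ := hy
    refine ⟨w ++ w', fun s hs => ?_, by simp⟩
    rcases List.mem_append.1 hs with h | h
    exacts [hw s h, hw' s h]
  | inv x _ hx =>
    obtain ⟨w, hw, rfl⟩ := hx
    obtain ⟨w', -, h2, h3⟩ := exists_inv_word hw
    exact ⟨w', h2, h3⟩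

lemma exists_geodesic {f : Equiv.Perm ℝ} (hf : f ∈ ThompsonF) :
    ∃ w : List (Equiv.Perm ℝ), w.length = wordLength f ∧ (∀ s ∈ w, s ∈ Gen) ∧ w.prod = f := by
  obtain ⟨w, hw, h⟩ := exists_word_of_mem hf
  exact Nat.sInf_mem (s := {n | ∃ w : List (Equiv.Perm ℝ), w.length = n ∧
    (∀ g ∈ w, g ∈ ({x0, x1, x0⁻¹, x1⁻¹} : Set (Equiv.Perm ℝ))) ∧ w.prod = f}) ⟨_, w, rfl, hw, h⟩

lemma isPL_of_mem {f : Equiv.Perm ℝ} (hf : f ∈ ThompsonF) : IsPL f := by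
  obtain ⟨w, hw, rfl⟩ := exists_word_of_mem hf
  exact isPL_prod hw

lemma ncard_bad_le {f : Equiv.Perm ℝ} (hf : f ∈ ThompsonF) :
    (bad f).ncard ≤ wordLength f + 2 := by
  obtain ⟨w, hl, hw, rfl⟩ := exists_geodesic hf
  rw [← hl]
  refine (ncard_le_ncard subset_union_left ?_).trans (ncard_badp_prod_le hw)
  exact (isPL_prod hw).fin.union (Set.toFinite _)

lemma wordLength_inv_le {f : Equiv.Perm ℝ} (hf : f ∈ ThompsonF) :
    wordLength f⁻¹ ≤ wordLength f := by
  obtain ⟨w, hl, hw, rfl⟩ := exists_geodesic hf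
  obtain ⟨w', h1, h2, h3⟩ := exists_inv_word hw
  rw [← h3, ← hl, ← h1]
  exact wordLength_le h2

section

/-- Finite rooted binary trees. -/
inductive Tree
  | leaf
  | node (a b : Tree)

namespace Tree

/-- The addresses of the leaves of a tree, from left to right. -/
def leaves : Tree → List (List Bool)
  | leaf => [[]]
  | node a b => (leaves a).map ([false] ++ ·) ++ (leaves b).map ([true] ++ ·)

/-- The number of interior vertices of a tree. -/
def carets : Tree → ℕ
  | leaf => 0
  | node a b => carets a + carets b + 1

lemma length_leaves (t : Tree) : t.leaves.length = t.carets + 1 := by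
  induction t with
  | leaf => rfl
  | node a b iha ihb => simp [leaves, carets, iha, ihb]; omega

lemma exists_leaf_mem (t : Tree) {x : ℝ} (hx : x ∈ Ico (0 : ℝ) 1) :
    ∃ u ∈ t.leaves, x ∈ cell u := by
  induction t generalizing x with
  | leaf => exact ⟨[], by simp [leaves], hx⟩
  | node a b iha ihb =>
    by_cases h : x < 1 / 2
    · obtain ⟨u, hu, hm⟩ := iha (x := 2 * x - 0) ⟨by linarith [hx.1], by linarith⟩
      exact ⟨false :: u, by simp [leaves, hu], by rw [mem_cell_cons]; simpa using hm⟩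
    · obtain ⟨u, hu, hm⟩ := ihb (x := 2 * x - 1) ⟨by linarith, by linarith [hx.2]⟩
      exact ⟨true :: u, by simp [leaves, hu], by rw [mem_cell_cons]; simpa using hm⟩

lemma exists_avoiding {B : Set (List Bool)} (hB : B.Finite) :
    ∃ t : Tree, t.carets ≤ B.ncard ∧ ∀ u ∈ t.leaves, u ∉ B := by
  induction hn : B.ncard using Nat.strong_induction_on generalizing B with
  | _ n ih =>
    by_cases h : [] ∈ B
    · have i0 : Function.Injective (List.cons false) := List.cons_injective
      have i1 : Function.Injective (List.cons true) := List.cons_injective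
      have f0 : (List.cons false ⁻¹' B).Finite := hB.preimage i0.injOn
      have f1 : (List.cons true ⁻¹' B).Finite := hB.preimage i1.injOn
      have hcard : (List.cons false ⁻¹' B).ncard + (List.cons true ⁻¹' B).ncard + 1 ≤ B.ncard := by
        rw [← ncard_image_of_injective _ i0, ← ncard_image_of_injective (List.cons true ⁻¹' B) i1,
          ← ncard_union_eq _ (f0.image _) (f1.image _),
          ← ncard_insert_of_notMem (a := []) _ ((f0.image _).union (f1.image _))]
        · refine ncard_le_ncard ?_ hB
          rintro u (rfl | ⟨v, hv, rfl⟩ | ⟨v, hv, rfl⟩)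
          exacts [h, hv, hv]
        · rintro (⟨v, hv, e⟩ | ⟨v, hv, e⟩) <;> simp at e
        · rw [Set.disjoint_left]
          rintro _ ⟨v, hv, rfl⟩ ⟨w, hw, e⟩
          simp at e
      obtain ⟨a, ha1, ha2⟩ := ih _ (by omega) f0 rfl
      obtain ⟨b, hb1, hb2⟩ := ih _ (by omega) f1 rfl
      refine ⟨node a b, by simp only [carets]; omega, ?_⟩
      intro u hu
      simp only [leaves, List.mem_append, List.mem_map] at hu
      rcases hu with ⟨v, hv, rfl⟩ | ⟨v, hv, rfl⟩
      exacts [ha2 v hv, hb2 v hv]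
    · exact ⟨leaf, by simp [carets], by simpa [leaves] using h⟩

end Tree

open Thompson.Tree

/-- The permutation `h` carries the standard charts of the words `us` to those of `vs`, in order. -/
def Maps (h : Equiv.Perm ℝ) (us vs : List (List Bool)) : Prop :=
  us.map (fun u => h • std u) = vs.map std

lemma Maps.mul {h k : Equiv.Perm ℝ} {us vs ws : List (List Bool)} (hk : Maps k us vs)
    (hh : Maps h vs ws) : Maps (h * k) us ws := by
  unfold Maps at *
  have := congrArg (List.map fun y : Chart => h • y) hk
  simp only [List.map_map, Function.comp_def, smul_smul] at this
  rw [this, ← hh]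

lemma Maps.append {h : Equiv.Perm ℝ} {us vs us' vs' : List (List Bool)} (h1 : Maps h us vs)
    (h2 : Maps h us' vs') : Maps h (us ++ us') (vs ++ vs') := by
  unfold Maps at *
  rw [List.map_append, List.map_append, h1, h2]

lemma Maps.pre {h : Equiv.Perm ℝ} {p q : List Bool} (e : h • std p = std q)
    (us : List (List Bool)) : Maps h (us.map (p ++ ·)) (us.map (q ++ ·)) := by
  simp [Maps, smul_std_append e]

lemma Maps.inv {h : Equiv.Perm ℝ} {us vs : List (List Bool)} (h1 : Maps h us vs) :
    Maps h⁻¹ vs us := by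
  unfold Maps at *
  have := congrArg (List.map fun y : Chart => h⁻¹ • y) h1
  simp only [List.map_map, Function.comp_def, inv_smul_smul] at this
  exact this.symm

lemma Maps.nil (h : Equiv.Perm ℝ) : Maps h [] [] := rfl

lemma Maps.single {h : Equiv.Perm ℝ} {u v : List Bool} (e : h • std u = std v) :
    Maps h [u] [v] := by simp [Maps, e]

lemma Maps.length_eq {h : Equiv.Perm ℝ} {us vs : List (List Bool)} (h1 : Maps h us vs) :
    us.length = vs.length := by
  simpa using congrArg List.length h1

/-- The string of `n` zeros. -/
def zeros (n : ℕ) : List Bool := List.replicate n false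

lemma zeros_append (m n : ℕ) : zeros m ++ zeros n = zeros (m + n) :=
  List.replicate_append_replicate

lemma zeros_append_append (m n : ℕ) (u : List Bool) :
    zeros m ++ (zeros n ++ u) = zeros (m + n) ++ u := by
  rw [← List.append_assoc, zeros_append]

/-- The lower leaves of a left vine. -/
def vine : ℕ → List (List Bool)
  | 0 => []
  | n + 1 => (zeros (n + 1) ++ [true]) :: vine n

lemma vine_add (m n : ℕ) : vine (m + n) = (vine m).map (zeros n ++ ·) ++ vine n := by
  induction m with
  | zero => simp [vine]
  | succ m ih =>
    rw [show m + 1 + n = (m + n) + 1 by ring, vine, ih, vine, List.map_cons, List.cons_append,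
      zeros_append_append]
    congr 3
    ring

lemma Maps.vine {h : Equiv.Perm ℝ} {p : ℕ} (e : h • std [false] = std (zeros (p + 1))) (n : ℕ) :
    Maps h (vine n) ((Thompson.vine n).map (zeros p ++ ·)) := by
  induction n with
  | zero => exact Maps.nil h
  | succ n ih =>
    have h1 : h • std (zeros (n + 1) ++ [true]) = std (zeros p ++ (zeros (n + 1) ++ [true])) := by
      have := smul_std_append e (zeros n ++ [true])
      rw [zeros_append_append] at this ⊢
      rw [show p + (n + 1) = p + 1 + n by ring, ← this]
      rfl
    exact (Maps.single h1).append ih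

/-- A word straightening a tree hanging at `10` onto the left vine. -/
def straighten : Tree → List (Equiv.Perm ℝ)
  | leaf => [x0]
  | node a b => straighten b ++ straighten a ++ [x1⁻¹]

lemma straighten_length (t : Tree) : (straighten t).length = 2 * t.carets + 1 := by
  induction t with
  | leaf => rfl
  | node a b iha ihb => simp [straighten, carets, iha, ihb]; ring

lemma straighten_gen (t : Tree) : ∀ s ∈ straighten t, s ∈ Gen := by
  induction t with
  | leaf => simp [straighten, Gen]
  | node a b iha ihb =>
    intro s hs
    simp only [straighten, List.mem_append, List.mem_singleton] at hs
    rcases hs with (h | h) | rfl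
    exacts [ihb s h, iha s h, by simp [Gen]]

lemma straighten_spec (t : Tree) :
    Maps (straighten t).prod (t.leaves.map ([true, false] ++ ·)) (vine (t.carets + 1)) ∧
    (straighten t).prod • std [true, true] = std [true] ∧
    (straighten t).prod • std [false] = std (zeros (t.carets + 2)) := by
  induction t with
  | leaf =>
    simp only [straighten, List.prod_singleton]
    exact ⟨Maps.single x0_std_one_zero, x0_std_one_one, x0_std_zero⟩
  | node a b iha ihb =>
    obtain ⟨a1, a2, a3⟩ := iha
    obtain ⟨b1, b2, b3⟩ := ihb
    simp only [straighten, List.prod_append, List.prod_singleton]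
    refine ⟨?_, ?_, ?_⟩
    · rw [show (node a b).carets + 1 = (a.carets + 1) + (b.carets + 1) by simp [carets]; ring,
        vine_add, leaves, List.map_append]
      refine Maps.append ?_ ?_
      · rw [List.map_map]
        have h1 := Maps.pre (smul_std_inv x1_std_one_zero) a.leaves
        exact h1.mul (a1.mul (Maps.vine b3 _))
      · rw [List.map_map]
        have h1 := Maps.pre (smul_std_inv x1_std_one_one_zero) b.leaves
        have h2 := Maps.pre (smul_std_append a2 [false]) b.leaves
        exact h1.mul (h2.mul b1)
    · rw [mul_smul, smul_std_inv x1_std_one_one_one, mul_smul,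
        show [true, true, true] = [true, true] ++ [true] from rfl, smul_std_append a2]
      exact b2
    · rw [mul_smul, smul_std_inv x1_std_zero, mul_smul, a3,
        show zeros (a.carets + 2) = [false] ++ zeros (a.carets + 1) from rfl, smul_std_append b3,
        zeros_append]
      congr 2
      simp only [carets]; ring

/-- A word straightening a tree hanging at `0` onto the left vine. -/
def straightenZero : Tree → List (Equiv.Perm ℝ)
  | leaf => []
  | node a b => straighten b ++ straightenZero a ++ [x0⁻¹]

lemma straightenZero_length (t : Tree) : (straightenZero t).length = 2 * t.carets := by
  induction t with
  | leaf => rfl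
  | node a b iha _ => simp [straightenZero, carets, iha, straighten_length]; ring

lemma straightenZero_gen (t : Tree) : ∀ s ∈ straightenZero t, s ∈ Gen := by
  induction t with
  | leaf => simp [straightenZero]
  | node a b iha _ =>
    intro s hs
    simp only [straightenZero, List.mem_append, List.mem_singleton] at hs
    rcases hs with (h | h) | rfl
    exacts [straighten_gen b s h, iha s h, by simp [Gen]]

lemma straightenZero_spec (t : Tree) :
    Maps (straightenZero t).prod (t.leaves.map ([false] ++ ·))
      (zeros (t.carets + 1) :: vine t.carets) ∧
    (straightenZero t).prod • std [true] = std [true] := by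
  induction t with
  | leaf =>
    simp only [straightenZero, List.prod_nil, one_smul, and_true]
    exact Maps.single (one_smul _ _)
  | node a b iha _ =>
    obtain ⟨a1, a2⟩ := iha
    obtain ⟨b1, b2, b3⟩ := straighten_spec b
    simp only [straightenZero, List.prod_append, List.prod_singleton]
    refine ⟨?_, ?_⟩
    · rw [show (node a b).carets = a.carets + (b.carets + 1) by simp [carets]; ring,
        vine_add, leaves, List.map_append, ← List.cons_append]
      refine Maps.append ?_ ?_
      · rw [List.map_map]
        have h1 := Maps.pre (smul_std_inv x0_std_zero) a.leaves
        have h2 : (straighten b).prod • std (zeros (a.carets + 1))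
            = std (zeros (a.carets + (b.carets + 1) + 1)) := by
          rw [show zeros (a.carets + 1) = [false] ++ zeros a.carets from rfl, smul_std_append b3,
            zeros_append]
          congr 2; ring
        exact h1.mul (a1.mul ((Maps.single h2).append (Maps.vine b3 _)))
      · rw [List.map_map]
        have h1 := Maps.pre (smul_std_inv x0_std_one_zero) b.leaves
        have h2 := Maps.pre (smul_std_append a2 [false]) b.leaves
        exact h1.mul (h2.mul b1)
    · rw [mul_smul, smul_std_inv x0_std_one_one, mul_smul,
        show [true, true] = [true] ++ [true] from rfl, smul_std_append a2]
      exact b2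

/-- A word straightening a tree hanging at `1` onto the left vine. -/
def straightenOne : Tree → List (Equiv.Perm ℝ)
  | leaf => []
  | node a b => straightenOne b ++ straighten a

lemma straightenOne_length (t : Tree) : (straightenOne t).length ≤ 2 * t.carets := by
  induction t with
  | leaf => rfl
  | node a b _ ihb => simp [straightenOne, carets, straighten_length]; omega

lemma straightenOne_gen (t : Tree) : ∀ s ∈ straightenOne t, s ∈ Gen := by
  induction t with
  | leaf => simp [straightenOne]
  | node a b _ ihb =>
    intro s hs
    simp only [straightenOne, List.mem_append] at hs
    rcases hs with h | h
    exacts [ihb s h, straighten_gen a s h]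

lemma straightenOne_spec (t : Tree) :
    Maps (straightenOne t).prod (t.leaves.map ([true] ++ ·)) (vine t.carets ++ [[true]]) ∧
    (straightenOne t).prod • std [false] = std (zeros (t.carets + 1)) := by
  induction t with
  | leaf =>
    simp only [straightenOne, List.prod_nil, one_smul]
    exact ⟨Maps.single (one_smul _ _), rfl⟩
  | node a b _ ihb =>
    obtain ⟨a1, a2, a3⟩ := straighten_spec a
    obtain ⟨b1, b2⟩ := ihb
    simp only [straightenOne, List.prod_append]
    refine ⟨?_, ?_⟩
    · rw [show (node a b).carets = (a.carets + 1) + b.carets by simp [carets]; ring,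
        vine_add, leaves, List.map_append, List.append_assoc]
      refine Maps.append ?_ ?_
      · rw [List.map_map]
        exact a1.mul (Maps.vine b2 _)
      · rw [List.map_map]
        exact (Maps.pre a2 b.leaves).mul b1
    · rw [mul_smul, a3, show zeros (a.carets + 2) = [false] ++ zeros (a.carets + 1) from rfl,
        smul_std_append b2, zeros_append]
      congr 2
      simp only [carets]; ring

lemma exists_straightening (a b : Tree) : ∃ w : List (Equiv.Perm ℝ),
    w.length + 2 ≤ 2 * (node a b).carets ∧ (∀ s ∈ w, s ∈ Gen) ∧
    Maps w.prod (node a b).leaves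
      (zeros (node a b).carets :: (vine ((node a b).carets - 1) ++ [[true]])) := by
  obtain ⟨a1, a2⟩ := straightenZero_spec a
  obtain ⟨b1, b2⟩ := straightenOne_spec b
  refine ⟨straightenOne b ++ straightenZero a, ?_, ?_, ?_⟩
  · have := straightenOne_length b
    rw [List.length_append, straightenZero_length, carets]
    omega
  · intro s hs
    rcases List.mem_append.1 hs with h | h
    exacts [straightenOne_gen b s h, straightenZero_gen a s h]
  · rw [show (node a b).carets - 1 = a.carets + b.carets by simp [carets], vine_add, leaves,
      List.append_assoc, ← List.cons_append, List.prod_append]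
    refine Maps.append ?_ ?_
    · have h2 : (straightenOne b).prod • std (zeros (a.carets + 1))
          = std (zeros (node a b).carets) := by
        rw [show zeros (a.carets + 1) = [false] ++ zeros a.carets from rfl, smul_std_append b2,
          zeros_append]
        congr 2
        simp only [carets]; ring
      exact a1.mul ((Maps.single h2).append (Maps.vine b2 _))
    · exact (Maps.pre a2 b.leaves).mul b1

/-- The cells of the words `us` tile the interval from `a` to `b`, in order. -/
def Tiles : ℝ → List (List Bool) → ℝ → Prop
  | a, [], b => a = b
  | a, v :: vs, b => dyad v 0 = a ∧ Tiles (dyad v 1) vs b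

lemma Tiles.append {a b c : ℝ} {us vs : List (List Bool)} (h1 : Tiles a us b)
    (h2 : Tiles b vs c) : Tiles a (us ++ vs) c := by
  induction us generalizing a with
  | nil => obtain rfl : a = b := h1; exact h2
  | cons u us ih => exact ⟨h1.1, ih h1.2⟩

lemma tiles_leaves_pre (t : Tree) (p : List Bool) :
    Tiles (dyad p 0) (t.leaves.map (p ++ ·)) (dyad p 1) := by
  induction t generalizing p with
  | leaf => simp [leaves, Tiles]
  | node a b iha ihb =>
    rw [leaves, List.map_append, List.map_map, List.map_map]
    have h1 := iha (p ++ [false])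
    have h2 := ihb (p ++ [true])
    simp only [dyad_append, dyad, Bool.false_eq_true, if_false, if_true] at h1 h2
    norm_num at h1 h2
    refine Tiles.append (b := dyad p (1 / 2)) ?_ ?_
    · simpa [Function.comp_def] using h1
    · simpa [Function.comp_def] using h2

lemma tiles_leaves (t : Tree) : Tiles 0 t.leaves 1 := by
  simpa using tiles_leaves_pre t []

lemma map_lo {h : Equiv.Perm ℝ} {u v : List Bool} (e : h • std u = std v) :
    h (dyad u 0) = dyad v 0 := congrFun e ⟨0, by norm_num⟩

lemma IsPL.map_hi {h : Equiv.Perm ℝ} (hh : IsPL h) {u v : List Bool} (e : h • std u = std v) :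
    h (dyad u 1) = dyad v 1 := by
  apply le_antisymm
  · by_contra hlt
    push Not at hlt
    have h1 : dyad v 0 < dyad v 1 := dyad_strictMono v one_pos
    have h2 : h⁻¹ (dyad v 1) < dyad u 1 := by
      rw [← hh.mono.lt_iff_lt]; simpa using hlt
    have h3 : dyad u 0 ≤ h⁻¹ (dyad v 1) := by
      rw [← hh.mono.le_iff_le, map_lo e]; simpa using h1.le
    have h4 := (image_cell e).2 (show h⁻¹ (dyad v 1) ∈ cell u from ⟨h3, h2⟩)
    simp only [Equiv.Perm.coe_inv, Equiv.apply_symm_apply] at h4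
    exact lt_irrefl _ h4.2
  · by_contra hlt
    push Not at hlt
    have h1 : dyad u 0 < dyad u 1 := dyad_strictMono u one_pos
    have h2 : h (dyad u 1) ∈ cell v := ⟨by rw [← map_lo e]; exact (hh.mono h1).le, hlt⟩
    exact lt_irrefl _ ((image_cell e).1 h2).2

lemma Tiles.map {h : Equiv.Perm ℝ} (hh : IsPL h) {us vs : List (List Bool)} (hm : Maps h us vs)
    {a b : ℝ} (ht : Tiles a us b) : Tiles (h a) vs (h b) := by
  induction us generalizing a vs with
  | nil =>
    have : vs = [] := by simpa [Maps, eq_comm] using hm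
    subst this
    exact congrArg h ht
  | cons u us ih =>
    cases vs with
    | nil => simp [Maps] at hm
    | cons v vs =>
      simp only [Maps, List.map_cons, List.cons.injEq] at hm
      refine ⟨?_, ?_⟩
      · rw [← map_lo hm.1, ht.1]
      · rw [← hh.map_hi hm.1]; exact ih hm.2 ht.2

lemma Tiles.split_one {a : ℝ} {vs : List (List Bool)} (ha : 1 / 2 ≤ a) (ht : Tiles a vs 1) :
    ∃ bs, vs = bs.map ([true] ++ ·) ∧ Tiles (2 * a - 1) bs 1 := by
  induction vs generalizing a with
  | nil =>
    obtain rfl : a = 1 := ht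
    exact ⟨[], rfl, by norm_num [Tiles]⟩
  | cons v vs ih =>
    obtain ⟨h1, h2⟩ := ht
    rcases v with _ | ⟨_ | _, v⟩
    · norm_num [dyad] at h1; linarith
    · have := (dyad_mem v (s := 0) (by norm_num)).2
      simp [dyad] at h1; linarith
    · have h3 : 1 / 2 ≤ dyad (true :: v) 1 := by
        have := dyad_nonneg v (s := 1) (by norm_num)
        simp only [dyad, if_true]; linarith
      obtain ⟨bs, rfl, h4⟩ := ih h3 h2
      refine ⟨v :: bs, rfl, ?_, ?_⟩
      · simp only [dyad, if_true] at h1; linarith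
      · convert h4 using 1
        simp only [dyad, if_true]; ring

lemma Tiles.split_zero {a : ℝ} {vs : List (List Bool)} (ha0 : 0 < a) (ha : a ≤ 1 / 2)
    (ht : Tiles a vs 1) : ∃ as bs, vs = as.map ([false] ++ ·) ++ bs.map ([true] ++ ·) ∧
      Tiles (2 * a) as 1 ∧ Tiles 0 bs 1 := by
  induction vs generalizing a with
  | nil =>
    obtain rfl : a = 1 := ht
    norm_num at ha
  | cons v vs ih =>
    rcases ha.eq_or_lt with rfl | hlt
    · obtain ⟨bs, h1, h2⟩ := ht.split_one le_rfl
      exact ⟨[], bs, by simpa using h1, by norm_num [Tiles], by norm_num at h2; exact h2⟩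
    obtain ⟨h1, h2⟩ := ht
    rcases v with _ | ⟨_ | _, v⟩
    · simp [dyad] at h1; linarith
    · have h3 : dyad (false :: v) 1 ≤ 1 / 2 := by
        have := dyad_le_one v (s := 1) le_rfl
        simp [dyad]; linarith
      have h4 : 0 < dyad (false :: v) 1 :=
        lt_of_le_of_lt (dyad_nonneg _ le_rfl) (dyad_strictMono _ one_pos)
      obtain ⟨as, bs, rfl, h5, h6⟩ := ih h4 h3 h2
      refine ⟨v :: as, bs, rfl, ⟨?_, ?_⟩, h6⟩
      · simp [dyad] at h1; linarith
      · convert h5 using 1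
        simp [dyad]; ring
    · have := dyad_nonneg v (s := 0) le_rfl
      simp only [dyad, if_true] at h1; linarith

lemma exists_tree_of_tiles {vs : List (List Bool)} (ht : Tiles 0 vs 1) :
    ∃ t : Tree, t.leaves = vs := by
  induction hn : vs.length using Nat.strong_induction_on generalizing vs with
  | _ n ih =>
    have ne_nil : ∀ {ws : List (List Bool)}, Tiles 0 ws 1 → 0 < ws.length := by
      intro ws hw
      rcases ws with _ | ⟨w, ws⟩
      · norm_num [Tiles] at hw
      · simp
    rcases vs with _ | ⟨v, vs⟩
    · norm_num [Tiles] at ht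
    obtain ⟨h1, h2⟩ := ht
    rcases v with _ | ⟨_ | _, v⟩
    · rcases vs with _ | ⟨w, vs⟩
      · exact ⟨leaf, rfl⟩
      · have := (dyad_mem w (s := 0) (by norm_num)).2
        have h3 : dyad w 0 = 1 := h2.1
        linarith
    · have h3 : dyad (false :: v) 1 ≤ 1 / 2 := by
        have := dyad_le_one v (s := 1) le_rfl
        simp [dyad]; linarith
      have h4 : 0 < dyad (false :: v) 1 :=
        lt_of_le_of_lt (dyad_nonneg _ le_rfl) (dyad_strictMono _ one_pos)
      obtain ⟨as, bs, rfl, h5, h6⟩ := h2.split_zero h4 h3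
      have h7 : Tiles 0 (v :: as) 1 := by
        refine ⟨?_, ?_⟩
        · simp [dyad] at h1; linarith
        · convert h5 using 1
          simp [dyad]; ring
      simp only [List.length_cons, List.length_append, List.length_map] at hn
      obtain ⟨ta, hta⟩ := ih (as.length + 1) (by have := ne_nil h6; omega) h7 rfl
      obtain ⟨tb, htb⟩ := ih bs.length (by omega) h6 rfl
      exact ⟨node ta tb, by simp [leaves, hta, htb]⟩
    · have := dyad_nonneg v (s := 0) le_rfl
      simp only [dyad, if_true] at h1; linarith

lemma IsPL.eq_of_agree {h k : Equiv.Perm ℝ} (hh : IsPL h) (hk : IsPL k) (t : Tree)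
    (ht : ∀ u ∈ t.leaves, h • std u = k • std u) : h = k := by
  ext x
  by_cases hx : x ∈ Ico (0 : ℝ) 1
  · obtain ⟨u, hu, hxu⟩ := t.exists_leaf_mem hx
    rw [← range_std] at hxu
    obtain ⟨s, rfl⟩ := hxu
    exact congrFun (ht u hu) s
  · rw [hh.supp x hx, hk.supp x hx]

/-- A nontrivial piecewise dyadic map lies in Thompson's group, with controlled word length. -/
lemma IsPL.exists_word {h : Equiv.Perm ℝ} (hh : IsPL h) (h1 : h ≠ 1) :
    ∃ w : List (Equiv.Perm ℝ), w.length + 4 ≤ 4 * (bad h).ncard ∧ (∀ s ∈ w, s ∈ Gen) ∧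
      w.prod = h := by
  obtain ⟨t, hc, ht⟩ := Tree.exists_avoiding hh.fin
  have key : ∀ u, ∃ v, u ∈ t.leaves → h • std u = std v := by
    intro u
    by_cases hu : u ∈ t.leaves
    · obtain ⟨v, hv⟩ := not_mem_bad.1 (ht u hu)
      exact ⟨v, fun _ => hv⟩
    · exact ⟨[], fun h => absurd h hu⟩
  choose F hF using key
  have hm : Maps h t.leaves (t.leaves.map F) := by
    simp only [Maps, List.map_map]
    exact List.map_congr_left hF
  have hT : Tiles 0 (t.leaves.map F) 1 := by
    have := (tiles_leaves t).map hh hm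
    have h0 : h 0 = 0 := by
      rcases (hh.mono.lt_iff_lt (a := 0) (b := 1)).2 one_pos with h'
      rw [hh.supp 1 (by norm_num)] at h'
      by_contra hne
      rcases lt_or_gt_of_ne hne with h2 | h2
      · have := hh.supp (h 0) (fun h3 => by linarith [h3.1])
        exact hne (h.injective this)
      · have h4 : h⁻¹ 0 < 0 := by
          rw [← hh.mono.lt_iff_lt]; simpa using h2
        have h5 := hh.supp (h⁻¹ 0) (fun h3 => by linarith [h3.1])
        simp only [Equiv.Perm.coe_inv, Equiv.apply_symm_apply] at h5 h4
        linarith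
    rwa [h0, hh.supp 1 (by norm_num)] at this
  obtain ⟨t', ht'⟩ := exists_tree_of_tiles hT
  rw [← ht'] at hm
  have hcc : t.carets = t'.carets := by
    have := hm.length_eq
    rw [length_leaves, length_leaves] at this
    omega
  have fin : ∀ w : List (Equiv.Perm ℝ), (∀ s ∈ w, s ∈ Gen) →
      Maps w.prod t.leaves t'.leaves → w.prod = h := by
    intro w hw hmw
    refine (isPL_prod hw).eq_of_agree hh t fun u hu => ?_
    exact List.map_inj_left.1 (hmw.trans hm.symm) u hu
  rcases t with _ | ⟨a, b⟩
  · rcases t' with _ | ⟨a', b'⟩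
    · exact absurd (fin [] (by simp) (by simp [Maps])).symm h1
    · simp [carets] at hcc
  · rcases t' with _ | ⟨a', b'⟩
    · simp [carets] at hcc
    · obtain ⟨w, hw1, hw2, hw3⟩ := exists_straightening a b
      obtain ⟨w', hw1', hw2', hw3'⟩ := exists_straightening a' b'
      obtain ⟨v, hv1, hv2, hv3⟩ := exists_inv_word hw2'
      have hgen : ∀ s ∈ v ++ w, s ∈ Gen := by
        intro s hs
        rcases List.mem_append.1 hs with h | h
        exacts [hv2 s h, hw2 s h]
      refine ⟨v ++ w, ?_, hgen, fin _ hgen ?_⟩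
      · rw [List.length_append]; omega
      · rw [List.prod_append, hv3]
        refine hw3.mul (Maps.inv ?_)
        rw [hcc]; exact hw3'

lemma IsPL.mem {h : Equiv.Perm ℝ} (hh : IsPL h) : h ∈ ThompsonF := by
  by_cases h1 : h = 1
  · rw [h1]; exact one_mem _
  · obtain ⟨w, -, hw, rfl⟩ := hh.exists_word h1
    exact prod_mem hw

lemma IsPL.inv {h : Equiv.Perm ℝ} (hh : IsPL h) : IsPL h⁻¹ := isPL_of_mem (inv_mem hh.mem)

lemma IsPL.zpow {h : Equiv.Perm ℝ} (hh : IsPL h) (n : ℤ) : IsPL (h ^ n) :=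
  isPL_of_mem (zpow_mem hh.mem n)

lemma IsPL.wordLength_le {h : Equiv.Perm ℝ} (hh : IsPL h) (h1 : h ≠ 1) :
    wordLength h + 4 ≤ 4 * (bad h).ncard := by
  obtain ⟨w, hl, hw, rfl⟩ := hh.exists_word h1
  have := Thompson.wordLength_le hw
  omega

/-- The word length is controlled by the number of charts on which standardness changes. -/
lemma IsPL.wordLength_le_two {h : Equiv.Perm ℝ} (hh : IsPL h) (h1 : h ≠ 1) :
    wordLength h + 4 ≤ 2 * ((bad h).ncard + (bad h⁻¹).ncard) := by
  have h2 := hh.wordLength_le h1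
  have h3 := hh.inv.wordLength_le (inv_ne_one.2 h1)
  have h4 := wordLength_inv_le hh.inv.mem
  rw [inv_inv] at h4
  omega

end

section

variable {f : Equiv.Perm ℝ} {x : ℝ}

lemma zpow_succ_apply (f : Equiv.Perm ℝ) (t : ℤ) (x : ℝ) : (f ^ (t + 1)) x = f ((f ^ t) x) := by
  rw [add_comm, zpow_one_add, Equiv.Perm.mul_apply]

lemma zpow_add_apply (f : Equiv.Perm ℝ) (s t : ℤ) (x : ℝ) :
    (f ^ (s + t)) x = (f ^ s) ((f ^ t) x) := by
  rw [zpow_add, Equiv.Perm.mul_apply]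

lemma zpow_apply_apply (f : Equiv.Perm ℝ) (t : ℤ) (x : ℝ) : (f ^ t) (f x) = (f ^ (t + 1)) x := by
  rw [zpow_add_apply, zpow_one]

lemma zpow_apply_ne (hx : f x ≠ x) (t : ℤ) : f ((f ^ t) x) ≠ (f ^ t) x := by
  rw [← zpow_succ_apply, zpow_add_apply, zpow_one]
  exact fun h => hx ((f ^ t).injective h)

lemma zpow_fixed {q : ℝ} (hq : f q = q) (t : ℤ) : (f ^ t) q = q := by
  induction t with
  | zero => simp
  | succ n ih => rw [zpow_succ_apply, ih, hq]
  | pred n ih =>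
    rw [sub_eq_add_neg, zpow_add_apply, zpow_neg_one]
    conv_lhs => rw [show f⁻¹ q = q by rw [Equiv.Perm.inv_eq_iff_eq, hq]]
    exact ih

lemma IsPL.mem_unit (hf : IsPL f) (hx : f x ≠ x) : x ∈ Ico (0 : ℝ) 1 := by
  by_contra h
  exact hx (hf.supp x h)

lemma inv_apply_ne (hx : f x ≠ x) : f⁻¹ x ≠ x := by
  rw [Ne, Equiv.Perm.inv_eq_iff_eq]
  exact fun h => hx h.symm

lemma IsPL.fixed_zero (hf : IsPL f) : f 0 = 0 := by
  by_contra hne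
  have h1 : f (f⁻¹ 0) = 0 := by simp
  have h2 := (hf.mem_unit hne)
  rcases lt_or_gt_of_ne hne with h | h
  · exact hne (f.injective (hf.supp (f 0) (fun h3 => by linarith [h3.1])))
  · have h4 : f⁻¹ 0 < 0 := by
      rw [← hf.mono.lt_iff_lt, h1]; exact h
    have h5 := hf.supp (f⁻¹ 0) (fun h3 => by linarith [h3.1])
    rw [h1] at h5
    linarith

lemma IsPL.fixed_one (hf : IsPL f) : f 1 = 1 := hf.supp 1 (by norm_num)

/-! ### Attracting and repelling cells -/

/-- The point `x` lies in a standard cell that `f` contracts into itself. -/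
def Att (f : Equiv.Perm ℝ) (x : ℝ) : Prop :=
  ∃ u w : List Bool, w ≠ [] ∧ f • std u = std (u ++ w) ∧ x ∈ cell u

/-- The `n`-fold repetition of a word. -/
def rpt (w : List Bool) : ℕ → List Bool
  | 0 => []
  | n + 1 => w ++ rpt w n

lemma length_rpt (w : List Bool) (n : ℕ) : (rpt w n).length = n * w.length := by
  induction n with
  | zero => simp [rpt]
  | succ n ih => simp [rpt, ih]; ring

lemma le_length_rpt {w : List Bool} (hw : w ≠ []) (n : ℕ) : n ≤ (rpt w n).length := by
  rw [length_rpt]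
  exact Nat.le_mul_of_pos_right _ (List.length_pos_iff.2 hw)

lemma Att.apply (h : Att f x) : Att f (f x) := by
  obtain ⟨u, w, hw, e, hx⟩ := h
  exact ⟨u, w, hw, e, cell_append_subset u w ((image_cell e).2 hx)⟩

lemma pow_mem_cell_rpt {u w : List Bool} (e : f • std u = std (u ++ w)) (n : ℕ)
    (hx : x ∈ cell u) : (f ^ n) x ∈ cell (u ++ rpt w n) := by
  induction n with
  | zero => simpa [rpt] using hx
  | succ n ih =>
    rw [pow_succ', Equiv.Perm.mul_apply]
    have := (image_cell (smul_std_append e (rpt w n))).2 ih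
    rwa [List.append_assoc] at this

lemma Att.not_att_inv (h : Att f x) : ¬ Att f⁻¹ x := by
  have key : ∀ {f : Equiv.Perm ℝ} {u w p w' : List Bool}, w ≠ [] → f • std u = std (u ++ w) →
      f⁻¹ • std (u ++ p) = std (u ++ p ++ w') → False := by
    intro f u w p w' hw e e'
    have h1 := smul_std_append e (p ++ w')
    have h2 := smul_std_inv e'
    rw [inv_inv, List.append_assoc, h1] at h2
    have := congrArg List.length (std_injective h2)
    simp only [List.length_append] at this
    have := List.length_pos_iff.2 hw
    omega
  obtain ⟨u, w, hw, e, hx⟩ := h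
  rintro ⟨v, w', hw', e', hx'⟩
  rcases prefix_or_prefix hx hx' with ⟨p, rfl⟩ | ⟨p, rfl⟩
  · exact key hw e e'
  · exact key (f := f⁻¹) hw' e' (by rwa [inv_inv])

lemma exists_not_att (hx : f x ≠ x) : ∃ n : ℕ, ¬ Att f ((f ^ (-(n : ℤ))) x) := by
  obtain ⟨n, hn⟩ := length_bound hx.symm
  refine ⟨n, ?_⟩
  rintro ⟨u, w, hw, e, hm⟩
  have h1 := pow_mem_cell_rpt e n hm
  rw [zpow_neg, zpow_natCast, Equiv.Perm.coe_inv, Equiv.apply_symm_apply] at h1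
  have h2 := pow_mem_cell_rpt e 1 (cell_append_subset u _ h1)
  have h3 : f x ∈ cell (u ++ rpt w n) := by
    have := (image_cell (smul_std_append e (rpt w n))).2 h1
    have e2 : ∀ n, w ++ rpt w n = rpt w n ++ w := by
      intro n
      induction n with
      | zero => simp [rpt]
      | succ n ih => simp only [rpt]; rw [List.append_assoc, ← ih]
    rw [List.append_assoc, e2, ← List.append_assoc] at this
    exact cell_append_subset _ _ this
  have := hn _ h1 h3
  have := le_length_rpt hw n
  simp only [List.length_append] at *
  omega

/-! ### Orbits -/

lemma zpow_strictMono (hf : IsPL f) (t : ℤ) : StrictMono (f ^ t : Equiv.Perm ℝ) := (hf.zpow t).mono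

lemma orbit_strictMono (hf : IsPL f) (h : x < f x) : StrictMono fun t : ℤ => (f ^ t) x := by
  refine strictMono_int_of_lt_succ fun t => ?_
  rw [zpow_add_apply, zpow_one]
  exact zpow_strictMono hf t h

lemma orbit_strictAnti (hf : IsPL f) (h : f x < x) : StrictAnti fun t : ℤ => (f ^ t) x := by
  refine strictAnti_int_of_succ_lt fun t => ?_
  rw [zpow_add_apply, zpow_one]
  exact zpow_strictMono hf t h

/-- The fundamental interval of the orbit of `x` at time `t`. -/
def step (f : Equiv.Perm ℝ) (x : ℝ) (t : ℤ) : Set ℝ :=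
  Ioc (min ((f ^ t) x) ((f ^ (t + 1)) x)) (max ((f ^ t) x) ((f ^ (t + 1)) x))

lemma step_disjoint (hf : IsPL f) (hx : f x ≠ x) {s t : ℤ} {p : ℝ} (hs : p ∈ step f x s)
    (ht : p ∈ step f x t) : s = t := by
  by_contra hne
  wlog hlt : s < t generalizing s t
  · exact this ht hs (Ne.symm hne) (lt_of_le_of_ne (not_lt.1 hlt) (Ne.symm hne))
  rcases lt_or_gt_of_ne hx with h | h
  · have hm := orbit_strictAnti hf h
    have h1 := hm (show s < s + 1 by omega)
    have h2 := hm (show t < t + 1 by omega)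
    have h3 := hm.antitone (show s + 1 ≤ t by omega)
    simp only [step] at hs ht h1 h2 h3
    rw [min_eq_right h1.le, max_eq_left h1.le] at hs
    rw [min_eq_right h2.le, max_eq_left h2.le] at ht
    linarith [hs.1, ht.2]
  · have hm := orbit_strictMono hf h
    have h1 := hm (show s < s + 1 by omega)
    have h2 := hm (show t < t + 1 by omega)
    have h3 := hm.monotone (show s + 1 ≤ t by omega)
    simp only [step] at hs ht h1 h2 h3
    rw [min_eq_left h1.le, max_eq_right h1.le] at hs
    rw [min_eq_left h2.le, max_eq_right h2.le] at ht
    linarith [hs.2, ht.1]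

/-- The standard cell of `u` meets its image. -/
def Ov (f : Equiv.Perm ℝ) (u : List Bool) : Prop := ∃ z ∈ cell u, f z ∈ cell u

/-- The nonstandard words whose cell meets its image. -/
def badOv (f : Equiv.Perm ℝ) : Set (List Bool) := {v | v ∈ bad f ∧ Ov f v}

/-- The nonstandard words whose cell meets its image and has its midpoint in `S`. -/
def badOvIn (f : Equiv.Perm ℝ) (S : Set ℝ) : Set (List Bool) :=
  {v | v ∈ badOv f ∧ dyad v (1 / 2) ∈ S}

lemma badOvIn_subset (f : Equiv.Perm ℝ) (S : Set ℝ) : badOvIn f S ⊆ badOv f := fun _ h => h.1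

lemma IsPL.badOv_finite (hf : IsPL f) : (badOv f).Finite := hf.fin.subset fun _ h => h.1

lemma IsPL.badOvIn_finite (hf : IsPL f) (S : Set ℝ) : (badOvIn f S).Finite :=
  hf.badOv_finite.subset (badOvIn_subset f S)

lemma eq_zeros_or (u : List Bool) : u = zeros u.length ∨ ∃ v l, u = v ++ (true :: zeros l) := by
  induction u with
  | nil => exact Or.inl rfl
  | cons b u ih =>
    rcases ih with h | ⟨v, l, h⟩
    · cases b
      · left; rw [h]; simp [zeros, List.replicate_succ]
      · right; exact ⟨[], u.length, by rw [List.nil_append, ← h]⟩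
    · right; exact ⟨b :: v, l, by rw [h]; rfl⟩

lemma dyad_zeros (l : ℕ) : dyad (zeros l) 0 = 0 := by
  induction l with
  | zero => rfl
  | succ l ih =>
    have : zeros (l + 1) = false :: zeros l := rfl
    rw [this]; simp [dyad, ih]

lemma dyad_true_zeros (v : List Bool) (l : ℕ) :
    dyad (v ++ true :: zeros l) 0 = dyad v (1 / 2) := by
  rw [dyad_append]; simp [dyad, dyad_zeros]

/-- No standardly mapped cell contains both `x` and its image at time `t`. -/
def Jump (f : Equiv.Perm ℝ) (x : ℝ) (t : ℤ) : Prop :=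
  ∀ u, u ∉ bad f → (f ^ t) x ∈ cell u → (f ^ (t + 1)) x ∈ cell u → False

lemma IsPL.exists_bound (hf : IsPL f) : ∃ N : ℕ, ∀ u : List Bool, N ≤ u.length → u ∉ bad f := by
  obtain ⟨N, hN⟩ := (hf.fin.image List.length).bddAbove
  refine ⟨N + 1, fun u hu hb => ?_⟩
  have := hN ⟨u, hb, rfl⟩
  omega

lemma Jump.exists_badOv (hf : IsPL f) (hx : f x ≠ x) {t : ℤ} (ht : Jump f x t) :
    ∃ v ∈ badOv f, dyad v (1 / 2) ∈ step f x t := by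
  classical
  set M := max ((f ^ t) x) ((f ^ (t + 1)) x) with hM
  set m := min ((f ^ t) x) ((f ^ (t + 1)) x) with hm
  have hM1 : M ∈ Ico (0 : ℝ) 1 := by
    rcases max_choice ((f ^ t) x) ((f ^ (t + 1)) x) with h | h <;> rw [hM, h]
    · exact hf.mem_unit (zpow_apply_ne hx t)
    · exact hf.mem_unit (zpow_apply_ne hx (t + 1))
  obtain ⟨N, hN⟩ := hf.exists_bound
  have hex : ∃ n, ∃ u : List Bool, u.length = n ∧ M ∈ cell u ∧ (u ∉ bad f ∨ ¬ Ov f u) := by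
    obtain ⟨u, hu, hMu⟩ := exists_word hM1 N
    exact ⟨N, u, hu, hMu, Or.inl (hN u hu.ge)⟩
  obtain ⟨u, hu, hMu, hadm⟩ := Nat.find_spec hex
  have hmin := fun k (hk : k < Nat.find hex) => Nat.find_min hex hk
  have hm_notin : m ∉ cell u := by
    intro hmu
    have h1 : (f ^ t) x ∈ cell u ∧ (f ^ (t + 1)) x ∈ cell u := by
      rcases le_total ((f ^ t) x) ((f ^ (t + 1)) x) with h | h
      · rw [hm, min_eq_left h] at hmu; rw [hM, max_eq_right h] at hMu
        exact ⟨hmu, hMu⟩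
      · rw [hm, min_eq_right h] at hmu; rw [hM, max_eq_left h] at hMu
        exact ⟨hMu, hmu⟩
    rcases hadm with h | h
    · exact ht u h h1.1 h1.2
    · exact h ⟨_, h1.1, by rw [← zpow_succ_apply]; exact h1.2⟩
  have hlt : m < dyad u 0 := by
    by_contra hle
    push Not at hle
    exact hm_notin ⟨hle, lt_of_le_of_lt min_le_max hMu.2⟩
  have hm0 : 0 ≤ m := by
    rcases min_choice ((f ^ t) x) ((f ^ (t + 1)) x) with h | h <;> rw [hm, h]
    · exact (hf.mem_unit (zpow_apply_ne hx t)).1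
    · exact (hf.mem_unit (zpow_apply_ne hx (t + 1))).1
  rcases eq_zeros_or u with h | ⟨v, l, rfl⟩
  · rw [h, dyad_zeros] at hlt; linarith
  · have hv := hmin v.length (by rw [← hu]; simp)
    push Not at hv
    have := hv v rfl (cell_append_subset _ _ hMu)
    rw [dyad_true_zeros] at hlt
    refine ⟨v, this, hlt, ?_⟩
    rw [← dyad_true_zeros v l]; exact hMu.1

lemma jumps_finite (hf : IsPL f) (hx : f x ≠ x) {S : Set ℝ} (hS : ∀ t, step f x t ⊆ S) :
    {t | Jump f x t}.Finite ∧ {t | Jump f x t}.ncard ≤ (badOvIn f S).ncard := by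
  have key : ∀ t ∈ {t | Jump f x t}, ∃ v, v ∈ badOvIn f S ∧ dyad v (1 / 2) ∈ step f x t := by
    intro t ht
    obtain ⟨v, hv, hm⟩ := Jump.exists_badOv hf hx ht
    exact ⟨v, ⟨hv, hS t hm⟩, hm⟩
  choose! F hF1 hF2 using key
  have hinj : InjOn F {t | Jump f x t} := by
    intro s hs t ht h
    have := hF2 s hs
    rw [h] at this
    exact step_disjoint hf hx this (hF2 t ht)
  exact ⟨Set.Finite.of_injOn hF1 hinj (hf.badOvIn_finite S),
    ncard_le_ncard_of_injOn F hF1 hinj (hf.badOvIn_finite S)⟩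

lemma att_or_rep_of_not_jump (hx : f x ≠ x) {t : ℤ} (h : ¬ Jump f x t) :
    Att f ((f ^ t) x) ∨ Att f⁻¹ ((f ^ (t + 2)) x) := by
  simp only [Jump, not_forall] at h
  obtain ⟨u, hu, h1, h2, -⟩ := h
  obtain ⟨v, e⟩ := not_mem_bad.1 hu
  have h3 : (f ^ (t + 1)) x ∈ cell v := by rw [zpow_succ_apply]; exact (image_cell e).2 h1
  have hne : ∀ w, v = u ++ w → w ≠ [] := by
    rintro w rfl rfl
    rw [← range_std] at h1
    obtain ⟨s, hs⟩ := h1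
    have := congrFun e s
    rw [List.append_nil, hs, smul_chart_apply, hs] at this
    exact zpow_apply_ne hx t this
  rcases prefix_or_prefix h2 h3 with ⟨w, rfl⟩ | ⟨w, rfl⟩
  · exact Or.inl ⟨u, w, hne w rfl, e, h1⟩
  · refine Or.inr ⟨v, w, fun hw => ?_, smul_std_inv e, ?_⟩
    · subst hw; exact hne [] (by simp) rfl
    · rw [show t + 2 = t + 1 + 1 by ring, zpow_succ_apply]
      exact (image_cell e).2 h2

/-- The window of the orbit of `x`: attracting exactly from time `C` on, repelling exactly up to
time `E`. -/
structure Window (f : Equiv.Perm ℝ) (x : ℝ) (E C : ℤ) : Prop where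
  att : ∀ t : ℤ, Att f ((f ^ t) x) ↔ C ≤ t
  rep : ∀ t : ℤ, Att f⁻¹ ((f ^ t) x) ↔ t ≤ E

lemma Window.lt {E C : ℤ} (h : Window f x E C) : E < C := by
  by_contra hle
  push Not at hle
  exact ((h.att C).2 le_rfl).not_att_inv ((h.rep C).2 hle)

lemma exists_least_time {P : ℤ → Prop} (hs : ∀ t, P t → P (t + 1)) (h1 : ∃ t, P t)
    (h2 : ∃ t, ¬ P t) : ∃ C, ∀ t, P t ↔ C ≤ t := by
  have up : ∀ s t, s ≤ t → P s → P t := by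
    intro s t hst hp
    induction t, hst using Int.leInduction with
    | base => exact hp
    | succ n _ ih => exact hs n ih
  obtain ⟨a, ha⟩ := h2
  obtain ⟨C, hC, hmin⟩ := Int.exists_least_of_bdd (P := P)
    ⟨a, fun z hz => by by_contra h; exact ha (up z a (by omega) hz)⟩ h1
  exact ⟨C, fun t => ⟨hmin t, fun h => up C t h hC⟩⟩

lemma exists_att (hf : IsPL f) (hx : f x ≠ x) : ∃ t : ℤ, Att f ((f ^ t) x) := by
  obtain ⟨n, hn⟩ := exists_not_att (f := f⁻¹) (inv_apply_ne hx)
  have hfin := (jumps_finite hf hx (S := univ) (fun _ => subset_univ _)).1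
  obtain ⟨M, hM⟩ := hfin.bddAbove
  have hrep : ∀ t : ℤ, (n : ℤ) ≤ t → ¬ Att f⁻¹ ((f ^ t) x) := by
    intro t ht
    induction t, ht using Int.leInduction with
    | base => rwa [inv_zpow, zpow_neg, inv_inv] at hn
    | succ k _ ih =>
      intro h
      have := h.apply
      rw [zpow_succ_apply, Equiv.Perm.coe_inv, Equiv.symm_apply_apply] at this
      exact ih this
  set t := max (M + 1) n
  have hnj : ¬ Jump f x t := fun h => by
    have := hM h
    have := le_max_left (M + 1) (n : ℤ)
    omega
  rcases att_or_rep_of_not_jump hx hnj with h | h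
  · exact ⟨t, h⟩
  · exact absurd h (hrep _ (by have := le_max_right (M + 1) (n : ℤ); omega))

lemma exists_window (hf : IsPL f) (hx : f x ≠ x) : ∃ E C, Window f x E C := by
  have key : ∀ {f : Equiv.Perm ℝ}, IsPL f → f x ≠ x → ∃ C, ∀ t : ℤ, Att f ((f ^ t) x) ↔ C ≤ t := by
    intro f hf hx
    refine exists_least_time (P := fun t => Att f ((f ^ t) x)) (fun t ht => ?_)
      (exists_att hf hx) ?_
    · simp only [zpow_succ_apply]; exact ht.apply
    · obtain ⟨n, hn⟩ := exists_not_att hx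
      exact ⟨_, hn⟩
  obtain ⟨C, hC⟩ := key hf hx
  obtain ⟨E, hE⟩ := key hf.inv (inv_apply_ne hx)
  refine ⟨-E, C, hC, fun t => ?_⟩
  have := hE (-t)
  rw [inv_zpow, zpow_neg, inv_inv] at this
  rw [this]; omega

lemma Window.card_le (hf : IsPL f) (hx : f x ≠ x) {E C : ℤ} (h : Window f x E C) {S : Set ℝ}
    (hS : ∀ t, step f x t ⊆ S) : C - E + 1 ≤ ((badOvIn f S).ncard : ℤ) := by
  obtain ⟨h1, h2⟩ := jumps_finite hf hx hS
  have h3 : ((Finset.Icc (E - 1) (C - 1) : Finset ℤ) : Set ℤ) ⊆ {t | Jump f x t} := by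
    intro t ht
    rw [Finset.coe_Icc, mem_Icc] at ht
    by_contra hj
    rcases att_or_rep_of_not_jump hx hj with h' | h'
    · rw [h.att] at h'; omega
    · rw [h.rep] at h'; omega
  have h4 := ncard_le_ncard h3 h1
  rw [ncard_coe_finset, Int.card_Icc] at h4
  have := h.lt
  omega

lemma Window.shift {E C : ℤ} (h : Window f x E C) (s : ℤ) :
    Window f ((f ^ s) x) (E - s) (C - s) where
  att t := by rw [← zpow_add_apply, h.att]; omega
  rep t := by rw [← zpow_add_apply, h.rep]; omega

lemma Window.inv {E C : ℤ} (h : Window f x E C) : Window f⁻¹ x (-C) (-E) where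
  att t := by rw [inv_zpow', h.rep]; omega
  rep t := by rw [inv_inv, inv_zpow', h.att]; omega

lemma cell_ordConnected (u : List Bool) : (cell u).OrdConnected := ordConnected_Ico

lemma uIcc_zpow_subset (hf : IsPL f) {x' : ℝ} (h : x' ∈ uIcc x (f x)) (t : ℤ) :
    (f ^ t) x' ∈ uIcc ((f ^ t) x) (f ((f ^ t) x)) := by
  have hm := (zpow_strictMono hf t).monotone
  rw [← zpow_succ_apply, zpow_add_apply, zpow_one]
  rw [mem_uIcc] at h ⊢
  rcases h with ⟨h1, h2⟩ | ⟨h1, h2⟩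
  · exact Or.inl ⟨hm h1, hm h2⟩
  · exact Or.inr ⟨hm h1, hm h2⟩

lemma Att.of_uIcc {x' : ℝ} (h : Att f x) (hx' : x' ∈ uIcc x (f x)) : Att f x' := by
  obtain ⟨u, w, hw, e, hx⟩ := h
  exact ⟨u, w, hw, e, (cell_ordConnected u).uIcc_subset hx
    (cell_append_subset _ _ ((image_cell e).2 hx)) hx'⟩

lemma Att.of_uIcc_inv {x' : ℝ} (h : Att f⁻¹ (f x)) (hx' : x' ∈ uIcc x (f x)) : Att f⁻¹ x' := by
  rw [uIcc_comm] at hx'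
  refine h.of_uIcc ?_
  simpa using hx'

lemma mem_uIcc_step (hf : IsPL f) {x' : ℝ} (h : x' ∈ uIcc x (f x)) : f x ∈ uIcc x' (f x') := by
  have hm := hf.mono.monotone
  rw [mem_uIcc] at h ⊢
  rcases h with ⟨h1, h2⟩ | ⟨h1, h2⟩
  · exact Or.inl ⟨h2, hm h1⟩
  · exact Or.inr ⟨hm h2, h1⟩

lemma Window.compare (hf : IsPL f) {x' : ℝ} {E C E' C' : ℤ} (h : Window f x E C)
    (h' : Window f x' E' C') (hx' : x' ∈ uIcc x (f x)) :
    C - 1 ≤ C' ∧ C' ≤ C ∧ E - 1 ≤ E' ∧ E' ≤ E := by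
  have hx := mem_uIcc_step hf hx'
  refine ⟨?_, ?_, ?_, ?_⟩
  · have h1 := ((h'.att C').2 le_rfl).of_uIcc (uIcc_zpow_subset hf hx C')
    rw [zpow_apply_apply, h.att] at h1
    omega
  · have h1 := ((h.att C).2 le_rfl).of_uIcc (uIcc_zpow_subset hf hx' C)
    rwa [h'.att] at h1
  · have h1 := (h.rep E).2 le_rfl
    rw [show E = (E - 1) + 1 by ring, zpow_succ_apply] at h1
    have := h1.of_uIcc_inv (uIcc_zpow_subset hf hx' (E - 1))
    rwa [h'.rep] at this
  · have h1 := (h'.rep E').2 le_rfl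
    rw [show E' = (E' - 1) + 1 by ring, zpow_succ_apply] at h1
    have := h1.of_uIcc_inv (uIcc_zpow_subset hf hx (E' - 1))
    rw [zpow_apply_apply, h.rep] at this
    omega

end

section

variable {f g h k : Equiv.Perm ℝ} {x : ℝ} {y : Chart}

/-! ### Standard times -/

/-- The chart `y` is standard at time `t` under the iteration of `f`. -/
def StdAt (f : Equiv.Perm ℝ) (y : Chart) (t : ℤ) : Prop := f ^ t • y ∈ range std

/-- The last time before standardness becomes constant. -/
def Last (f : Equiv.Perm ℝ) (y : Chart) (b : ℤ) : Prop :=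
  ∀ t, b < t → (StdAt f y t ↔ ¬ StdAt f y b)

lemma Last.unique {b b' : ℤ} (h : Last f y b) (h' : Last f y b') : b = b' := by
  by_contra hne
  wlog hlt : b < b' generalizing b b'
  · exact this h' h (Ne.symm hne) (lt_of_le_of_ne (not_lt.1 hlt) (Ne.symm hne))
  have h1 := h b' hlt
  have h2 := h (b' + 1) (by omega)
  have h3 := h' (b' + 1) (by omega)
  tauto

lemma Last.succ {b : ℤ} (h : Last f y b) : StdAt f y (b + 1) ↔ ¬ StdAt f y b := h _ (by omega)

lemma stdAt_zpow_smul (f : Equiv.Perm ℝ) (y : Chart) (s t : ℤ) :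
    StdAt f (f ^ s • y) t ↔ StdAt f y (t + s) := by
  rw [StdAt, StdAt, zpow_add, mul_smul]

lemma stdAt_inv (f : Equiv.Perm ℝ) (y : Chart) (t : ℤ) : StdAt f⁻¹ y t ↔ StdAt f y (-t) := by
  rw [StdAt, StdAt, inv_zpow']

lemma Last.zpow_smul {b : ℤ} (h : Last f y b) (s : ℤ) : Last f (f ^ s • y) (b - s) := by
  intro t ht
  rw [stdAt_zpow_smul, stdAt_zpow_smul, h _ (by omega), sub_add_cancel]

/-- Conjugating moves the chart. -/
lemma conj_zpow (hc : g = h⁻¹ * f * h) (t : ℤ) : g ^ t = h⁻¹ * f ^ t * h := by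
  have := _root_.conj_zpow (i := t) (a := h⁻¹) (b := f)
  rw [inv_inv] at this
  rw [hc, this]

lemma conj_zpow_apply (hc : g = h⁻¹ * f * h) (t : ℤ) (x : ℝ) :
    (g ^ t) (h⁻¹ x) = h⁻¹ ((f ^ t) x) := by
  rw [conj_zpow hc]; simp

lemma conj_apply (hc : g = h⁻¹ * f * h) (x : ℝ) : g (h⁻¹ x) = h⁻¹ (f x) := by
  rw [hc]; simp

lemma conj_smul (hc : g = h⁻¹ * f * h) (y : Chart) : g • h⁻¹ • y = h⁻¹ • f • y := by
  rw [hc, mul_smul, mul_smul, smul_inv_smul]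

lemma conj_inv (hc : g = h⁻¹ * f * h) : g⁻¹ = h⁻¹ * f⁻¹ * h := by
  rw [hc]; group

lemma mem_range_smul (k : Equiv.Perm ℝ) (y : Chart) (x : ℝ) : k x ∈ range (k • y) ↔ x ∈ range y := by
  constructor
  · rintro ⟨s, hs⟩; exact ⟨s, k.injective hs⟩
  · rintro ⟨s, rfl⟩; exact ⟨s, rfl⟩

/-! ### Localisation -/

/-- The chart `y` is contracted into itself by `f`, and the orbit of `x` enters it at time
`n + 1`. -/
def RayAt (f : Equiv.Perm ℝ) (y : Chart) (x : ℝ) (n : ℤ) : Prop :=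
  ∃ w : List Bool, w ≠ [] ∧ f • y = sub y w ∧ (f ^ (n + 1)) x ∈ range y ∧ (f ^ n) x ∉ range y

/-- The chart `y` is located at time `n` of the orbit of `x`. -/
def Lives (f : Equiv.Perm ℝ) (y : Chart) (x : ℝ) (n : ℤ) : Prop :=
  (range y ⊆ uIcc x (f x) ∧ n = 0) ∨ RayAt f y x n ∨ RayAt f⁻¹ y x (-n - 1)

lemma RayAt.conj (hc : g = h⁻¹ * f * h) {n : ℤ} (H : RayAt f y x n) :
    RayAt g (h⁻¹ • y) (h⁻¹ x) n := by
  obtain ⟨w, hw, e, h1, h2⟩ := H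
  refine ⟨w, hw, ?_, ?_, ?_⟩
  · rw [conj_smul hc, e, smul_sub]
  · rwa [conj_zpow_apply hc, mem_range_smul]
  · rwa [conj_zpow_apply hc, mem_range_smul]

lemma Lives.conj (hh : IsPL h) (hc : g = h⁻¹ * f * h) {n : ℤ} (H : Lives f y x n) :
    Lives g (h⁻¹ • y) (h⁻¹ x) n := by
  rcases H with ⟨h1, h2⟩ | H | H
  · refine Or.inl ⟨?_, h2⟩
    rintro _ ⟨s, rfl⟩
    have := h1 ⟨s, rfl⟩
    have hm := hh.inv.mono.monotone
    rw [conj_apply hc, smul_chart_apply]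
    rw [mem_uIcc] at this ⊢
    rcases this with ⟨a, b⟩ | ⟨a, b⟩
    · exact Or.inl ⟨hm a, hm b⟩
    · exact Or.inr ⟨hm a, hm b⟩
  · exact Or.inr (Or.inl (H.conj hc))
  · exact Or.inr (Or.inr (H.conj (conj_inv hc)))

lemma RayAt.stdAt_succ {n t : ℤ} (H : RayAt f y x n) (ht : StdAt f y t) : StdAt f y (t + 1) := by
  obtain ⟨w, hw, e, -, -⟩ := H
  obtain ⟨u, hu⟩ := ht
  refine ⟨u ++ w, ?_⟩
  rw [zpow_add, mul_smul, zpow_one, e, smul_sub, ← hu, std_sub]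

lemma pred_std_of_att {u : List Bool} (hx : Att f x)
    (h1 : f x ∉ cell u) (h2 : f (f x) ∈ cell u) : f⁻¹ • std u ∈ range std := by
  obtain ⟨v, w', -, e', hx⟩ := hx
  have h3 := (image_cell e').2 hx
  have h4 := cell_append_subset _ _ ((image_cell (smul_std_append e' w')).2 h3)
  rcases prefix_or_prefix h2 h4 with ⟨p, hp⟩ | ⟨p, rfl⟩
  · exact absurd (cell_append_subset u p (by rwa [hp])) h1
  · exact ⟨v ++ p, (smul_std_inv (smul_std_append e' p)).symm⟩

lemma RayAt.bounds {n b E C : ℤ} (H : RayAt f y x n) (hW : Window f x E C)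
    (ha : ¬ StdAt f y b) (hb : StdAt f y (b + 1)) : C - 2 ≤ b + n ∧ b + n ≤ C - 1 := by
  obtain ⟨w, hw, e, h1, h2⟩ := H
  obtain ⟨u, hu⟩ := hb
  have e2 : f • std u = std (u ++ w) := by
    rw [hu, ← mul_smul, ← zpow_one_add, add_comm, zpow_add, zpow_one, mul_smul, e, smul_sub, ← hu,
      std_sub]
  have key : ∀ t : ℤ, (f ^ (b + 1 + t)) x ∈ cell u ↔ (f ^ t) x ∈ range y := by
    intro t
    rw [← range_std, hu, zpow_add_apply, mem_range_smul]
  constructor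
  · have : Att f ((f ^ (b + 1 + (n + 1))) x) := ⟨u, w, hw, e2, (key _).2 h1⟩
    rw [hW.att] at this
    omega
  · by_contra hlt
    have h3 : Att f ((f ^ (b + n)) x) := (hW.att _).2 (by omega)
    refine ha ?_
    have := pred_std_of_att (u := u) h3 ?_ ?_
    · rwa [hu, ← mul_smul, ← zpow_neg_one, ← zpow_add, show -1 + (b + 1) = b by ring] at this
    · rw [← zpow_succ_apply, show b + n + 1 = b + 1 + n by ring, key]; exact h2
    · rw [← zpow_succ_apply, ← zpow_succ_apply, show b + n + 1 + 1 = b + 1 + (n + 1) by ring, key]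
      exact h1

lemma stdAt_succ_iff_of_att (hf : IsPL f) {t : ℤ} (hy : range y ⊆ uIcc x (f x))
    (ha : Att f ((f ^ t) x)) : StdAt f y t ↔ StdAt f y (t + 1) := by
  obtain ⟨u, w, hw, e, hx⟩ := ha
  have h1 : range (f ^ t • y) ⊆ cell u := by
    rintro _ ⟨s, rfl⟩
    exact (cell_ordConnected u).uIcc_subset hx
      (cell_append_subset _ _ ((image_cell e).2 hx)) (uIcc_zpow_subset hf (hy ⟨s, rfl⟩) t)
  rw [StdAt, StdAt, mem_std_iff e h1, add_comm, zpow_one_add, mul_smul]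

lemma stdAt_const_of_window (hf : IsPL f) {E C : ℤ} (hy : range y ⊆ uIcc x (f x))
    (hW : Window f x E C) :
    (∀ t, C ≤ t → (StdAt f y t ↔ StdAt f y (t + 1))) ∧
    (∀ t, t + 2 ≤ E → (StdAt f y t ↔ StdAt f y (t + 1))) := by
  refine ⟨fun t ht => stdAt_succ_iff_of_att hf hy ((hW.att t).2 ht), fun t ht => ?_⟩
  have h1 : Att f⁻¹ ((f⁻¹ ^ (-(t + 1) - 1 + 1 : ℤ)) (f x)) → (StdAt f⁻¹ y (-(t + 1)) ↔
      StdAt f⁻¹ y (-(t + 1) + 1)) := by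
    intro h
    refine stdAt_succ_iff_of_att (x := f x) hf.inv ?_ ?_
    · rw [uIcc_comm]; simpa using hy
    · simpa using h
  rw [stdAt_inv, stdAt_inv, neg_neg, show -(-(t + 1) + 1) = t by ring] at h1
  refine (h1 ?_).symm
  rw [inv_zpow', zpow_apply_apply, hW.rep]
  omega

/-- The last change of standardness happens inside the window. -/
lemma Lives.last_bounds (hf : IsPL f) {n b E C : ℤ} (H : Lives f y x n) (hW : Window f x E C)
    (hb : Last f y b) : E - 1 ≤ b + n ∧ b + n ≤ C - 1 := by
  have hlt := hW.lt
  have hs := hb.succ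
  rcases H with ⟨h1, rfl⟩ | H | H
  · obtain ⟨hC, hE⟩ := stdAt_const_of_window hf h1 hW
    constructor
    · by_contra hcon
      have := hE b (by omega)
      tauto
    · by_contra hcon
      have := hC b (by omega)
      tauto
  · have hnb : ¬ StdAt f y b := fun h => hs.1 (H.stdAt_succ h) h
    have := H.bounds hW hnb (hs.2 hnb)
    omega
  · have hyb : StdAt f y b := by
      by_contra hnb
      have h1 := (stdAt_inv f y (-(b + 1))).2 (by rw [neg_neg]; exact hs.2 hnb)
      have h2 := H.stdAt_succ h1
      rw [stdAt_inv, neg_add, neg_neg, add_neg_cancel_right] at h2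
      exact hnb h2
    have hnb : ¬ StdAt f y (b + 1) := fun h => hs.1 h hyb
    have := H.bounds hW.inv (b := -(b + 1)) (by rwa [stdAt_inv, neg_neg])
      (by rwa [stdAt_inv, neg_add, neg_neg, add_neg_cancel_right])
    omega

/-- The overlapping words of two conjugate elements with midpoint in a given region. -/
def cnt (f g h : Equiv.Perm ℝ) (S : Set ℝ) : ℤ :=
  (badOvIn f S).ncard + (badOvIn g (h ⁻¹' S)).ncard

lemma badOvIn_add_le (hf : IsPL f) {S T U : Set ℝ} (hST : Disjoint S T) (hS : S ⊆ U) (hT : T ⊆ U) :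
    (badOvIn f S).ncard + (badOvIn f T).ncard ≤ (badOvIn f U).ncard := by
  rw [← ncard_union_eq _ (hf.badOvIn_finite S) (hf.badOvIn_finite T)]
  · refine ncard_le_ncard ?_ (hf.badOvIn_finite U)
    rintro v (hv | hv)
    · exact ⟨hv.1, hS hv.2⟩
    · exact ⟨hv.1, hT hv.2⟩
  · rw [Set.disjoint_left]
    exact fun v h1 h2 => Set.disjoint_left.1 hST h1.2 h2.2

lemma cnt_add_le (hf : IsPL f) (hg : IsPL g) {S T U : Set ℝ} (hST : Disjoint S T) (hS : S ⊆ U)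
    (hT : T ⊆ U) : cnt f g h S + cnt f g h T ≤ cnt f g h U := by
  have h1 := badOvIn_add_le hf hST hS hT
  have h2 := badOvIn_add_le hg (hST.preimage h) (preimage_mono hS) (preimage_mono hT)
  simp only [cnt]
  omega

lemma cnt_le (hf : IsPL f) (hg : IsPL g) (S : Set ℝ) :
    cnt f g h S ≤ (badOv f).ncard + (badOv g).ncard := by
  have h1 := ncard_le_ncard (badOvIn_subset f S) hf.badOv_finite
  have h2 := ncard_le_ncard (badOvIn_subset g (h ⁻¹' S)) hg.badOv_finite
  simp only [cnt]
  omega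

lemma step_subset {S : Set ℝ} (hS : S.OrdConnected)
    (hx : ∀ t : ℤ, (f ^ t) x ∈ S) (t : ℤ) : step f x t ⊆ S := fun _ hp =>
  hS.uIcc_subset (hx t) (hx (t + 1)) ⟨hp.1.le, hp.2⟩

lemma preimage_ordConnected (hh : IsPL h) {S : Set ℝ} (hS : S.OrdConnected) :
    (h ⁻¹' S).OrdConnected := hS.preimage_mono hh.mono.monotone

/-- Charts near the orbit of the same point have comparable drifts. -/
lemma drift_le_of_orbit (hf : IsPL f) (hg : IsPL g) (hh : IsPL h) (hc : g = h⁻¹ * f * h)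
    {x' : ℝ} {y' : Chart} {n n' b c b' c' : ℤ} (hx : f x ≠ x) (hx' : f x' ≠ x')
    (H : Lives f y x n) (H' : Lives f y' x' n') (hb : Last f y b) (hc1 : Last g (h⁻¹ • y) c)
    (hb' : Last f y' b') (hc' : Last g (h⁻¹ • y') c') {s : ℤ}
    (hs : x' ∈ uIcc ((f ^ s) x) ((f ^ (s + 1)) x)) {S : Set ℝ} (hS : S.OrdConnected)
    (hxS : ∀ t : ℤ, (f ^ t) x ∈ S) : |(b - c) - (b' - c')| ≤ cnt f g h S := by
  have main : ∀ {f : Equiv.Perm ℝ} {x x' : ℝ} {y y' : Chart} {b b' : ℤ} {S : Set ℝ},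
      IsPL f → f x ≠ x → f x' ≠ x' → Lives f y x n → Lives f y' x' n' → Last f y b →
      Last f y' b' → x' ∈ uIcc ((f ^ s) x) ((f ^ (s + 1)) x) → S.OrdConnected →
      (∀ t : ℤ, (f ^ t) x ∈ S) → ∃ a : ℤ, a + 1 ≤ (badOvIn f S).ncard ∧
        -a ≤ (b + n) - (b' + n' + s) ∧ (b + n) - (b' + n' + s) ≤ a + 1 := by
    intro f x x' y y' b b' S hf hx hx' H H' hb hb' hs hS hxS
    obtain ⟨E, C, hW⟩ := exists_window hf hx
    obtain ⟨E', C', hW'⟩ := exists_window hf hx'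
    have h1 := H.last_bounds hf hW hb
    have h2 := H'.last_bounds hf hW' hb'
    have h3 := (hW.shift s).compare hf hW' (by rwa [← zpow_succ_apply])
    have h4 := hW.card_le hf hx (step_subset hS hxS)
    exact ⟨C - E, h4, by omega, by omega⟩
  obtain ⟨a, h1, h2, h3⟩ := main hf hx hx' H H' hb hb' hs hS hxS
  have hne : ∀ {p : ℝ}, f p ≠ p → g (h⁻¹ p) ≠ h⁻¹ p := fun hp => by
    rw [conj_apply hc]; exact fun h' => hp (h⁻¹.injective h')
  obtain ⟨a', h1', h2', h3'⟩ := main (S := h ⁻¹' S) hg (hne hx) (hne hx') (H.conj hh hc)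
    (H'.conj hh hc) hc1 hc' (by
      have hm := hh.inv.mono.monotone
      rw [conj_zpow_apply hc, conj_zpow_apply hc]
      rw [mem_uIcc] at hs ⊢
      exact hs.imp (fun h => ⟨hm h.1, hm h.2⟩) (fun h => ⟨hm h.1, hm h.2⟩))
    (preimage_ordConnected hh hS) (fun t => by
      rw [mem_preimage, conj_zpow_apply hc]; simpa using hxS t)
  rw [abs_le]
  simp only [cnt]
  omega

lemma not_mem_of_ray {u w : List Bool} (hw : w ≠ []) (e : f • std u = std (u ++ w))
    (hx : f x ≠ x) : ∃ t : ℤ, (f ^ t) x ∉ cell u := by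
  obtain ⟨n, hn⟩ := exists_not_att hx
  exact ⟨_, fun h => hn ⟨u, w, hw, e, h⟩⟩

lemma exists_rayAt {u w : List Bool} (hw : w ≠ []) (e : f • std u = std (u ++ w))
    (hx : f x ≠ x) (hxu : x ∈ cell u) : ∃ n, RayAt f (std u) x n := by
  obtain ⟨a, ha⟩ := exists_least_time (P := fun t => (f ^ t) x ∈ cell u)
    (fun t ht => by
      simp only [zpow_succ_apply]
      exact cell_append_subset _ _ ((image_cell e).2 ht))
    ⟨0, by simpa using hxu⟩ (not_mem_of_ray hw e hx)
  refine ⟨a - 1, w, hw, by rw [e, std_sub], ?_, ?_⟩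
  · rw [range_std, ha]; omega
  · rw [range_std, ha]; omega

lemma pow_smul_sub {w : List Bool} (e : f • y = sub y w) (n : ℕ) : f ^ n • y = sub y (rpt w n) := by
  induction n with
  | zero => simp [rpt]
  | succ n ih => rw [pow_succ', mul_smul, ih, smul_sub, e, sub_sub]; rfl

/-- A contracted chart of `IsPL` type becomes standard at some time. -/
lemma exists_last_of_ray (hk : IsPL k) {u w : List Bool} (hw : w ≠ [])
    (e : f • k • std u = sub (k • std u) w) : ∃ b, Last f (k • std u) b := by
  obtain ⟨N, hN⟩ := hk.exists_bound
  obtain ⟨C, hC⟩ := exists_least_time (P := StdAt f (k • std u)) (fun t ht => by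
      obtain ⟨v, hv⟩ := ht
      refine ⟨v ++ w, ?_⟩
      rw [zpow_add, mul_smul, zpow_one, e, smul_sub, ← hv, std_sub])
    ⟨N, by
      rw [StdAt, zpow_natCast, pow_smul_sub e, ← smul_sub, std_sub]
      by_contra hb
      refine hN (u ++ rpt w N) ?_ hb
      have := le_length_rpt hw N
      simp only [List.length_append]; omega⟩
    (by
      by_contra hall
      push Not at hall
      obtain ⟨v, hv⟩ := hall 0
      rw [zpow_zero, one_smul] at hv
      obtain ⟨v', hv'⟩ := hall (-((v.length + 1 : ℕ) : ℤ))
      have e' : f • std v' = sub (std v') w := by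
        rw [hv', ← mul_smul, ← zpow_one_add, add_comm, zpow_add, zpow_one, mul_smul, e, smul_sub]
      have h1 := pow_smul_sub e' (v.length + 1)
      rw [hv', zpow_neg, zpow_natCast, smul_inv_smul, ← zpow_natCast, ← zpow_neg, ← hv',
        std_sub, ← hv] at h1
      have h2 := congrArg List.length (std_injective h1)
      have h3 := le_length_rpt hw (v.length + 1)
      simp only [List.length_append] at h2
      omega)
  refine ⟨C - 1, fun t ht => ?_⟩
  rw [hC, hC]; omega

lemma exists_last_of_ray_inv (hk : IsPL k) {u w : List Bool} (hw : w ≠ [])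
    (e : f⁻¹ • k • std u = sub (k • std u) w) : ∃ b, Last f (k • std u) b := by
  obtain ⟨b, hb⟩ := exists_last_of_ray hk hw e
  have hs := hb.succ
  have up : ∀ t, StdAt f⁻¹ (k • std u) t → StdAt f⁻¹ (k • std u) (t + 1) := by
    rintro t ⟨v, hv⟩
    refine ⟨v ++ w, ?_⟩
    rw [zpow_add, mul_smul, zpow_one, e, smul_sub, ← hv, std_sub]
  have hnb : ¬ StdAt f⁻¹ (k • std u) b := fun h => hs.1 (up b h) h
  have down : ∀ t, t ≤ b → ¬ StdAt f⁻¹ (k • std u) t := by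
    intro t ht h
    refine hnb ?_
    clear hs hnb hb
    induction b, ht using Int.leInduction with
    | base => exact h
    | succ n _ ih => exact up n ih
  refine ⟨-(b + 1), fun t ht => ?_⟩
  have h1 := (stdAt_inv f (k • std u) (b + 1)).1 (hs.2 hnb)
  have h2 := down (-t) (by omega)
  rw [stdAt_inv, neg_neg] at h2
  tauto

end

section

variable {f g h k : Equiv.Perm ℝ} {x : ℝ} {y : Chart}

/-! ### Fixed points -/

lemma eq_of_two_fixed {u v : List Bool} (e : f • std u = std v) {q q' : ℝ} (hq : q ∈ cell u)
    (hq' : q' ∈ cell u) (hne : q ≠ q') (h1 : f q = q) (h2 : f q' = q') : u = v := by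
  rw [← range_std] at hq hq'
  obtain ⟨s, rfl⟩ := hq
  obtain ⟨s', rfl⟩ := hq'
  have e1 := congrFun e s
  have e2 := congrFun e s'
  rw [smul_chart_apply, h1] at e1
  rw [smul_chart_apply, h2] at e2
  simp only [std] at e1 e2
  rw [dyad_eq u, dyad_eq v] at e1 e2
  have hss : (s : ℝ) - s' ≠ 0 := by
    intro h
    exact hne (by rw [Subtype.ext (sub_eq_zero.1 h)])
  have h3 : ((s : ℝ) - s') * (1 / 2 ^ u.length - 1 / 2 ^ v.length) = 0 := by
    have : (s : ℝ) / 2 ^ u.length - s' / 2 ^ u.length = s / 2 ^ v.length - s' / 2 ^ v.length := by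
      linarith
    linear_combination this
  have h4 : (1 : ℝ) / 2 ^ u.length - 1 / 2 ^ v.length = 0 := (mul_eq_zero.1 h3).resolve_left hss
  refine std_injective (funext fun r => ?_)
  simp only [std]
  rw [dyad_eq u, dyad_eq v]
  linear_combination e1 + ((r : ℝ) - s) * h4

lemma fixed_inter_finite (hf : IsPL f) {x x' : ℝ} (hx : f x ≠ x) (hx' : f x' ≠ x')
    (hd : ∀ v, dyad v 0 ∈ Icc x x' → f (dyad v 0) ≠ dyad v 0) :
    {q ∈ Icc x x' | f q = q}.Finite := by
  obtain ⟨N, hN⟩ := hf.exists_bound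
  have h0 := (hf.mem_unit hx).1
  have h1 := (hf.mem_unit hx').2
  have key : ∀ q ∈ {q ∈ Icc x x' | f q = q}, ∃ u : List Bool,
      u ∈ {u : List Bool | u.length = N} ∧ q ∈ cell u := fun q hq =>
    exists_word ⟨h0.trans hq.1.1, hq.1.2.trans_lt h1⟩ N
  choose! F hF1 hF2 using key
  refine Set.Finite.of_injOn hF1 ?_ (List.finite_length_eq Bool N)
  intro q hq q' hq' heq
  by_contra hne
  have hm := hF2 q' hq'
  rw [← heq] at hm
  obtain ⟨v, e⟩ := not_mem_bad.1 (hN (F q) (hF1 q hq).ge)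
  have := eq_of_two_fixed e (hF2 q hq) hm hne hq.2 hq'.2
  rw [← this] at e
  have hxu : ∀ {p}, f p ≠ p → p ∉ cell (F q) := by
    intro p hp hpu
    rw [← range_std] at hpu
    obtain ⟨s, rfl⟩ := hpu
    exact hp (congrFun e s)
  refine hd (F q) ⟨?_, (hF2 q hq).1.trans hq.1.2⟩ (map_lo e)
  by_contra hlt
  push Not at hlt
  exact hxu hx ⟨hlt.le, hq.1.1.trans_lt (hF2 q hq).2⟩

lemma exists_nat_step {e : Equiv.Perm ℝ} (he : StrictMono e) {x x' : ℝ} (hx : x ≤ e x)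
    (hxx : x ≤ x') (hfix : ∀ p ∈ Icc x x', e p ≠ p) :
    ∃ n : ℕ, (e ^ n) x ≤ x' ∧ x' ≤ (e ^ (n + 1)) x := by
  by_contra hcon
  push Not at hcon
  have hall : ∀ n : ℕ, (e ^ n) x ≤ x' := by
    intro n
    induction n with
    | zero => simpa using hxx
    | succ n ih => exact (hcon n ih).le
  have hb : BddAbove (range fun n : ℕ => (e ^ n) x) := ⟨x', by rintro _ ⟨n, rfl⟩; exact hall n⟩
  set p := ⨆ n : ℕ, (e ^ n) x
  have hle : ∀ n : ℕ, (e ^ n) x ≤ p := le_ciSup hb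
  have hsucc : ∀ n : ℕ, (e ^ (n + 1)) x = e ((e ^ n) x) := fun n => by
    rw [pow_succ', Equiv.Perm.mul_apply]
  refine hfix p ⟨by simpa using hle 0, ciSup_le hall⟩ (le_antisymm ?_ ?_)
  · by_contra hlt
    push Not at hlt
    have h1 : e⁻¹ p < p := by
      rw [← he.lt_iff_lt, Equiv.Perm.coe_inv, Equiv.apply_symm_apply]; exact hlt
    obtain ⟨n, hn⟩ := exists_lt_of_lt_ciSup h1
    have h2 := he hn
    rw [Equiv.Perm.coe_inv, Equiv.apply_symm_apply, ← hsucc] at h2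
    exact absurd (hle (n + 1)) (not_le.2 h2)
  · refine ciSup_le fun n => ?_
    cases n with
    | zero => exact (by simpa using hx : _ ≤ e x).trans (he.monotone (by simpa using hle 0))
    | succ n => rw [hsucc]; exact he.monotone (hle n)

lemma exists_step (hf : IsPL f) {x x' : ℝ} (hxx : x ≤ x') (hfix : ∀ p ∈ Icc x x', f p ≠ p) :
    ∃ s : ℤ, x' ∈ uIcc ((f ^ s) x) ((f ^ (s + 1)) x) := by
  rcases le_total x (f x) with h | h
  · obtain ⟨n, h1, h2⟩ := exists_nat_step hf.mono h hxx hfix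
    refine ⟨n, mem_uIcc.2 (Or.inl ⟨by simpa using h1, ?_⟩)⟩
    rw [← zpow_natCast] at h2; exact_mod_cast h2
  · obtain ⟨n, h1, h2⟩ := exists_nat_step hf.inv.mono (x := x) (x' := x')
      (by rw [← hf.mono.le_iff_le]; simpa using h) hxx (fun p hp => inv_apply_ne (hfix p hp))
    refine ⟨-(n + 1 : ℤ), mem_uIcc.2 (Or.inr ⟨?_, ?_⟩)⟩
    · rw [neg_add, neg_add_cancel_right, zpow_neg, zpow_natCast, ← inv_pow]; exact h1
    · rw [← inv_zpow']; exact_mod_cast h2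

/-! ### Comparing drifts along a chain of contracted charts -/

lemma exists_contracted {u : List Bool} {q : ℝ} (hu : u ∉ bad f) (hq : q ∈ cell u)
    (hfq : f q = q) (hd : f (dyad u 0) ≠ dyad u 0) :
    ∃ u', cell u ⊆ cell u' ∧ (∀ x ∈ cell u', f x ≠ x → ∃ n, Lives f (std u') x n) ∧
      ∀ g h, IsPL h → g = h⁻¹ * f * h → ∃ c, Last g (h⁻¹ • std u') c := by
  obtain ⟨v, e⟩ := not_mem_bad.1 hu
  have hne : v ≠ u := by rintro rfl; exact hd (map_lo e)
  have hqv : q ∈ cell v := by rw [← hfq]; exact (image_cell e).2 hq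
  rcases prefix_or_prefix hq hqv with ⟨w, rfl⟩ | ⟨w, rfl⟩
  · have hw : w ≠ [] := by rintro rfl; simp at hne
    refine ⟨u, Subset.rfl, fun x hx hfx => ?_, fun g h hh hc => ?_⟩
    · obtain ⟨n, hn⟩ := exists_rayAt hw e hfx hx
      exact ⟨n, Or.inr (Or.inl hn)⟩
    · exact exists_last_of_ray hh.inv hw (by rw [conj_smul hc, e, ← std_sub, smul_sub])
  · have hw : w ≠ [] := by rintro rfl; simp at hne
    have e' := smul_std_inv e
    refine ⟨v, cell_append_subset v w, fun x hx hfx => ?_, fun g h hh hc => ?_⟩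
    · obtain ⟨n, hn⟩ := exists_rayAt hw e' (inv_apply_ne hfx) hx
      exact ⟨-n - 1, Or.inr (Or.inr (by rwa [show -(-n - 1) - 1 = n by ring]))⟩
    · exact exists_last_of_ray_inv hh.inv hw
        (by rw [conj_smul (conj_inv hc), e', ← std_sub, smul_sub])

lemma zpow_lt_fixed (hf : IsPL f) {r : ℝ} (hr : f r = r) (hx : x < r) (t : ℤ) : (f ^ t) x < r := by
  have := zpow_strictMono hf t hx
  rwa [zpow_fixed hr] at this

lemma fixed_lt_zpow (hf : IsPL f) {r : ℝ} (hr : f r = r) (hx : r < x) (t : ℤ) : r < (f ^ t) x := by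
  have := zpow_strictMono hf t hx
  rwa [zpow_fixed hr] at this

lemma drift_le_chain (hf : IsPL f) (hg : IsPL g) (hh : IsPL h) (hc : g = h⁻¹ * f * h) (m : ℕ)
    {x x' r : ℝ} {y y' : Chart} {n n' b c b' c' : ℤ} (hxx : x ≤ x') (hx : f x ≠ x)
    (hx' : f x' ≠ x') (hd : ∀ v, dyad v 0 ∈ Icc x x' → f (dyad v 0) ≠ dyad v 0)
    (hm : {q ∈ Icc x x' | f q = q}.ncard = m) (hr : f r = r) (hxr : x' < r)
    (H : Lives f y x n) (H' : Lives f y' x' n') (hb : Last f y b) (hc1 : Last g (h⁻¹ • y) c)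
    (hb' : Last f y' b') (hc' : Last g (h⁻¹ • y') c') :
    |(b - c) - (b' - c')| ≤ cnt f g h (Iio r) := by
  induction m using Nat.strong_induction_on generalizing x' r y' n' b' c' with
  | _ m ih =>
  have hfin := fixed_inter_finite hf hx hx' hd
  by_cases hemp : {q ∈ Icc x x' | f q = q} = ∅
  · obtain ⟨s, hs⟩ := exists_step hf hxx (fun p hp hfp => by
      have : p ∈ {q ∈ Icc x x' | f q = q} := ⟨hp, hfp⟩
      rw [hemp] at this; exact this)
    exact drift_le_of_orbit hf hg hh hc hx hx' H H' hb hc1 hb' hc' hs ordConnected_Iio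
      (zpow_lt_fixed hf hr (hxx.trans_lt hxr))
  · obtain ⟨q, hq, hmax⟩ := exists_max_image _ id hfin (nonempty_iff_ne_empty.2 hemp)
    have hfq : f q = q := hq.2
    have hxq : x < q := lt_of_le_of_ne hq.1.1 (by rintro rfl; exact hx hfq)
    have hqx : q < x' := lt_of_le_of_ne hq.1.2 (by rintro rfl; exact hx' hfq)
    obtain ⟨N, hN⟩ := hf.exists_bound
    obtain ⟨N1, hN1⟩ := length_bound hxq.ne
    obtain ⟨N2, hN2⟩ := length_bound hqx.ne
    have hqu : q ∈ Ico (0 : ℝ) 1 := ⟨(hf.mem_unit hx).1.trans hxq.le,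
      hqx.trans (hf.mem_unit hx').2⟩
    obtain ⟨u, hu, hqc⟩ := exists_word hqu (max N (max N1 N2))
    have hlo : x < dyad u 0 := by
      by_contra hlt
      have := hN1 u ⟨not_lt.1 hlt, hxq.trans hqc.2⟩ hqc
      have := le_max_left N1 N2; have := le_max_right N (max N1 N2); omega
    have hhi : dyad u 1 ≤ x' := by
      by_contra hlt
      have := hN2 u hqc ⟨hqc.1.trans hqx.le, not_le.1 hlt⟩
      have := le_max_right N1 N2; have := le_max_right N (max N1 N2); omega
    have hdu := hd u ⟨hlo.le, hqc.1.trans hqx.le⟩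
    have hlq : dyad u 0 < q := lt_of_le_of_ne hqc.1 (by
      intro h; rw [h] at hdu; exact hdu hfq)
    obtain ⟨u', huu, hlive, hlast⟩ := exists_contracted
      (hN u (by rw [hu]; exact le_max_left _ _)) hqc hfq hdu
    obtain ⟨n1, hn1⟩ := hlive _ (huu (lo_mem_cell u)) hdu
    obtain ⟨b1, hb1⟩ := hlast f 1 IsPL.one (by simp)
    obtain ⟨c1, hc1'⟩ := hlast g h hh hc
    rw [inv_one, one_smul] at hb1
    have hfirst := ih _ (by
        rw [← hm]
        refine ncard_lt_ncard ⟨fun p hp => ⟨⟨hp.1.1, hp.1.2.trans (hlq.trans hqx).le⟩, hp.2⟩, ?_⟩ hfin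
        exact fun hsub => absurd (hsub hq).1.2 (not_le.2 hlq))
      hlo.le hdu (fun v hv => hd v ⟨hv.1, hv.2.trans (hlq.trans hqx).le⟩) rfl hfq hlq hn1 hb1 hc1'
    set x2 := (q + dyad u 1) / 2 with hx2
    have hq1 := hqc.2
    have hx2q : q < x2 := by rw [hx2]; linarith
    have hx2x : x2 < x' := by rw [hx2]; linarith
    have hx2c : x2 ∈ cell u := ⟨hqc.1.trans hx2q.le, by rw [hx2]; linarith⟩
    have hnofix : ∀ p ∈ Icc x2 x', f p ≠ p := fun p hp hfp => by
      have := hmax p ⟨⟨(hxq.trans hx2q).le.trans hp.1, hp.2⟩, hfp⟩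
      exact absurd this (not_le.2 (hx2q.trans_le hp.1))
    have hfx2 := hnofix x2 ⟨le_rfl, hx2x.le⟩
    obtain ⟨n2, hn2⟩ := hlive _ (huu hx2c) hfx2
    obtain ⟨s, hs⟩ := exists_step hf hx2x.le hnofix
    have hsecond := drift_le_of_orbit hf hg hh hc hfx2 hx' hn2 H' hb1 hc1' hb' hc' hs
      (ordConnected_Ioo (a := q) (b := r))
      (fun t => ⟨fixed_lt_zpow hf hfq hx2q t, zpow_lt_fixed hf hr (hx2x.trans hxr) t⟩)
    have hadd := cnt_add_le (h := h) hf hg (S := Iio q) (T := Ioo q r) (U := Iio r)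
      (by rw [Set.disjoint_left]; exact fun p h1 h2 => lt_asymm h1 h2.1)
      (Iio_subset_Iio (hqx.trans hxr).le) (fun p hp => hp.2)
    rw [abs_le] at *
    constructor <;> linarith [hfirst.1, hfirst.2, hsecond.1, hsecond.2]

/-! ### Separation by dyadic fixed points -/

/-- Images of standard charts under elements of the group. -/
def IsChart (y : Chart) : Prop := ∃ k u, IsPL k ∧ y = k • std u

lemma IsChart.smul (hy : IsChart y) (hk : IsPL k) : IsChart (k • y) := by
  obtain ⟨l, u, hl, rfl⟩ := hy
  exact ⟨k * l, u, hk.mul hl, by rw [mul_smul]⟩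

lemma isChart_std (u : List Bool) : IsChart (std u) := ⟨1, u, IsPL.one, by rw [one_smul]⟩

lemma IsChart.ordConnected (hy : IsChart y) : (range y).OrdConnected := by
  obtain ⟨k, u, hk, rfl⟩ := hy
  have : range (k • std u) = (k⁻¹ : Equiv.Perm ℝ) ⁻¹' cell u := by
    ext p
    rw [mem_preimage, ← range_std, ← mem_range_smul k (std u), Equiv.Perm.coe_inv,
      Equiv.apply_symm_apply]
  rw [this]
  exact preimage_ordConnected hk.inv (cell_ordConnected u)

lemma IsChart.strictMono (hy : IsChart y) : StrictMono y := by
  obtain ⟨k, u, hk, rfl⟩ := hy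
  exact fun s t hst => hk.mono (dyad_strictMono u hst)

lemma IsPL.exists_dyad (hk : IsPL k) (v : List Bool) : ∃ v', k (dyad v 0) = dyad v' 0 := by
  obtain ⟨N, hN⟩ := hk.exists_bound
  obtain ⟨v', e⟩ := not_mem_bad.1 (hN (v ++ zeros N) (by simp [zeros]))
  refine ⟨v', ?_⟩
  rw [← map_lo e, dyad_append, dyad_zeros]

lemma eq_lo_of_dyad_fixed {u w v : List Bool} (hw : w ≠ []) (e : f • std u = std (u ++ w))
    (hv : dyad v 0 ∈ cell u) (hfv : f (dyad v 0) = dyad v 0) : dyad v 0 = dyad u 0 := by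
  have hfn : (f ^ v.length) (dyad v 0) = dyad v 0 := by
    have := zpow_fixed hfv v.length
    rwa [zpow_natCast] at this
  have h1 := pow_mem_cell_rpt e v.length hv
  rw [hfn] at h1
  have h2 : dyad (u ++ rpt w v.length) 0 = dyad v 0 := by
    have hlen := le_length_rpt hw v.length
    rcases prefix_or_prefix (lo_mem_cell v) h1 with ⟨p, hp⟩ | hp
    · refine le_antisymm h1.1 ?_
      rw [← hp, dyad_append]
      exact (dyad_strictMono v).monotone (dyad_nonneg p le_rfl)
    · rw [hp.eq_of_length_le (by simp only [List.length_append]; omega)]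
  have h3 : f ^ v.length • std u = std (u ++ rpt w v.length) := by
    rw [pow_smul_sub (y := std u) (w := w) (by rw [e, std_sub]), std_sub]
  have h4 := map_lo h3
  rw [h2, ← hfn] at h4
  exact ((f ^ v.length).injective h4).symm

lemma RayAt.fixed_eq_lo (hy : IsChart y) {n : ℤ} (H : RayAt f y x n) {v : List Bool}
    (hv : dyad v 0 ∈ range y) (hfv : f (dyad v 0) = dyad v 0) :
    dyad v 0 = y ⟨0, by norm_num⟩ := by
  obtain ⟨k, u, hk, rfl⟩ := hy
  obtain ⟨w, hw, e, -, -⟩ := H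
  obtain ⟨v', hv'⟩ := hk.inv.exists_dyad v
  have hkv : k (dyad v' 0) = dyad v 0 := by rw [← hv']; simp
  have e' : (k⁻¹ * f * k) • std u = std (u ++ w) := by
    rw [mul_smul, mul_smul, e, smul_sub, inv_smul_smul, std_sub]
  have := eq_lo_of_dyad_fixed (v := v') hw e' (by rwa [← range_std, ← mem_range_smul k, hkv])
    (by simp only [Equiv.Perm.mul_apply, hkv, hfv, hv'])
  rw [← hkv, this]
  rfl

lemma RayAt.separated (hf : IsPL f) (hy : IsChart y) {n : ℤ} (H : RayAt f y x n) {v : List Bool}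
    (hfv : f (dyad v 0) = dyad v 0) :
    (x < dyad v 0 → range y ⊆ Iio (dyad v 0)) ∧ (dyad v 0 < x → range y ⊆ Ici (dyad v 0)) := by
  have hconn := hy.ordConnected
  have hmono := hy.strictMono
  have hlo := fun hv => H.fixed_eq_lo hy (v := v) hv hfv
  obtain ⟨w, hw, e, h1, h2⟩ := H
  have hmin : ∀ p ∈ range y, y ⟨0, by norm_num⟩ ≤ p := by
    rintro _ ⟨s, rfl⟩
    exact hmono.monotone s.2.1
  constructor
  · intro hx p hp
    by_contra hcon
    have h3 := zpow_lt_fixed hf hfv hx (n + 1)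
    have h4 := hlo (hconn.out h1 hp ⟨h3.le, not_lt.1 hcon⟩)
    exact absurd (hmin _ h1) (not_le.2 (h4 ▸ h3))
  · intro hx p hp
    by_contra hcon
    have h3 := fixed_lt_zpow hf hfv hx (n + 1)
    have h5 : p < dyad v 0 := not_le.1 hcon
    have h4 := hlo (hconn.out hp h1 ⟨h5.le, h3.le⟩)
    exact absurd (hmin _ hp) (not_le.2 (h4 ▸ h5))

lemma Lives.separated (hf : IsPL f) (hy : IsChart y) {n : ℤ} (H : Lives f y x n) {v : List Bool}
    (hfv : f (dyad v 0) = dyad v 0) :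
    (x < dyad v 0 → range y ⊆ Iio (dyad v 0)) ∧ (dyad v 0 < x → range y ⊆ Ici (dyad v 0)) := by
  rcases H with ⟨h1, -⟩ | H | H
  · constructor
    · intro hx p hp
      have h2 := hf.mono hx
      rw [hfv] at h2
      exact (h1 hp).2.trans_lt (max_lt hx h2)
    · intro hx p hp
      have h2 := hf.mono hx
      rw [hfv] at h2
      exact (lt_min hx h2).le.trans (h1 hp).1
  · exact H.separated hf hy hfv
  · exact H.separated hf.inv hy (by rw [Equiv.Perm.inv_eq_iff_eq, hfv])

/-- Two located charts either have comparable drifts or are separated by a dyadic fixed point. -/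
lemma drift_le_or_separated (hf : IsPL f) (hg : IsPL g) (hh : IsPL h) (hc : g = h⁻¹ * f * h)
    {x x' : ℝ} {y y' : Chart} (hy : IsChart y) (hy' : IsChart y') {n n' b c b' c' : ℤ}
    (hxx : x ≤ x') (hx : f x ≠ x) (hx' : f x' ≠ x')
    (H : Lives f y x n) (H' : Lives f y' x' n') (hb : Last f y b) (hc1 : Last g (h⁻¹ • y) c)
    (hb' : Last f y' b') (hc' : Last g (h⁻¹ • y') c') :
    |(b - c) - (b' - c')| ≤ (badOv f).ncard + (badOv g).ncard ∨
      ∃ v, f (dyad v 0) = dyad v 0 ∧ range y ⊆ Iio (dyad v 0) ∧ range y' ⊆ Ici (dyad v 0) := by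
  by_cases hd : ∀ v, dyad v 0 ∈ Icc x x' → f (dyad v 0) ≠ dyad v 0
  · left
    exact (drift_le_chain hf hg hh hc _ hxx hx hx' hd rfl hf.fixed_one (hf.mem_unit hx').2
      H H' hb hc1 hb' hc').trans (cnt_le hf hg _)
  · right
    push Not at hd
    obtain ⟨v, hv, hfv⟩ := hd
    exact ⟨v, hfv, (H.separated hf hy hfv).1 (lt_of_le_of_ne hv.1 (by rintro rfl; exact hx hfv)),
      (H'.separated hf hy' hfv).2 (lt_of_le_of_ne hv.2 (by rintro rfl; exact hx' hfv))⟩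

end

section

variable {f g h k : Equiv.Perm ℝ} {x : ℝ} {y : Chart}

/-! ### Gluing -/

lemma IsPL.of_length (hm : StrictMono h) (hs : ∀ x, x ∉ Ico (0 : ℝ) 1 → h x = x) {N : ℕ}
    (hN : ∀ u : List Bool, u.length = N → u ∉ bad h) : IsPL h where
  mono := hm
  supp := hs
  fin := by
    refine (List.finite_length_lt Bool N).subset fun u hu => ?_
    by_contra hlt
    simp only [mem_ofPred_eq, not_lt] at hlt
    obtain ⟨v, e⟩ := not_mem_bad.1 (hN (u.take N) (by simpa using hlt))
    refine not_mem_bad.2 ⟨v ++ u.drop N, ?_⟩ hu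
    have := smul_std_append e (u.drop N)
    rwa [List.take_append_drop] at this

lemma lo_eq_of_mem_cell {u v : List Bool} (hl : v.length ≤ u.length) (hv : dyad v 0 ∈ cell u) :
    dyad u 0 = dyad v 0 := by
  rcases prefix_or_prefix (lo_mem_cell v) hv with ⟨p, rfl⟩ | hp
  · refine le_antisymm hv.1 ?_
    rw [dyad_append]
    exact (dyad_strictMono v).monotone (dyad_nonneg p le_rfl)
  · rw [hp.eq_of_length_le hl]

lemma smul_eq_of_eqOn {z z' : Equiv.Perm ℝ} (h : ∀ p ∈ range y, z p = z' p) : z • y = z' • y :=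
  funext fun s => h _ ⟨s, rfl⟩

lemma exists_glue {z₁ z₂ : Equiv.Perm ℝ} (h₁ : IsPL z₁) (h₂ : IsPL z₂) {v : List Bool}
    (hv₁ : z₁ (dyad v 0) = dyad v 0) (hv₂ : z₂ (dyad v 0) = dyad v 0) :
    ∃ z, IsPL z ∧ (∀ p, p < dyad v 0 → z p = z₁ p) ∧ (∀ p, dyad v 0 ≤ p → z p = z₂ p) := by
  set q := dyad v 0
  have lt1 : ∀ p, z₁ p < q ↔ p < q := fun p => by
    conv_lhs => rw [← hv₁]
    exact h₁.mono.lt_iff_lt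
  have lt2 : ∀ p, z₂ p < q ↔ p < q := fun p => by
    conv_lhs => rw [← hv₂]
    exact h₂.mono.lt_iff_lt
  have lt1' : ∀ p, z₁⁻¹ p < q ↔ p < q := fun p => by rw [← lt1]; simp
  have lt2' : ∀ p, z₂⁻¹ p < q ↔ p < q := fun p => by rw [← lt2]; simp
  let z : Equiv.Perm ℝ :=
    { toFun := fun p => if p < q then z₁ p else z₂ p
      invFun := fun p => if p < q then z₁⁻¹ p else z₂⁻¹ p
      left_inv := fun p => by
        by_cases hp : p < q
        · simp [hp, (lt1 p).2 hp]
        · have : ¬ z₂ p < q := fun h => hp ((lt2 p).1 h)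
          simp [hp, this]
      right_inv := fun p => by
        by_cases hp : p < q
        · have := (lt1' p).2 hp
          rw [Equiv.Perm.coe_inv] at this
          simp [hp, this]
        · have : ¬ z₂⁻¹ p < q := fun h => hp ((lt2' p).1 h)
          rw [Equiv.Perm.coe_inv] at this
          simp [hp, this] }
  have hz1 : ∀ p, p < q → z p = z₁ p := fun p hp => if_pos hp
  have hz2 : ∀ p, q ≤ p → z p = z₂ p := fun p hp => if_neg (not_lt.2 hp)
  refine ⟨z, ?_, hz1, hz2⟩
  obtain ⟨N₁, hN₁⟩ := h₁.exists_bound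
  obtain ⟨N₂, hN₂⟩ := h₂.exists_bound
  refine IsPL.of_length (N := max v.length (max N₁ N₂)) ?_ ?_ ?_
  · intro a b hab
    rcases lt_or_ge a q with ha | ha <;> rcases lt_or_ge b q with hb | hb
    · rw [hz1 a ha, hz1 b hb]; exact h₁.mono hab
    · rw [hz1 a ha, hz2 b hb]
      exact ((lt1 a).2 ha).trans_le (not_lt.1 fun h => not_lt.2 hb ((lt2 b).1 h))
    · linarith
    · rw [hz2 a ha, hz2 b hb]; exact h₂.mono hab
  · intro p hp
    rcases lt_or_ge p q with h | h
    · rw [hz1 p h, h₁.supp p hp]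
    · rw [hz2 p h, h₂.supp p hp]
  · intro u hu
    have hl1 := le_max_left v.length (max N₁ N₂)
    have hl2 := le_max_right v.length (max N₁ N₂)
    have hl3 := le_max_left N₁ N₂
    have hl4 := le_max_right N₁ N₂
    rcases lt_or_ge (dyad u 0) q with h | h
    · have : z • std u = z₁ • std u := by
        refine smul_eq_of_eqOn fun p hp => hz1 p ?_
        rw [range_std] at hp
        by_contra hcon
        have := lo_eq_of_mem_cell (u := u) (v := v) (by omega)
          ⟨h.le, (not_lt.1 hcon).trans_lt hp.2⟩
        exact h.ne this
      rw [bad, mem_ofPred_eq, this]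
      exact hN₁ u (by omega)
    · have : z • std u = z₂ • std u := by
        refine smul_eq_of_eqOn fun p hp => hz2 p ?_
        rw [range_std] at hp
        exact h.trans hp.1
      rw [bad, mem_ofPred_eq, this]
      exact hN₂ u (by omega)

/-! ### Centring -/

/-- The chart `y` is located on some orbit of a point moved by `f`. -/
def Livable (f : Equiv.Perm ℝ) (y : Chart) : Prop :=
  IsChart y ∧ ∃ x n, f x ≠ x ∧ Lives f y x n

lemma exists_center {Cs : Set ℤ} (hfin : Cs.Finite) {R : ℤ}
    (hC : ∀ c ∈ Cs, ∀ c' ∈ Cs, |c - c'| ≤ R) : ∃ m : ℤ, ∀ c ∈ Cs, 2 * |c + m| ≤ R + 1 := by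
  rcases Cs.eq_empty_or_nonempty with rfl | hne
  · exact ⟨0, fun c hc => absurd hc (notMem_empty c)⟩
  obtain ⟨a, ha, hmin⟩ := exists_min_image Cs id hfin hne
  obtain ⟨b, hb, hmax⟩ := exists_max_image Cs id hfin hne
  refine ⟨-((a + b) / 2), fun c hc => ?_⟩
  have h1 := hmin c hc
  have h2 := hmax c hc
  have h3 := hC b hb a ha
  simp only [id] at h1 h2
  rw [abs_le] at h3
  have : |c + -((a + b) / 2)| ≤ (R + 1) / 2 := by
    rw [abs_le]; omega
  omega

/-- A common correction commuting with `f` that balances the drifts of finitely many charts. -/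
lemma exists_centering (hf : IsPL f) (hg : IsPL g) (hh : IsPL h) (hc : g = h⁻¹ * f * h)
    {T : Set Chart} (hT : T.Finite) (hlive : ∀ y ∈ T, Livable f y ∧ Last f y 0) :
    ∃ z, IsPL z ∧ Commute z f ∧ (∀ p, f p = p → z p = p) ∧ ∀ y ∈ T, ∃ m : ℤ, z • y = f ^ m • y ∧
      ∀ c, Last g (h⁻¹ • y) c → 2 * |c + m| ≤ (badOv f).ncard + (badOv g).ncard + 1 := by
  induction hn : T.ncard using Nat.strong_induction_on generalizing T with
  | _ n ih =>
  by_cases hall : ∀ y ∈ T, ∀ y' ∈ T, ∀ c c', Last g (h⁻¹ • y) c → Last g (h⁻¹ • y') c' →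
      |c - c'| ≤ (badOv f).ncard + (badOv g).ncard
  · obtain ⟨m, hm⟩ := exists_center (Cs := {c | ∃ y ∈ T, Last g (h⁻¹ • y) c})
      (R := (badOv f).ncard + (badOv g).ncard) (by
        have : {c | ∃ y ∈ T, Last g (h⁻¹ • y) c} = ⋃ y ∈ T, {c | Last g (h⁻¹ • y) c} := by
          ext c; simp
        rw [this]
        exact hT.biUnion fun y _ => Set.Subsingleton.finite fun c h1 c' h2 => Last.unique h1 h2)
      (by rintro c ⟨y, hy, hc⟩ c' ⟨y', hy', hc'⟩; exact hall y hy y' hy' c c' hc hc')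
    exact ⟨f ^ m, hf.zpow m, (Commute.refl f).zpow_left m, fun p hp => zpow_fixed hp m,
      fun y hy => ⟨m, rfl, fun c hc => hm c ⟨y, hy, hc⟩⟩⟩
  · push Not at hall
    obtain ⟨y, hy, y', hy', c, c', hyc, hyc', hlt⟩ := hall
    have hsep : ∃ v, f (dyad v 0) = dyad v 0 ∧ (∃ t ∈ T, range t ⊆ Iio (dyad v 0)) ∧
        ∃ t ∈ T, range t ⊆ Ici (dyad v 0) := by
      obtain ⟨⟨hyC, x, n, hx, hl⟩, hb⟩ := hlive y hy
      obtain ⟨⟨hyC', x', n', hx', hl'⟩, hb'⟩ := hlive y' hy'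
      rcases le_total x x' with hxx | hxx
      · rcases drift_le_or_separated hf hg hh hc hyC hyC' hxx hx hx' hl hl' hb hyc hb' hyc' with
          h | ⟨v, h1, h2, h3⟩
        · rw [show (0 - c) - (0 - c') = -(c - c') by ring, abs_neg] at h
          exact absurd h (not_le.2 hlt)
        · exact ⟨v, h1, ⟨y, hy, h2⟩, ⟨y', hy', h3⟩⟩
      · rcases drift_le_or_separated hf hg hh hc hyC' hyC hxx hx' hx hl' hl hb' hyc' hb hyc with
          h | ⟨v, h1, h2, h3⟩
        · rw [show (0 - c') - (0 - c) = c - c' by ring] at h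
          exact absurd h (not_le.2 hlt)
        · exact ⟨v, h1, ⟨y', hy', h2⟩, ⟨y, hy, h3⟩⟩
    obtain ⟨v, hfv, ⟨t₁, ht₁, hr₁⟩, t₂, ht₂, hr₂⟩ := hsep
    have h0 : ∀ t : Chart, (range t).Nonempty := fun t => ⟨t ⟨0, by norm_num⟩, ⟨_, rfl⟩⟩
    have hcontra : ∀ t : Chart, range t ⊆ Iio (dyad v 0) → range t ⊆ Ici (dyad v 0) → False := by
      intro t h1 h2
      obtain ⟨p, hp⟩ := h0 t
      exact (lt_of_lt_of_le (mem_Iio.1 (h1 hp)) (mem_Ici.1 (h2 hp))).false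
    obtain ⟨z₁, hz₁, hcm₁, hfix₁, hb₁⟩ := ih {t ∈ T | range t ⊆ Iio (dyad v 0)}.ncard
      (by
        rw [← hn]
        exact ncard_lt_ncard ⟨fun t ht => ht.1, fun hsub => hcontra t₂ (hsub ht₂).2 hr₂⟩ hT)
      (hT.subset fun t ht => ht.1) (fun t ht => hlive t ht.1) rfl
    obtain ⟨z₂, hz₂, hcm₂, hfix₂, hb₂⟩ := ih {t ∈ T | range t ⊆ Ici (dyad v 0)}.ncard
      (by
        rw [← hn]
        exact ncard_lt_ncard ⟨fun t ht => ht.1, fun hsub => hcontra t₁ hr₁ (hsub ht₁).2⟩ hT)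
      (hT.subset fun t ht => ht.1) (fun t ht => hlive t ht.1) rfl
    obtain ⟨z, hz, hlo, hhi⟩ := exists_glue hz₁ hz₂ (hfix₁ _ hfv) (hfix₂ _ hfv)
    have hmono := hf.mono
    refine ⟨z, hz, ?_, ?_, ?_⟩
    · ext p
      simp only [Equiv.Perm.mul_apply]
      rcases lt_or_ge p (dyad v 0) with hp | hp
      · have h1 := hmono hp
        rw [hfv] at h1
        rw [hlo _ h1, hlo _ hp, ← Equiv.Perm.mul_apply, hcm₁.eq, Equiv.Perm.mul_apply]
      · have h1 := hmono.monotone hp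
        rw [hfv] at h1
        rw [hhi _ h1, hhi _ hp, ← Equiv.Perm.mul_apply, hcm₂.eq, Equiv.Perm.mul_apply]
    · intro p hp
      rcases lt_or_ge p (dyad v 0) with h | h
      · rw [hlo _ h, hfix₁ _ hp]
      · rw [hhi _ h, hfix₂ _ hp]
    · intro t ht
      obtain ⟨⟨htC, x, n, hx, hl⟩, -⟩ := hlive t ht
      have hs := hl.separated hf htC hfv
      have hxv : x ≠ dyad v 0 := by rintro rfl; exact hx hfv
      rcases lt_or_gt_of_ne hxv with h | h
      · obtain ⟨m, hm, hm2⟩ := hb₁ t ⟨ht, hs.1 h⟩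
        exact ⟨m, by rw [← hm]; exact smul_eq_of_eqOn fun p hp => hlo p (hs.1 h hp), hm2⟩
      · obtain ⟨m, hm, hm2⟩ := hb₂ t ⟨ht, hs.2 h⟩
        exact ⟨m, by rw [← hm]; exact smul_eq_of_eqOn fun p hp => hhi p (hs.2 h hp), hm2⟩

/-- A conjugator can be corrected so that finitely many drifts are balanced. -/
lemma exists_centered_conjugator (hf : IsPL f) (hg : IsPL g) (hh : IsPL h) (hc : g = h⁻¹ * f * h)
    {T : Set Chart} (hT : T.Finite) (hlive : ∀ y ∈ T, Livable f y ∧ Last f y 0) :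
    ∃ z, IsPL z ∧ g = (z * h)⁻¹ * f * (z * h) ∧ (∀ p, f p = p → z p = p) ∧ ∀ y ∈ T,
      ∀ c, Last g ((z * h)⁻¹ • y) c → 2 * |c| ≤ (badOv f).ncard + (badOv g).ncard + 1 := by
  obtain ⟨z, hz, hcm, hfix, hb⟩ := exists_centering hf hg hh hc hT hlive
  refine ⟨z, hz, ?_, hfix, fun y hy c hlast => ?_⟩
  · rw [hc, mul_inv_rev, mul_assoc (h⁻¹ * z⁻¹), ← mul_assoc f, ← hcm.eq]; group
  · obtain ⟨m, hm, hbound⟩ := hb y hy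
    have e1 : (z * h)⁻¹ • y = g ^ (-m) • h⁻¹ • y := by
      rw [conj_zpow hc, mul_inv_rev, mul_smul, mul_smul, mul_smul, smul_inv_smul, zpow_neg]
      congr 1
      rw [inv_smul_eq_iff, ← zpow_neg, ← mul_smul, (hcm.zpow_right (-m)).eq, mul_smul, hm, zpow_neg,
        inv_smul_smul]
    rw [e1] at hlast
    have h2 := hlast.zpow_smul m
    rw [← mul_smul, ← zpow_add, add_neg_cancel, zpow_zero, one_smul] at h2
    have := hbound _ h2
    rwa [sub_add_cancel] at this

end

section

variable {f g h k : Equiv.Perm ℝ} {x : ℝ} {y : Chart}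

/-! ### Tiles -/

/-- The left end of the unit interval. -/
def origin : ↥(Ico (0 : ℝ) 1) := ⟨0, by norm_num⟩

lemma origin_le (s : ↥(Ico (0 : ℝ) 1)) : origin ≤ s := s.2.1

/-- Charts onto half-open intervals that are standard after subdivision. -/
structure IsTile (c : Chart) : Prop where
  mono : StrictMono c
  rng : ∃ q, range c = Ico (c origin) q
  fin : ∃ N, ∀ v : List Bool, v.length = N → sub c v ∈ range std

lemma mem_range_sub {c : Chart} {s : ↥(Ico (0 : ℝ) 1)} {v : List Bool} (hs : (s : ℝ) ∈ cell v) :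
    c s ∈ range (sub c v) := by
  rw [← range_std] at hs
  obtain ⟨t, ht⟩ := hs
  exact ⟨t, congrArg c (Subtype.ext ht)⟩

lemma IsTile.exists_bound {c : Chart} (hc : IsTile c) :
    ∃ N, ∀ v : List Bool, N ≤ v.length → sub c v ∈ range std := by
  obtain ⟨N, hN⟩ := hc.fin
  refine ⟨N, fun v hv => ?_⟩
  obtain ⟨u, hu⟩ := hN (v.take N) (by simpa using hv)
  refine ⟨u ++ v.drop N, ?_⟩
  rw [← std_sub, hu, sub_sub, List.take_append_drop]

lemma IsTile.range_subset {c : Chart} (hc : IsTile c) : range c ⊆ Ico 0 1 := by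
  rintro _ ⟨s, rfl⟩
  obtain ⟨N, hN⟩ := hc.fin
  obtain ⟨v, hv, hs⟩ := exists_word s.2 N
  obtain ⟨u, hu⟩ := hN v hv
  have := mem_range_sub (c := c) hs
  rw [← hu, range_std] at this
  exact cell_subset_unit u this

lemma isTile_smul_std (hk : IsPL k) (u : List Bool) : IsTile (k • std u) where
  mono s t hst := hk.mono (dyad_strictMono u hst)
  rng := by
    refine ⟨k (dyad u 1), ?_⟩
    ext p
    have : p = k (k⁻¹ p) := by simp
    rw [this, mem_range_smul, range_std]
    exact and_congr hk.mono.le_iff_le.symm hk.mono.lt_iff_lt.symm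
  fin := by
    obtain ⟨N, hN⟩ := hk.exists_bound
    refine ⟨N, fun v hv => ?_⟩
    rw [← smul_sub, std_sub]
    by_contra hb
    exact hN (u ++ v) (by rw [List.length_append]; omega) hb

/-- Two tiles with the same range differ by an element of the group. -/
lemma exists_match_tile {c c' : Chart} (hc : IsTile c) (hc' : IsTile c') (hr : range c = range c') :
    ∃ z, IsPL z ∧ z • c' = c ∧ ∀ p, p ∉ range c → z p = p := by
  classical
  set σ : Equiv.Perm {p // p ∈ range c} := (Equiv.setCongr hr).trans
    ((Equiv.ofInjective c' hc'.mono.injective).symm.trans (Equiv.ofInjective c hc.mono.injective))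
    with hσ
  set z : Equiv.Perm ℝ := Equiv.Perm.ofSubtype σ
  have hz1 : ∀ s, z (c' s) = c s := by
    intro s
    have hmem : c' s ∈ range c := hr ▸ mem_range_self s
    have : z (c' s) = σ ⟨c' s, hmem⟩ := Equiv.Perm.ofSubtype_apply_of_mem σ hmem
    rw [this, hσ]
    simp only [Equiv.trans_apply, Equiv.setCongr_apply]
    rw [Equiv.ofInjective_symm_apply, Equiv.ofInjective_apply]
  have hz2 : ∀ p, p ∉ range c → z p = p := fun p hp => Equiv.Perm.ofSubtype_apply_of_not_mem σ hp
  refine ⟨z, ?_, funext hz1, hz2⟩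
  obtain ⟨q, hq⟩ := hc.rng
  have hz3 : ∀ p, p ∈ range c → z p ∈ range c := by
    rw [hr]
    rintro _ ⟨s, rfl⟩
    rw [hz1, ← hr]; exact ⟨s, rfl⟩
  obtain ⟨N, hN⟩ := hc.exists_bound
  obtain ⟨N', hN'⟩ := hc'.exists_bound
  have hex : ∃ B : ℕ, ∀ v : List Bool, v.length = max N N' → ∀ u, std u = sub c' v →
      u.length ≤ B := by
    have hfin : {u | ∃ v : List Bool, v.length = max N N' ∧ std u = sub c' v}.Finite := by
      refine (((List.finite_length_eq Bool (max N N')).image (sub c')).preimage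
        std_injective.injOn).subset ?_
      rintro u ⟨v, hv, e⟩
      exact ⟨v, hv, e.symm⟩
    obtain ⟨B, hB⟩ := (hfin.image List.length).bddAbove
    exact ⟨B, fun v hv u e => hB ⟨u, ⟨v, hv, e⟩, rfl⟩⟩
  obtain ⟨B, hB⟩ := hex
  refine IsPL.of_length (N := B) ?_ (fun p hp => hz2 p fun h => hp (hc.range_subset h)) ?_
  · intro a b hab
    by_cases ha : a ∈ range c <;> by_cases hb : b ∈ range c
    · rw [hr] at ha hb
      obtain ⟨s, rfl⟩ := ha
      obtain ⟨t, rfl⟩ := hb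
      rw [hz1, hz1]
      exact hc.mono (hc'.mono.lt_iff_lt.1 hab)
    · have h1 := hz3 a ha
      rw [hz2 b hb]
      rw [hq] at ha hb h1
      have : q ≤ b := by
        by_contra hlt
        exact hb ⟨ha.1.trans hab.le, not_le.1 hlt⟩
      exact h1.2.trans_le this
    · have h1 := hz3 b hb
      rw [hz2 a ha]
      rw [hq] at ha hb h1
      have : a < c origin := by
        by_contra hlt
        exact ha ⟨not_lt.1 hlt, hab.trans hb.2⟩
      exact this.trans_le h1.1
    · rwa [hz2 a ha, hz2 b hb]
  · intro u hu
    by_cases hmeet : ∃ p ∈ cell u, p ∈ range c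
    · obtain ⟨p, hpu, hp⟩ := hmeet
      rw [hr] at hp
      obtain ⟨s, rfl⟩ := hp
      obtain ⟨v, hv, hs⟩ := exists_word s.2 (max N N')
      obtain ⟨a, ha⟩ := hN' v (by rw [hv]; exact le_max_right _ _)
      obtain ⟨b, hb⟩ := hN v (by rw [hv]; exact le_max_left _ _)
      have hpa := mem_range_sub (c := c') hs
      rw [← ha, range_std] at hpa
      have hab : z • std a = std b := by
        rw [ha, smul_sub, show z • c' = c from funext hz1, hb]
      have hlen := hB v hv a ha
      rcases prefix_or_prefix hpa hpu with ⟨r, rfl⟩ | hp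
      · exact not_mem_bad.2 ⟨_, smul_std_append hab r⟩
      · rw [hp.eq_of_length_le (by omega)]
        exact not_mem_bad.2 ⟨_, hab⟩
    · push Not at hmeet
      refine not_mem_bad.2 ⟨u, ?_⟩
      have := smul_eq_of_eqOn (z := z) (z' := 1) (y := std u) fun p hp => by
        rw [range_std] at hp
        exact hz2 p (hmeet p hp)
      rw [this, one_smul]

/-- The chart obtained by juxtaposing two charts. -/
def merge (c c₂ : Chart) : Chart := fun s =>
  if h : (s : ℝ) < 1 / 2 then c ⟨2 * s, by have := s.2.1; constructor <;> linarith⟩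
  else c₂ ⟨2 * s - 1, by have := s.2.2; constructor <;> linarith⟩

lemma sub_merge_false (c c₂ : Chart) : sub (merge c c₂) [false] = c := by
  funext s
  have : dyad [false] s < 1 / 2 := by have := s.2.2; simp [dyad]; linarith
  simp only [sub, merge, this, dite_true]
  congr 1
  exact Subtype.ext (by simp [dyad]; ring)

lemma sub_merge_true (c c₂ : Chart) : sub (merge c c₂) [true] = c₂ := by
  funext s
  have : ¬ dyad [true] s < 1 / 2 := by have := s.2.1; simp [dyad]; linarith
  simp only [sub, merge, this, dite_false]
  congr 1
  exact Subtype.ext (by simp [dyad]; ring)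

lemma range_merge (c c₂ : Chart) : range (merge c c₂) = range c ∪ range c₂ := by
  apply Subset.antisymm
  · rintro _ ⟨s, rfl⟩
    simp only [merge]
    split_ifs
    · exact Or.inl ⟨_, rfl⟩
    · exact Or.inr ⟨_, rfl⟩
  · apply union_subset
    · conv_lhs => rw [← sub_merge_false c c₂]
      exact range_sub_subset _ _
    · conv_lhs => rw [← sub_merge_true c c₂]
      exact range_sub_subset _ _

lemma merge_origin (c c₂ : Chart) : merge c c₂ origin = c origin := by
  have : ((origin : ↥(Ico (0 : ℝ) 1)) : ℝ) < 1 / 2 := by norm_num [origin]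
  simp only [merge, this, dite_true]
  congr 1
  exact Subtype.ext (by simp [origin])

lemma IsTile.merge {c c₂ : Chart} (hc : IsTile c) (hc₂ : IsTile c₂)
    (hr : range c = Ico (c origin) (c₂ origin)) : IsTile (merge c c₂) where
  mono s t hst := by
    have hst' : (s : ℝ) < t := hst
    simp only [Thompson.merge]
    split_ifs with h1 h2
    · exact hc.mono (Subtype.mk_lt_mk.2 (by linarith))
    · have h3 : c ⟨2 * s, by have := s.2.1; constructor <;> linarith⟩ ∈ range c := ⟨_, rfl⟩
      rw [hr] at h3
      exact h3.2.trans_le (hc₂.mono.monotone (origin_le _))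
    · linarith
    · exact hc₂.mono (Subtype.mk_lt_mk.2 (by linarith))
  rng := by
    obtain ⟨q, hq⟩ := hc₂.rng
    refine ⟨q, ?_⟩
    have h1 : c₂ origin ∈ range c₂ := ⟨_, rfl⟩
    have h2 : c origin ∈ range c := ⟨_, rfl⟩
    rw [hq] at h1
    rw [hr] at h2
    rw [range_merge, merge_origin, hr, hq, Ico_union_Ico_eq_Ico h2.2.le h1.2.le]
  fin := by
    obtain ⟨N, hN⟩ := hc.exists_bound
    obtain ⟨N₂, hN₂⟩ := hc₂.exists_bound
    refine ⟨max N N₂ + 1, fun v hv => ?_⟩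
    cases v with
    | nil => simp at hv
    | cons b v =>
      have hv' : v.length = max N N₂ := by simpa using hv
      rw [show b :: v = [b] ++ v from rfl, ← sub_sub]
      cases b
      · rw [sub_merge_false]; exact hN v (by rw [hv']; exact le_max_left _ _)
      · rw [sub_merge_true]; exact hN₂ v (by rw [hv']; exact le_max_right _ _)

/-! ### Matching two tilings -/

/-- All subcharts of the charts in `L`. -/
def subs (L : Finset Chart) : Set Chart := {y | ∃ c ∈ L, ∃ v, y = sub c v}

/-- The finitely many tiles in `L` are disjoint with union `U`. -/
structure Tiling (L : Finset Chart) (U : Set ℝ) : Prop where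
  tile : ∀ c ∈ L, IsTile c
  disj : ∀ c ∈ L, ∀ c' ∈ L, ∀ p, p ∈ range c → p ∈ range c' → c = c'
  union : ∀ p, p ∈ U ↔ ∃ c ∈ L, p ∈ range c

lemma Tiling.exists_merge {L : Finset Chart} {U : Set ℝ} (hL : Tiling L U) {c : Chart} (hc : c ∈ L)
    (hmin : ∀ c' ∈ L, c origin ≤ c' origin) {q : ℝ} (hr : range c = Ico (c origin) q)
    (hq : q ∈ U) : ∃ L₁ m, Tiling L₁ U ∧ L₁.card + 1 = L.card ∧ subs L₁ = insert m (subs L) := by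
  classical
  obtain ⟨c₂, hc₂, hqc⟩ := (hL.union q).1 hq
  obtain ⟨q₂, hr₂⟩ := (hL.tile c₂ hc₂).rng
  have hne : c₂ ≠ c := by
    rintro rfl
    rw [hr] at hqc
    exact hqc.2.false
  have h2 : c₂ origin = q := by
    have h3 : c₂ origin ≤ q := by rw [hr₂] at hqc; exact hqc.1
    by_contra hlt
    refine hne (hL.disj c₂ hc₂ c hc (c₂ origin) ⟨_, rfl⟩ ?_)
    rw [hr]
    exact ⟨hmin c₂ hc₂, lt_of_le_of_ne h3 hlt⟩
  have hm := (hL.tile c hc).merge (hL.tile c₂ hc₂) (by rw [h2, hr])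
  have hrange : ∀ p, p ∈ range (merge c c₂) ↔ p ∈ range c ∨ p ∈ range c₂ := by
    intro p; rw [range_merge]; rfl
  have hmem : ∀ a, a ∈ (L.erase c).erase c₂ ↔ a ∈ L ∧ a ≠ c ∧ a ≠ c₂ := by
    intro a; simp only [Finset.mem_erase]; tauto
  have hmdis : ∀ a ∈ (L.erase c).erase c₂, ∀ p, p ∈ range a → p ∈ range (merge c c₂) → False := by
    intro a ha p hpa hpm
    rw [hmem] at ha
    rcases (hrange p).1 hpm with h | h
    · exact ha.2.1 (hL.disj a ha.1 c hc p hpa h)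
    · exact ha.2.2 (hL.disj a ha.1 c₂ hc₂ p hpa h)
  refine ⟨insert (merge c c₂) ((L.erase c).erase c₂), merge c c₂, ⟨?_, ?_, ?_⟩, ?_, ?_⟩
  · intro a ha
    rcases Finset.mem_insert.1 ha with rfl | ha
    · exact hm
    · exact hL.tile a ((hmem a).1 ha).1
  · intro a ha a' ha' p hp hp'
    rcases Finset.mem_insert.1 ha with rfl | ha <;> rcases Finset.mem_insert.1 ha' with rfl | ha'
    · rfl
    · exact (hmdis a' ha' p hp' hp).elim
    · exact (hmdis a ha p hp hp').elim
    · exact hL.disj a ((hmem a).1 ha).1 a' ((hmem a').1 ha').1 p hp hp'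
  · intro p
    rw [hL.union, Finset.exists_mem_insert, hrange]
    constructor
    · rintro ⟨a, ha, hp⟩
      by_cases h1 : a = c
      · exact Or.inl (Or.inl (h1 ▸ hp))
      by_cases h3 : a = c₂
      · exact Or.inl (Or.inr (h3 ▸ hp))
      exact Or.inr ⟨a, (hmem a).2 ⟨ha, h1, h3⟩, hp⟩
    · rintro ((h | h) | ⟨a, ha, h⟩)
      · exact ⟨c, hc, h⟩
      · exact ⟨c₂, hc₂, h⟩
      · exact ⟨a, ((hmem a).1 ha).1, h⟩
  · have hnot : merge c c₂ ∉ (L.erase c).erase c₂ := fun h =>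
      hmdis _ h _ (mem_range_self origin) (mem_range_self origin)
    have h3 : c₂ ∈ L.erase c := Finset.mem_erase.2 ⟨hne, hc₂⟩
    rw [Finset.card_insert_of_notMem hnot, Finset.card_erase_of_mem h3, Finset.card_erase_of_mem hc]
    have := Finset.card_pos.2 ⟨_, h3⟩
    rw [Finset.card_erase_of_mem hc] at this
    omega
  · ext a
    simp only [subs, mem_ofPred_eq, Finset.exists_mem_insert, mem_insert_iff]
    constructor
    · rintro (⟨v, rfl⟩ | ⟨d, hd, v, rfl⟩)
      · cases v with
        | nil => exact Or.inl rfl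
        | cons b v =>
          rw [show b :: v = [b] ++ v from rfl, ← sub_sub]
          cases b
          · rw [sub_merge_false]; exact Or.inr ⟨c, hc, v, rfl⟩
          · rw [sub_merge_true]; exact Or.inr ⟨c₂, hc₂, v, rfl⟩
      · exact Or.inr ⟨d, ((hmem d).1 hd).1, v, rfl⟩
    · rintro (rfl | ⟨d, hd, v, rfl⟩)
      · exact Or.inl ⟨[], rfl⟩
      · by_cases h1 : d = c
        · exact Or.inl ⟨[false] ++ v, by rw [← sub_sub, sub_merge_false, h1]⟩
        by_cases h3 : d = c₂
        · exact Or.inl ⟨[true] ++ v, by rw [← sub_sub, sub_merge_true, h3]⟩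
        exact Or.inr ⟨d, (hmem d).2 ⟨hd, h1, h3⟩, v, rfl⟩

lemma Tiling.erase {L : Finset Chart} {U : Set ℝ} [DecidableEq Chart] (hL : Tiling L U) {c : Chart}
    (hc : c ∈ L) : Tiling (L.erase c) (U \ range c) where
  tile a ha := hL.tile a (Finset.mem_of_mem_erase ha)
  disj a ha b hb := hL.disj a (Finset.mem_of_mem_erase ha) b (Finset.mem_of_mem_erase hb)
  union p := by
    rw [mem_sdiff, hL.union]
    constructor
    · rintro ⟨⟨a, ha, hp⟩, hn⟩
      exact ⟨a, Finset.mem_erase.2 ⟨by rintro rfl; exact hn hp, ha⟩, hp⟩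
    · rintro ⟨a, ha, hp⟩
      obtain ⟨h1, h2⟩ := Finset.mem_erase.1 ha
      exact ⟨⟨a, h2, hp⟩, fun h => h1 (hL.disj a h2 c hc p hp h)⟩

lemma mem_of_supported {z : Equiv.Perm ℝ} {V : Set ℝ} (hz : ∀ p, p ∉ V → z p = p) {p : ℝ}
    (hp : p ∈ V) : z p ∈ V := by
  by_contra h
  have := z.injective (hz _ h)
  rw [this] at h
  exact h hp

lemma Tiling.range_subset {L : Finset Chart} {U : Set ℝ} (hL : Tiling L U) (hy : y ∈ subs L) :
    range y ⊆ U := by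
  obtain ⟨c, hc, v, rfl⟩ := hy
  exact fun p hp => (hL.union p).2 ⟨c, hc, range_sub_subset c v hp⟩

/-- Two tilings of the same set can be matched up to few charts. -/
lemma exists_match {L L' : Finset Chart} {U : Set ℝ} (hL : Tiling L U) (hL' : Tiling L' U) :
    ∃ z, IsPL z ∧ (∀ p, p ∉ U → z p = p) ∧ ∃ D : Finset Chart, D.card ≤ L.card + L'.card ∧
      ∀ y, y ∉ D → (y ∈ subs L ↔ z⁻¹ • y ∈ subs L') := by
  classical
  induction hn : L.card + L'.card using Nat.strong_induction_on generalizing L L' U with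
  | _ n ih =>
  rcases U.eq_empty_or_nonempty with rfl | ⟨p₀, hp₀⟩
  · refine ⟨1, IsPL.one, fun _ _ => rfl, ∅, by simp, fun y _ => ?_⟩
    have : ∀ {K : Finset Chart}, Tiling K ∅ → ∀ a, a ∉ subs K := by
      intro K hK a ha
      exact hK.range_subset ha (mem_range_self origin)
    exact iff_of_false (this hL y) (this hL' _)
  have hleft : ∀ {K : Finset Chart}, Tiling K U → ∃ c ∈ K, ∀ c' ∈ K, c origin ≤ c' origin := by
    intro K hK
    obtain ⟨c, hc, -⟩ := (hK.union p₀).1 hp₀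
    exact Finset.exists_min_image K (fun c => c origin) ⟨c, hc⟩
  obtain ⟨c, hc, hmin⟩ := hleft hL
  obtain ⟨c', hc', hmin'⟩ := hleft hL'
  have hlo : ∀ {K K' : Finset Chart} {c c' : Chart}, Tiling K U → Tiling K' U → c ∈ K →
      (∀ a ∈ K', c' origin ≤ a origin) → c' origin ≤ c origin := by
    intro K K' c c' hK hK' hc hm
    obtain ⟨a, ha, hp⟩ := (hK'.union (c origin)).1 ((hK.union _).2 ⟨c, hc, mem_range_self _⟩)
    obtain ⟨q, hq⟩ := (hK'.tile a ha).rng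
    rw [hq] at hp
    exact (hm a ha).trans hp.1
  have heq : c origin = c' origin := le_antisymm (hlo hL' hL hc' hmin) (hlo hL hL' hc hmin')
  obtain ⟨q, hq⟩ := (hL.tile c hc).rng
  obtain ⟨q', hq'⟩ := (hL'.tile c' hc').rng
  have h1 : c origin ∈ range c := mem_range_self _
  have h1' : c' origin ∈ range c' := mem_range_self _
  rw [hq] at h1
  rw [hq'] at h1'
  rcases lt_trichotomy q q' with hlt | hqq | hlt
  · obtain ⟨L₁, m, hL₁, hcard, hsubs⟩ := hL.exists_merge hc hmin hq
      ((hL'.union q).2 ⟨c', hc', by rw [hq', ← heq]; exact ⟨h1.2.le, hlt⟩⟩)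
    obtain ⟨z, hz, hfix, D, hD, hyD⟩ := ih _ (by omega) hL₁ hL' rfl
    refine ⟨z, hz, hfix, insert m D, ?_, fun y hy => ?_⟩
    · have := Finset.card_insert_le m D
      omega
    · rw [Finset.mem_insert, not_or] at hy
      rw [← hyD y hy.2, hsubs, mem_insert_iff]
      exact ⟨Or.inr, fun h => h.resolve_left hy.1⟩
  · have hrr : range c = range c' := by rw [hq, hq', heq, hqq]
    obtain ⟨z₀, hz₀, hzc, hfix₀⟩ := exists_match_tile (hL.tile c hc) (hL'.tile c' hc') hrr
    have hE := hL.erase hc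
    have hE' := hL'.erase hc'
    rw [← hrr] at hE'
    obtain ⟨z₁, hz₁, hfix₁, D, hD, hyD⟩ := ih _ (by
      rw [← hn]
      exact Nat.add_lt_add (Finset.card_erase_lt_of_mem hc) (Finset.card_erase_lt_of_mem hc'))
      hE hE' rfl
    have hsplit : ∀ {K : Finset Chart} {c : Chart}, c ∈ K → ∀ a, a ∈ subs K ↔
        (∃ v, a = sub c v) ∨ a ∈ subs (K.erase c) := by
      intro K c hc a
      constructor
      · rintro ⟨d, hd, v, rfl⟩
        by_cases h : d = c
        · exact Or.inl ⟨v, by rw [h]⟩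
        · exact Or.inr ⟨d, Finset.mem_erase.2 ⟨h, hd⟩, v, rfl⟩
      · rintro (⟨v, rfl⟩ | ⟨d, hd, v, rfl⟩)
        · exact ⟨c, hc, v, rfl⟩
        · exact ⟨d, Finset.mem_of_mem_erase hd, v, rfl⟩
    have hone : ∀ v, (z₀ * z₁) • sub c' v = sub c v := by
      intro v
      have : z₁ • sub c' v = (1 : Equiv.Perm ℝ) • sub c' v := smul_eq_of_eqOn fun p hp =>
        hfix₁ p fun h => h.2 (hrr ▸ range_sub_subset c' v hp)
      rw [mul_smul, this, one_smul, smul_sub, hzc]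
    have htriv : ∀ a : Chart, range a ⊆ U \ range c → z₀ • a = a := fun a ha => by
      have : z₀ • a = (1 : Equiv.Perm ℝ) • a := smul_eq_of_eqOn fun p hp => hfix₀ p (ha hp).2
      rw [this, one_smul]
    refine ⟨z₀ * z₁, hz₀.mul hz₁, fun p hp => ?_, D, ?_, fun y hy => ?_⟩
    · have hpc : p ∉ range c := fun h => hp ((hL.union p).2 ⟨c, hc, h⟩)
      rw [Equiv.Perm.mul_apply, hfix₁ p fun h => hp h.1, hfix₀ p hpc]
    · have h2 := Finset.card_erase_le (s := L) (a := c)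
      have h3 := Finset.card_erase_le (s := L') (a := c')
      omega
    · rw [hsplit hc, hsplit hc']
      constructor
      · rintro (⟨v, rfl⟩ | h)
        · exact Or.inl ⟨v, by rw [← hone v, inv_smul_smul]⟩
        · right
          rw [mul_inv_rev, mul_smul, inv_smul_eq_iff.2 (htriv y (hE.range_subset h)).symm]
          exact (hyD y hy).1 h
      · rintro (⟨v, h⟩ | h)
        · exact Or.inl ⟨v, by rw [← hone v, ← h, smul_inv_smul]⟩
        · right
          have h2 := hE'.range_subset h
          have h3 : z₀ • z₁ • (z₀ * z₁)⁻¹ • y = z₁ • (z₀ * z₁)⁻¹ • y := by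
            refine htriv _ ?_
            rintro _ ⟨s, rfl⟩
            exact mem_of_supported hfix₁ (h2 ⟨s, rfl⟩)
          rw [← mul_smul z₀, smul_inv_smul] at h3
          rw [hyD y hy, inv_smul_eq_iff.2 h3]
          exact h
  · obtain ⟨L₁, m, hL₁, hcard, hsubs⟩ := hL'.exists_merge hc' hmin' hq'
      ((hL.union q').2 ⟨c, hc, by rw [hq, heq]; exact ⟨h1'.2.le, hlt⟩⟩)
    obtain ⟨z, hz, hfix, D, hD, hyD⟩ := ih _ (by omega) hL hL₁ rfl
    refine ⟨z, hz, hfix, insert (z • m) D, ?_, fun y hy => ?_⟩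
    · have := Finset.card_insert_le (z • m) D
      omega
    · rw [Finset.mem_insert, not_or] at hy
      rw [hyD y hy.2, hsubs, mem_insert_iff]
      exact ⟨fun h => h.resolve_left fun h => hy.1 (by rw [← h, smul_inv_smul]), Or.inr⟩

end

section

variable {f g h k : Equiv.Perm ℝ} {x : ℝ} {y : Chart}

/-! ### The fixed part -/

/-- The minimal words whose standard chart is fixed. -/
def minFix (f : Equiv.Perm ℝ) : Set (List Bool) :=
  {u | f • std u = std u ∧ ∀ v, v <+: u → f • std v = std v → v = u}

lemma minFix_eq_of_prefix {u v : List Bool} (hu : u ∈ minFix f) (hv : v ∈ minFix f)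
    (h : u <+: v) : u = v := hv.2 u h hu.1

lemma exists_minFix_prefix {u : List Bool} (hu : f • std u = std u) :
    ∃ v ∈ minFix f, v <+: u := by
  induction hn : u.length using Nat.strong_induction_on generalizing u with
  | _ n ih =>
  by_cases hmin : ∀ v, v <+: u → f • std v = std v → v = u
  · exact ⟨u, ⟨hu, hmin⟩, List.prefix_rfl⟩
  · push Not at hmin
    obtain ⟨v, hvu, hv, hne⟩ := hmin
    have hlt : v.length < n := by
      rw [← hn]
      exact lt_of_le_of_ne hvu.length_le fun e => hne (hvu.eq_of_length e)
    obtain ⟨v', h1, h2⟩ := ih _ hlt hv rfl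
    exact ⟨v', h1, h2.trans hvu⟩

lemma mem_badOv_of_minFix {v : List Bool} {l : ℕ} (h : v ++ (true :: zeros l) ∈ minFix f) :
    v ∈ badOv f := by
  have hfix := h.1
  refine ⟨fun hgood => ?_, dyad (v ++ (true :: zeros l)) 0,
    cell_append_subset _ _ (lo_mem_cell _), ?_⟩
  · obtain ⟨v', hv'⟩ := hgood
    have e := smul_std_append hv'.symm (true :: zeros l)
    rw [hfix] at e
    have e' := List.append_cancel_right (std_injective e)
    rw [← e'] at hv'
    have := congrArg List.length (h.2 v (List.prefix_append _ _) hv'.symm)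
    simp at this
  · exact cell_append_subset _ _ ((image_cell hfix).2 (lo_mem_cell _))

lemma ncard_minFix_le (hf : IsPL f) :
    (minFix f).Finite ∧ (minFix f).ncard ≤ (badOv f).ncard + 1 := by
  set A : Set (List Bool) := {u | u ∈ minFix f ∧ u = zeros u.length} with hA
  set B : Set (List Bool) := {u | u ∈ minFix f ∧ ∃ v l, u = v ++ (true :: zeros l)} with hB
  have hAsub : A.Subsingleton := by
    intro u hu v hv
    rcases le_total u.length v.length with hl | hl
    · refine minFix_eq_of_prefix hu.1 hv.1 ⟨zeros (v.length - u.length), ?_⟩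
      conv_lhs => rw [hu.2]
      rw [zeros_append, hv.2]
      simp only [zeros, List.length_replicate] at *
      congr 1; omega
    · refine (minFix_eq_of_prefix hv.1 hu.1 ⟨zeros (u.length - v.length), ?_⟩).symm
      conv_lhs => rw [hv.2]
      rw [zeros_append, hu.2]
      simp only [zeros, List.length_replicate] at *
      congr 1; omega
  have key : ∀ u ∈ B, ∃ v, v ∈ badOv f ∧ ∃ l, u = v ++ (true :: zeros l) := by
    rintro u ⟨h1, v, l, rfl⟩
    exact ⟨v, mem_badOv_of_minFix h1, l, rfl⟩
  choose! F hF1 hF2 using key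
  have hinj : InjOn F B := by
    intro u hu v hv e
    obtain ⟨l, hl⟩ := hF2 u hu
    obtain ⟨m, hm⟩ := hF2 v hv
    rw [← e] at hm
    have aux : ∀ a b : ℕ, a ≤ b → F u ++ true :: zeros a <+: F u ++ true :: zeros b := by
      intro a b hab
      refine ⟨zeros (b - a), ?_⟩
      rw [List.append_assoc, List.cons_append, zeros_append, Nat.add_sub_cancel' hab]
    rcases le_total l m with h | h
    · exact minFix_eq_of_prefix hu.1 hv.1 (by rw [hl, hm]; exact aux _ _ h)
    · exact (minFix_eq_of_prefix hv.1 hu.1 (by rw [hl, hm]; exact aux _ _ h)).symm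
  have hBfin : B.Finite := Set.Finite.of_injOn hF1 hinj hf.badOv_finite
  have hBle : B.ncard ≤ (badOv f).ncard := ncard_le_ncard_of_injOn F hF1 hinj hf.badOv_finite
  have hsub : minFix f ⊆ A ∪ B := fun u hu => by
    rcases eq_zeros_or u with h | h
    · exact Or.inl ⟨hu, h⟩
    · exact Or.inr ⟨hu, h⟩
  have hfin := hAsub.finite.union hBfin
  refine ⟨hfin.subset hsub, ?_⟩
  have h1 := ncard_le_ncard hsub hfin
  have h2 := ncard_union_le A B
  have h3 := (ncard_le_one hAsub.finite).2 fun u hu v hv => hAsub hu hv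
  omega

/-- The union of the fixed standard cells. -/
def fixedPart (f : Equiv.Perm ℝ) : Set ℝ := {p | ∃ u, f • std u = std u ∧ p ∈ cell u}

lemma fixedPart_conj (hh : IsPL h) (hc : g = h⁻¹ * f * h) {p : ℝ} (hp : p ∈ fixedPart f) :
    h⁻¹ p ∈ fixedPart g := by
  obtain ⟨u, hu, hpu⟩ := hp
  obtain ⟨N, hN⟩ := hh.inv.exists_bound
  obtain ⟨w, hw, hpw⟩ := exists_word (cell_subset_unit u hpu) (N + u.length)
  have huw : u <+: w := by
    rcases prefix_or_prefix hpu hpw with h | h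
    · exact h
    · rw [h.eq_of_length_le (by omega)]
  obtain ⟨v, hv⟩ := not_mem_bad.1 (hN w (by omega))
  obtain ⟨s, rfl⟩ := huw
  refine ⟨v, ?_, (image_cell hv).2 hpw⟩
  rw [← hv, conj_smul hc, smul_std_append hu]

lemma apply_of_smul_eq (hy : f • y = y) {p : ℝ} (hp : p ∈ range y) : f p = p := by
  obtain ⟨s, rfl⟩ := hp
  exact congrFun hy s

lemma apply_of_mem_fixedPart {p : ℝ} (hp : p ∈ fixedPart f) : f p = p := by
  obtain ⟨u, hu, hpu⟩ := hp
  exact apply_of_smul_eq hu (by rwa [range_std])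

/-- The images of the minimal fixed charts of a conjugate tile the fixed part. -/
lemma tiling_minFix (hg : IsPL g) (hh : IsPL h) (hc : g = h⁻¹ * f * h) :
    ∃ L : Finset Chart, L.card ≤ (badOv g).ncard + 1 ∧ Tiling L (fixedPart f) ∧
      ∀ y, f • y = y → (y ∈ subs L ↔ h⁻¹ • y ∈ range std) := by
  classical
  obtain ⟨hfin, hcard⟩ := ncard_minFix_le hg
  have hmem : ∀ c, c ∈ hfin.toFinset.image (fun u => h • std u) ↔
      ∃ u ∈ minFix g, h • std u = c := by
    intro c; simp
  have hrange : ∀ (u : List Bool) (p : ℝ), p ∈ range (h • std u) ↔ h⁻¹ p ∈ cell u := by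
    intro u p
    rw [← range_std, ← mem_range_smul h (std u), Equiv.Perm.coe_inv, Equiv.apply_symm_apply]
  have hc' : f = h⁻¹⁻¹ * g * h⁻¹ := by rw [hc]; group
  refine ⟨hfin.toFinset.image fun u => h • std u, ?_, ⟨?_, ?_, ?_⟩, fun y hy => ⟨?_, ?_⟩⟩
  · refine Finset.card_image_le.trans ?_
    rwa [← ncard_eq_toFinset_card _ hfin]
  · intro c hc
    obtain ⟨u, -, rfl⟩ := (hmem c).1 hc
    exact isTile_smul_std hh u
  · intro c hc c' hc' p hp hp'
    obtain ⟨u, hu, rfl⟩ := (hmem c).1 hc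
    obtain ⟨v, hv, rfl⟩ := (hmem c').1 hc'
    rw [hrange] at hp hp'
    rcases prefix_or_prefix hp hp' with h | h
    · rw [minFix_eq_of_prefix hu hv h]
    · rw [minFix_eq_of_prefix hv hu h]
  · intro p
    constructor
    · intro hp
      obtain ⟨u, hu, hpu⟩ := fixedPart_conj hh hc hp
      obtain ⟨v, hv, s, rfl⟩ := exists_minFix_prefix hu
      exact ⟨_, (hmem _).2 ⟨v, hv, rfl⟩, (hrange _ _).2 (cell_append_subset _ _ hpu)⟩
    · rintro ⟨c, hcL, hp⟩
      obtain ⟨u, hu, rfl⟩ := (hmem c).1 hcL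
      have := fixedPart_conj hh.inv hc' ⟨u, hu.1, (hrange _ _).1 hp⟩
      simpa using this
  · rintro ⟨c, hcL, s, rfl⟩
    obtain ⟨u, hu, rfl⟩ := (hmem c).1 hcL
    exact ⟨u ++ s, by rw [smul_sub, inv_smul_smul, std_sub]⟩
  · rintro ⟨u, hu⟩
    obtain ⟨v, hv, s, rfl⟩ := exists_minFix_prefix (f := g) (u := u)
      (by rw [hu, conj_smul hc, hy])
    refine ⟨_, (hmem _).2 ⟨v, hv, rfl⟩, s, ?_⟩
    rw [← smul_sub, std_sub, hu, smul_inv_smul]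

/-- A conjugator can be corrected so that it is standard on almost all fixed standard charts. -/
lemma exists_fixed_correction (hf : IsPL f) (hg : IsPL g) (hh : IsPL h)
    (hc : g = h⁻¹ * f * h) : ∃ z, IsPL z ∧ g = (z * h)⁻¹ * f * (z * h) ∧
      ∃ D : Finset Chart, D.card ≤ (badOv f).ncard + (badOv g).ncard + 2 ∧
        ∀ y, f • y = y → y ∉ D → (y ∈ range std ↔ (z * h)⁻¹ • y ∈ range std) := by
  obtain ⟨L, hL, hLt, hLs⟩ := tiling_minFix hf IsPL.one (show f = 1⁻¹ * f * 1 by simp)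
  obtain ⟨L', hL', hLt', hLs'⟩ := tiling_minFix hg hh hc
  obtain ⟨z, hz, hfix, D, hD, hDs⟩ := exists_match hLt hLt'
  have hcm : z * f = f * z := by
    ext p
    rw [Equiv.Perm.mul_apply, Equiv.Perm.mul_apply]
    by_cases hp : p ∈ fixedPart f
    · rw [apply_of_mem_fixedPart hp, apply_of_mem_fixedPart (mem_of_supported hfix hp)]
    · rw [hfix p hp, hfix]
      rintro ⟨u, hu, hpu⟩
      exact hp ⟨u, hu, (image_cell hu).1 hpu⟩
  refine ⟨z, hz, ?_, D, by omega, fun y hy hyD => ?_⟩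
  · rw [hc, mul_inv_rev, mul_assoc (h⁻¹ * z⁻¹), ← mul_assoc f, ← hcm]; group
  · have hy' : f • z⁻¹ • y = z⁻¹ • y := by
      rw [← mul_smul, (show Commute z f from hcm).inv_left.eq.symm, mul_smul, hy]
    have h1 := hLs y hy
    rw [inv_one, one_smul] at h1
    rw [← h1, hDs y hyD, hLs' _ hy', mul_inv_rev, mul_smul]

end

section

variable {f g h k : Equiv.Perm ℝ} {x : ℝ} {y : Chart}

/-! ### Eventually constant predicates on the integers -/

/-- The predicate is constant near `∞` and near `-∞`. -/
def EvConst (P : ℤ → Prop) : Prop :=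
  ∃ A B, (∀ t, t ≤ A → (P t ↔ P A)) ∧ ∀ t, B ≤ t → (P t ↔ P B)

/-- The predicate takes at `0` a value different from one before and from one after. -/
def Bump (P : ℤ → Prop) : Prop :=
  ∃ a < 0, ∃ b > 0, ¬ (P a ↔ P 0) ∧ ¬ (P 0 ↔ P b)

lemma iff_of_iff_succ {P : ℤ → Prop} {C : ℤ} (hP : ∀ t, C ≤ t → (P t ↔ P (t + 1))) {t : ℤ}
    (ht : C ≤ t) : P t ↔ P C := by
  induction t, ht using Int.leInduction with
  | base => exact Iff.rfl
  | succ n hn ih => rw [← hP n hn, ih]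

lemma iff_of_iff_pred {P : ℤ → Prop} {E : ℤ} (hP : ∀ t, t + 2 ≤ E → (P t ↔ P (t + 1))) {t : ℤ}
    (ht : t ≤ E - 1) : P t ↔ P (E - 1) := by
  have := iff_of_iff_succ (P := fun t => P (-t)) (C := -(E - 1)) (t := -t)
    (fun s hs => by
      have := hP (-(s + 1)) (by omega)
      rw [show -(s + 1) + 1 = -s by ring] at this
      exact this.symm) (by omega)
  simpa only [neg_neg] using this

lemma up_of_succ {P : ℤ → Prop} (hs : ∀ t, P t → P (t + 1)) {s t : ℤ} (hst : s ≤ t) (h : P s) :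
    P t := by
  induction t, hst using Int.leInduction with
  | base => exact h
  | succ n _ ih => exact hs n ih

lemma evConst_of_up {P : ℤ → Prop} (hs : ∀ t, P t → P (t + 1)) : EvConst P := by
  have key : ∃ A, ∀ t, t ≤ A → (P t ↔ P A) := by
    by_cases h : ∀ t, P t
    · exact ⟨0, fun t _ => by simp [h]⟩
    · push Not at h
      obtain ⟨A, hA⟩ := h
      exact ⟨A, fun t ht => ⟨up_of_succ hs ht, fun h => absurd h hA⟩⟩
  have key' : ∃ B, ∀ t, B ≤ t → (P t ↔ P B) := by
    by_cases h : ∃ t, P t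
    · obtain ⟨B, hB⟩ := h
      exact ⟨B, fun t ht => ⟨fun _ => hB, up_of_succ hs ht⟩⟩
    · push Not at h
      exact ⟨0, fun t _ => by simp [h]⟩
  obtain ⟨A, hA⟩ := key
  obtain ⟨B, hB⟩ := key'
  exact ⟨A, B, hA, hB⟩

lemma EvConst.neg {P : ℤ → Prop} (h : EvConst fun t => P (-t)) : EvConst P := by
  obtain ⟨A, B, hA, hB⟩ := h
  refine ⟨-B, -A, fun t ht => ?_, fun t ht => ?_⟩
  · simpa using hB (-t) (by omega)
  · simpa using hA (-t) (by omega)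

lemma not_bump_of_up {P : ℤ → Prop} (hs : ∀ t, P t → P (t + 1)) : ¬ Bump P := by
  rintro ⟨a, ha, b, hb, h1, h2⟩
  have h3 := up_of_succ hs ha.le
  have h4 := up_of_succ hs (show (0 : ℤ) ≤ b from le_of_lt hb)
  tauto

lemma not_bump_of_down {P : ℤ → Prop} (hs : ∀ t, P (t + 1) → P t) : ¬ Bump P := by
  rintro ⟨a, ha, b, hb, h1, h2⟩
  refine not_bump_of_up (P := fun t => P (-t)) (fun t ht => ?_)
    ⟨-b, by omega, -a, by omega, by simpa using fun h => h2 h.symm, by simpa using fun h => h1 h.symm⟩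
  refine hs _ ?_
  rwa [show -(t + 1) + 1 = -t by ring]

lemma exists_drop {P : ℤ → Prop} (h : Bump P) : ∃ t, P t ∧ ¬ P (t + 1) := by
  by_contra hno
  push Not at hno
  exact not_bump_of_up hno h

lemma exists_last_change {P : ℤ → Prop} {A B : ℤ} (hB : ∀ t, B ≤ t → (P t ↔ P B))
    (hne : ¬ (P A ↔ P B)) :
    ∃ b, (∀ t, b < t → (P t ↔ P B)) ∧ ¬ (P b ↔ P B) := by
  obtain ⟨C, hC⟩ := exists_least_time (P := fun t => ∀ s, t ≤ s → (P s ↔ P B))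
    (fun t ht s hs => ht s (by omega)) ⟨B, hB⟩ ⟨A, fun h => hne (h A le_rfl)⟩
  refine ⟨C - 1, fun t ht => (hC C).2 le_rfl t (by omega), fun h => ?_⟩
  have := (hC (C - 1)).1 fun s hs => by
    rcases hs.lt_or_eq with h1 | rfl
    · exact (hC C).2 le_rfl s (by omega)
    · exact h
  omega

lemma iff_of_not_iff {a b c : Prop} (h : ¬ (a ↔ b)) (h' : ¬ (a ↔ c)) : b ↔ c := by tauto

/-- Two eventually constant predicates that agree almost everywhere but not at `0`. -/
lemma bump_or_last {P Q : ℤ → Prop} (hP : EvConst P) (hQ : EvConst Q)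
    (hfin : {t | ¬ (P t ↔ Q t)}.Finite) (h0 : ¬ (P 0 ↔ Q 0)) :
    Bump P ∨ Bump Q ∨ ∃ b b', (∀ t, b < t → (P t ↔ ¬ P b)) ∧ (∀ t, b' < t → (Q t ↔ ¬ Q b')) ∧
      ¬ (b < 0 ↔ b' < 0) := by
  obtain ⟨A₁, B₁, hA₁, hB₁⟩ := hP
  obtain ⟨A₂, B₂, hA₂, hB₂⟩ := hQ
  obtain ⟨M, hM⟩ := hfin.bddAbove
  obtain ⟨m, hm⟩ := hfin.bddBelow
  have hagree : ∀ t, (M < t ∨ t < m) → (P t ↔ Q t) := by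
    intro t ht
    by_contra hne
    have h1 := hM hne
    have h2 := hm hne
    omega
  obtain ⟨B, hB0, hBM, hB1, hB2⟩ : ∃ B : ℤ, 0 < B ∧ M < B ∧ B₁ ≤ B ∧ B₂ ≤ B :=
    ⟨max (max 1 (M + 1)) (max B₁ B₂), by omega, by omega, by omega, by omega⟩
  obtain ⟨A, hA0, hAm, hA1, hA2⟩ : ∃ A : ℤ, A < 0 ∧ A < m ∧ A ≤ A₁ ∧ A ≤ A₂ :=
    ⟨min (min (-1) (m - 1)) (min A₁ A₂), by omega, by omega, by omega, by omega⟩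
  have hPB : ∀ t, B ≤ t → (P t ↔ P B) := fun t ht => by
    rw [hB₁ t (by omega), hB₁ B (by omega)]
  have hQB : ∀ t, B ≤ t → (Q t ↔ Q B) := fun t ht => by
    rw [hB₂ t (by omega), hB₂ B (by omega)]
  have eB := hagree B (Or.inl hBM)
  have eA := hagree A (Or.inr hAm)
  by_cases hends : P A ↔ P B
  · by_cases hp : P A ↔ P 0
    · have hq : ¬ (Q A ↔ Q 0) := fun h => h0 (hp.symm.trans (eA.trans h))
      exact Or.inr (Or.inl ⟨A, hA0, B, hB0, hq, fun h =>
        hq (eA.symm.trans (hends.trans (eB.trans h.symm)))⟩)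
    · exact Or.inl ⟨A, hA0, B, hB0, hp, fun h => hp (hends.trans h.symm)⟩
  · have hends' : ¬ (Q A ↔ Q B) := fun h => hends (eA.trans (h.trans eB.symm))
    obtain ⟨b, hb1, hb2⟩ := exists_last_change hPB hends
    obtain ⟨b', hb1', hb2'⟩ := exists_last_change hQB hends'
    by_cases hbb : b < 0 ↔ b' < 0
    · by_cases hneg : b < 0
      · exact absurd ((hb1 0 hneg).trans (eB.trans (hb1' 0 (hbb.1 hneg)).symm)) h0
      · have hneg' := fun h => hneg (hbb.2 h)
        by_cases hp : P 0 ↔ P B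
        · have : b ≠ 0 := by rintro rfl; exact hb2 hp
          exact Or.inl ⟨A, hA0, b, by omega, fun h => hends (h.trans hp),
            fun h => hb2 (h.symm.trans hp)⟩
        · have hq : Q 0 ↔ Q B := (iff_of_not_iff h0 hp).trans eB
          have : b' ≠ 0 := by rintro rfl; exact hb2' hq
          exact Or.inr (Or.inl ⟨A, hA0, b', by omega, fun h => hends' (h.trans hq),
            fun h => hb2' (h.symm.trans hq)⟩)
    · refine Or.inr (Or.inr ⟨b, b', fun t ht => ?_, fun t ht => ?_, hbb⟩)
      · exact (hb1 t ht).trans (not_iff.1 hb2).symm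
      · exact (hb1' t ht).trans (not_iff.1 hb2').symm

/-! ### Moving charts -/

/-- The chart is carried into itself. -/
def Ray (f : Equiv.Perm ℝ) (y : Chart) : Prop := ∃ w : List Bool, w ≠ [] ∧ f • y = sub y w

/-- The chart is carried off itself. -/
def Off (f : Equiv.Perm ℝ) (y : Chart) : Prop := ∀ p ∈ range y, f p ∉ range y

lemma Ray.conj (hc : g = h⁻¹ * f * h) (H : Ray f y) : Ray g (h⁻¹ • y) := by
  obtain ⟨w, hw, e⟩ := H
  exact ⟨w, hw, by rw [conj_smul hc, e, smul_sub]⟩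

lemma Off.conj (hc : g = h⁻¹ * f * h) (H : Off f y) : Off g (h⁻¹ • y) := by
  rintro _ ⟨s, rfl⟩ hm
  rw [smul_chart_apply, conj_apply hc, mem_range_smul] at hm
  exact H _ ⟨s, rfl⟩ hm

lemma eq_conj_zpow (f : Equiv.Perm ℝ) (t : ℤ) : f = (f ^ t)⁻¹ * f * f ^ t := by
  group

lemma Off.zpow_smul (H : Off f y) (t : ℤ) : Off f (f ^ t • y) := by
  have := H.conj (eq_conj_zpow f (-t))
  rwa [← zpow_neg, neg_neg] at this

lemma Ray.stdAt_succ (H : Ray f y) {t : ℤ} (ht : StdAt f y t) : StdAt f y (t + 1) := by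
  obtain ⟨w, -, e⟩ := H
  obtain ⟨u, hu⟩ := ht
  refine ⟨u ++ w, ?_⟩
  rw [zpow_add, mul_smul, zpow_one, e, smul_sub, ← hu, std_sub]

lemma Ray.stdAt_pred (H : Ray f⁻¹ y) {t : ℤ} (ht : StdAt f y (t + 1)) : StdAt f y t := by
  have := H.stdAt_succ (t := -(t + 1)) (by rwa [stdAt_inv, neg_neg])
  rwa [stdAt_inv, show -(-(t + 1) + 1) = t by ring] at this

lemma Off.exists_step (hf : IsPL f) (hy : IsChart y) (H : Off f y) :
    ∃ x, f x ≠ x ∧ range y ⊆ uIcc x (f x) := by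
  have hmin : ∀ p ∈ range y, y origin ≤ p := by
    rintro _ ⟨s, rfl⟩
    exact hy.strictMono.monotone (origin_le s)
  have h0 : y origin ∈ range y := ⟨_, rfl⟩
  have hoc := hy.ordConnected
  have hne : f (y origin) ≠ y origin := fun e => H _ h0 (by rwa [e])
  rcases lt_or_gt_of_ne hne with hlt | hgt
  · have e : f (f⁻¹ (y origin)) = y origin := by simp
    refine ⟨f⁻¹ (y origin), by rw [e]; exact (inv_apply_ne hne).symm, fun p hp => ?_⟩
    rw [e, uIcc_comm, uIcc_of_le (hf.mono.le_iff_le.1 (by rw [e]; exact hlt.le))]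
    refine ⟨hmin p hp, ?_⟩
    by_contra hlt'
    push Not at hlt'
    refine H (f⁻¹ (y origin)) (hoc.out h0 hp ⟨?_, hlt'.le⟩) (by rwa [e])
    exact hf.mono.le_iff_le.1 (by rw [e]; exact hlt.le)
  · refine ⟨y origin, hne, fun p hp => ?_⟩
    rw [uIcc_of_le hgt.le]
    refine ⟨hmin p hp, ?_⟩
    by_contra hlt'
    push Not at hlt'
    exact H _ h0 (hoc.out h0 hp ⟨hgt.le, hlt'.le⟩)

lemma Ray.exists_rayAt (hy : IsChart y) (H : Ray f y) : ∃ x n, f x ≠ x ∧ RayAt f y x n := by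
  obtain ⟨w, hw, e⟩ := H
  obtain ⟨k, u, hk, rfl⟩ := hy
  have e1 : (k⁻¹ * f * k) • std u = std (u ++ w) := by
    rw [mul_smul, mul_smul, e, ← smul_sub, inv_smul_smul, std_sub]
  have hne : (k⁻¹ * f * k) • std u ≠ std u := fun h => by
    rw [e1] at h
    exact hw (by simpa using std_injective h)
  obtain ⟨s, hs⟩ := Function.ne_iff.1 hne
  obtain ⟨n, hn⟩ := Thompson.exists_rayAt hw e1 hs (by rw [← range_std]; exact ⟨s, rfl⟩)
  have h1 := hn.conj (g := f) (h := k⁻¹) (by group)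
  rw [inv_inv] at h1
  refine ⟨_, n, fun h => hs ?_, h1⟩
  rw [smul_chart_apply, Equiv.Perm.mul_apply, Equiv.Perm.mul_apply, h, Equiv.Perm.coe_inv,
    Equiv.symm_apply_apply]

/-- The chart is carried into itself, onto a larger chart, or off itself. -/
def Moves (f : Equiv.Perm ℝ) (y : Chart) : Prop := Ray f y ∨ Ray f⁻¹ y ∨ Off f y

lemma Moves.conj (hc : g = h⁻¹ * f * h) (H : Moves f y) : Moves g (h⁻¹ • y) :=
  H.imp (Ray.conj hc) (Or.imp (Ray.conj (conj_inv hc)) (Off.conj hc))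

lemma Moves.livable (hf : IsPL f) (hy : IsChart y) (H : Moves f y) : Livable f y := by
  refine ⟨hy, ?_⟩
  rcases H with H | H | H
  · obtain ⟨x, n, hx, hn⟩ := H.exists_rayAt hy
    exact ⟨x, n, hx, Or.inr (Or.inl hn)⟩
  · obtain ⟨x, n, hx, hn⟩ := H.exists_rayAt hy
    refine ⟨x, -n - 1, ?_, Or.inr (Or.inr ?_)⟩
    · simpa using inv_apply_ne hx
    · rwa [show -(-n - 1) - 1 = n by ring]
  · obtain ⟨x, hx, hsub⟩ := H.exists_step hf hy
    exact ⟨x, 0, hx, Or.inl ⟨hsub, rfl⟩⟩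

lemma Moves.evConst (hf : IsPL f) (hy : IsChart y) (H : Moves f y) : EvConst (StdAt f y) := by
  rcases H with H | H | H
  · exact evConst_of_up fun t => H.stdAt_succ
  · refine EvConst.neg (evConst_of_up fun t ht => ?_)
    refine H.stdAt_pred ?_
    rwa [show -(t + 1) + 1 = -t by ring]
  · obtain ⟨x, hx, hsub⟩ := H.exists_step hf hy
    obtain ⟨E, C, hW⟩ := exists_window hf hx
    obtain ⟨h1, h2⟩ := stdAt_const_of_window hf hsub hW
    exact ⟨E - 1, C, fun t => iff_of_iff_pred h2, fun t => iff_of_iff_succ h1⟩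

lemma Moves.off_of_bump (H : Moves f y) (hb : Bump (StdAt f y)) : Off f y := by
  rcases H with H | H | H
  · exact absurd hb (not_bump_of_up fun t => H.stdAt_succ)
  · exact absurd hb (not_bump_of_down fun t => H.stdAt_pred)
  · exact H

/-- Standard charts are fixed, moving, or among finitely many exceptions. -/
lemma fixed_or_moves (f : Equiv.Perm ℝ) (u : List Bool) :
    u ∈ badOv f ∨ f • std u = std u ∨ Moves f (std u) := by
  by_cases hov : Ov f u
  swap
  · refine Or.inr (Or.inr (Or.inr (Or.inr fun p hp hp' => hov ?_)))
    rw [range_std] at hp hp'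
    exact ⟨p, hp, hp'⟩
  by_cases hb : u ∈ bad f
  · exact Or.inl ⟨hb, hov⟩
  obtain ⟨v, hv⟩ := not_mem_bad.1 hb
  obtain ⟨z, hz, hz'⟩ := hov
  right
  by_cases huv : u = v
  · left; rw [hv, huv]
  right
  rcases prefix_or_prefix hz' ((image_cell hv).2 hz) with ⟨w, rfl⟩ | ⟨w, rfl⟩
  · exact Or.inl ⟨w, by rintro rfl; simp at huv, by rw [hv, std_sub]⟩
  · refine Or.inr (Or.inl ⟨w, by rintro rfl; simp at huv, ?_⟩)
    conv_lhs => rw [← std_sub v w]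
    rw [smul_sub, smul_std_inv hv]

/-- A moving point visits each chart at most once along its orbit. -/
lemma zpow_smul_injective (hf : IsPL f) (hy : f • y ≠ y) :
    Function.Injective fun t : ℤ => f ^ t • y := by
  obtain ⟨s, hs⟩ := Function.ne_iff.1 hy
  rw [smul_chart_apply] at hs
  intro t t' e
  have e' : (f ^ t) (y s) = (f ^ t') (y s) := congrFun e s
  rcases lt_or_gt_of_ne hs with h | h
  · exact (orbit_strictAnti hf h).injective e'
  · exact (orbit_strictMono hf h).injective e'

end

section

variable {f g h k : Equiv.Perm ℝ} {x : ℝ} {y : Chart}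

/-! ### Counting the nonstandard charts -/

/-- A family of finite sets of bounded size over a finite index set has a small union. -/
lemma ncard_biUnion_le {α β : Type*} {S : Set α} (hS : S.Finite) (F : α → Finset β) {n : ℕ}
    (hF : ∀ a ∈ S, (F a).card ≤ n) {V : Set β} (hV : ∀ b ∈ V, ∃ a ∈ S, b ∈ F a) :
    V.Finite ∧ V.ncard ≤ S.ncard * n := by
  classical
  have hsub : V ⊆ (hS.toFinset.biUnion F : Finset β) := fun b hb => by
    obtain ⟨a, ha, hba⟩ := hV b hb
    simpa using ⟨a, ha, hba⟩
  refine ⟨(Finset.finite_toSet _).subset hsub, ?_⟩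
  refine (ncard_le_ncard hsub (Finset.finite_toSet _)).trans ?_
  rw [ncard_coe_finset, ncard_eq_toFinset_card _ hS]
  exact Finset.card_biUnion_le_card_mul _ _ _ fun a ha => hF a (by simpa using ha)

/-- The charts carried off themselves at which standardness is locally extremal. -/
def bumps (f : Equiv.Perm ℝ) : Set Chart := {y | IsChart y ∧ Off f y ∧ Bump (StdAt f y)}

lemma bumps_card_le (hf : IsPL f) : (bumps f).Finite ∧
    (bumps f).ncard ≤ (bad f \ badOv f).ncard * (badOv f).ncard := by
  classical
  have key : ∀ u ∈ bad f \ badOv f, ∃ E C : ℤ, C - E + 1 ≤ (badOv f).ncard ∧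
      (∀ t, C ≤ t → (StdAt f (std u) t ↔ StdAt f (std u) C)) ∧
      (∀ t, t ≤ E - 1 → (StdAt f (std u) t ↔ StdAt f (std u) (E - 1))) := by
    rintro u ⟨hu, hov⟩
    have hoff : Off f (std u) := fun p hp hp' => by
      rw [range_std] at hp hp'
      exact hov ⟨hu, p, hp, hp'⟩
    obtain ⟨x, hx, hsub⟩ := hoff.exists_step hf (isChart_std u)
    obtain ⟨E, C, hW⟩ := exists_window hf hx
    obtain ⟨h1, h2⟩ := stdAt_const_of_window hf hsub hW
    have h3 := hW.card_le hf hx (S := univ) fun _ => subset_univ _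
    have h4 := ncard_le_ncard (badOvIn_subset f univ) hf.badOv_finite
    exact ⟨E, C, by omega, fun t => iff_of_iff_succ h1, fun t => iff_of_iff_pred h2⟩
  choose! E C hEC hC hE using key
  refine ncard_biUnion_le (hf.fin.subset sdiff_subset)
    (fun u => (Finset.Ico (E u) (C u)).image fun s => f ^ s • std u) (fun u hu => ?_) ?_
  · refine Finset.card_image_le.trans ?_
    have := hEC u hu
    rw [Int.card_Ico]; omega
  · rintro y ⟨hy, hoff, hbump⟩
    obtain ⟨t, ht, ht'⟩ := exists_drop hbump
    obtain ⟨u, hu⟩ := ht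
    have hyu : y = f ^ (-t) • std u := by rw [hu, zpow_neg, inv_smul_smul]
    have hubad : u ∈ bad f \ badOv f := by
      constructor
      · intro hgood
        rw [hu, ← mul_smul, ← zpow_one_add, add_comm] at hgood
        exact ht' hgood
      · rintro ⟨-, p, hp, hp'⟩
        rw [← range_std, hu] at hp hp'
        exact hoff.zpow_smul t p hp hp'
    refine ⟨u, hubad, Finset.mem_image.2 ⟨-t, Finset.mem_Ico.2 ?_, hyu.symm⟩⟩
    obtain ⟨a, ha, b, hb, h1, h2⟩ := hbump
    rw [hyu, stdAt_zpow_smul, stdAt_zpow_smul] at h1 h2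
    constructor
    · by_contra hlt
      push Not at hlt
      exact h1 ((hE u hubad _ (by omega)).trans (hE u hubad _ (by omega)).symm)
    · by_contra hlt
      push Not at hlt
      exact h2 ((hC u hubad _ (by omega)).trans (hC u hubad _ (by omega)).symm)

lemma Livable.zpow_smul (hf : IsPL f) (H : Livable f y) (t : ℤ) : Livable f (f ^ t • y) := by
  obtain ⟨hy, x, n, hx, hl⟩ := H
  refine ⟨hy.smul (hf.zpow t), (f ^ t) x, n, zpow_apply_ne hx t, ?_⟩
  have := hl.conj (hf.zpow (-t)) (eq_conj_zpow f (-t))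
  rwa [← zpow_neg, neg_neg] at this

lemma Livable.exists_not_mem (hf : IsPL f) (H : Livable f y) :
    ∃ p ∈ Ico (0 : ℝ) 1, p ∉ range y := by
  obtain ⟨-, x, n, hx, ⟨hsub, -⟩ | ⟨w, -, -, -, h⟩ | ⟨w, -, -, -, h⟩⟩ := H
  · refine ⟨0, by norm_num, fun h0 => ?_⟩
    have h1 := hsub h0
    have hx0 := (hf.mem_unit hx).1
    have hfx0 := (hf.mem_unit (zpow_apply_ne hx 1)).1
    rw [zpow_one] at hfx0
    have e0 := hf.fixed_zero
    rcases mem_uIcc.1 h1 with ⟨a, -⟩ | ⟨a, -⟩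
    · have : x = 0 := le_antisymm a hx0
      exact hx (by rw [this, e0])
    · have : f x = 0 := le_antisymm a hfx0
      have h2 : x = 0 := f.injective (by rw [this, e0])
      exact hx (by rw [h2, e0])
  · exact ⟨_, hf.mem_unit (zpow_apply_ne hx _), h⟩
  · exact ⟨_, hf.inv.mem_unit (zpow_apply_ne (inv_apply_ne hx) _), h⟩

lemma nil_mem_bad (hf : IsPL f) (hne : f ≠ 1) : [] ∈ bad f := by
  rintro ⟨v, hv⟩
  have hin : ∀ p ∈ Ico (0 : ℝ) 1, p ∈ cell v := by
    intro p hp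
    have h1 : f⁻¹ p ∈ cell [] := by
      by_contra h
      have := hf.supp _ h
      rw [Equiv.Perm.coe_inv, Equiv.apply_symm_apply] at this
      rw [Equiv.Perm.coe_inv, ← this] at h
      exact h hp
    have h2 := (image_cell hv.symm).2 h1
    rwa [Equiv.Perm.coe_inv, Equiv.apply_symm_apply] at h2
  have hv0 : v = [] := List.prefix_nil.1 (prefix_of_cell_subset (u := v) (v := []) hin)
  rw [hv0] at hv
  refine hne (Equiv.ext fun p => ?_)
  by_cases hp : p ∈ Ico (0 : ℝ) 1
  · exact apply_of_smul_eq hv.symm (by rwa [range_std])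
  · exact hf.supp p hp

/-- The charts that change standardness for the last time. -/
def lasts (f : Equiv.Perm ℝ) : Set Chart := {y | Livable f y ∧ Last f y 0}

lemma lasts_card_le (hf : IsPL f) (hne : f ≠ 1) : (lasts f).Finite ∧
    (lasts f).ncard + 2 ≤ (bad f).ncard + (bad f⁻¹).ncard := by
  have hsub : lasts f ⊆ std '' (bad f \ {[]}) ∪ (fun u => f⁻¹ • std u) '' (bad f⁻¹ \ {[]}) := by
    rintro y ⟨hy, hl⟩
    obtain ⟨p, hp, hpy⟩ := hy.exists_not_mem hf
    have hs := hl.succ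
    rw [zero_add, StdAt, StdAt, zpow_one, zpow_zero, one_smul] at hs
    by_cases h0 : y ∈ range std
    · obtain ⟨u, rfl⟩ := h0
      refine Or.inl ⟨u, ⟨fun h => hs.1 h ⟨u, rfl⟩, ?_⟩, rfl⟩
      rintro rfl
      exact hpy (by rwa [range_std])
    · obtain ⟨v, hv⟩ := hs.2 h0
      have e : f⁻¹ • std v = y := by rw [hv, inv_smul_smul]
      refine Or.inr ⟨v, ⟨fun h => h0 (by rwa [e] at h), ?_⟩, e⟩
      rintro rfl
      refine hpy ?_
      rw [← mem_range_smul f, ← hv, range_std]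
      by_contra h
      have h1 := hf.inv.supp _ h
      rw [Equiv.Perm.coe_inv, Equiv.symm_apply_apply] at h1
      rw [← h1] at h
      exact h hp
  have h1 : (bad f \ {[]}).Finite := hf.fin.subset sdiff_subset
  have h2 : (bad f⁻¹ \ {[]}).Finite := hf.inv.fin.subset sdiff_subset
  have hfin := (h1.image std).union (h2.image fun u => f⁻¹ • std u)
  refine ⟨hfin.subset hsub, ?_⟩
  have h3 := ncard_le_ncard hsub hfin
  have h4 := ncard_union_le (std '' (bad f \ {[]})) ((fun u => f⁻¹ • std u) '' (bad f⁻¹ \ {[]}))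
  have h5 := ncard_image_le h1 (f := std)
  have h6 := ncard_image_le h2 (f := fun u => f⁻¹ • std u)
  have h7 := ncard_sdiff_singleton_add_one (nil_mem_bad hf hne) hf.fin
  have h8 := ncard_sdiff_singleton_add_one (nil_mem_bad hf.inv (inv_ne_one.2 hne)) hf.inv.fin
  omega

/-- The charts on which `h` is not standard, in one direction or the other. -/
def mismatch (h : Equiv.Perm ℝ) : Set Chart :=
  {y | ¬ (y ∈ range std ↔ h⁻¹ • y ∈ range std)}

lemma mismatch_eq (h : Equiv.Perm ℝ) :
    mismatch h = std '' bad h⁻¹ ∪ (fun u => h • std u) '' bad h := by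
  ext y
  constructor
  · intro hy
    by_cases h0 : y ∈ range std
    · obtain ⟨u, rfl⟩ := h0
      exact Or.inl ⟨u, fun h1 => hy ⟨fun _ => h1, fun _ => ⟨u, rfl⟩⟩, rfl⟩
    · by_cases h1 : h⁻¹ • y ∈ range std
      · obtain ⟨u, hu⟩ := h1
        have e : h • std u = y := by rw [hu, smul_inv_smul]
        exact Or.inr ⟨u, fun h2 => h0 (by rwa [e] at h2), e⟩
      · exact absurd ⟨fun h => absurd h h0, fun h => absurd h h1⟩ hy
  · rintro (⟨u, hu, rfl⟩ | ⟨u, hu, rfl⟩) e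
    · exact hu (e.1 ⟨u, rfl⟩)
    · exact hu (e.2 ⟨u, (inv_smul_smul _ _).symm⟩)

lemma mismatch_finite (hh : IsPL h) : (mismatch h).Finite := by
  rw [mismatch_eq]
  exact (hh.inv.fin.image _).union (hh.fin.image _)

lemma ncard_mismatch (hh : IsPL h) : (mismatch h).ncard = (bad h).ncard + (bad h⁻¹).ncard := by
  rw [mismatch_eq, ncard_union_eq _ (hh.inv.fin.image _) (hh.fin.image _),
    ncard_image_of_injective _ std_injective,
    ncard_image_of_injective _ (show Function.Injective fun u => h • std u from
      (MulAction.injective h).comp std_injective), add_comm]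
  rw [disjoint_left]
  rintro _ ⟨u, -, rfl⟩ ⟨v, hv, e⟩
  exact hv ⟨u, e.symm⟩

/-- The charts separated by the last changes of standardness of `f` and of its conjugate. -/
def gaps (f g h : Equiv.Perm ℝ) : Set Chart :=
  {y | ∃ r ∈ lasts f, ∃ c s : ℤ, Last g (h⁻¹ • r) c ∧ y = f ^ s • r ∧
    s ∈ Finset.Ioc (min 0 c) (max 0 c)}

lemma gaps_card_le (hf : IsPL f) (hne : f ≠ 1) {n : ℕ}
    (hn : ∀ r ∈ lasts f, ∀ c, Last g (h⁻¹ • r) c → |c| ≤ n) :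
    (gaps f g h).Finite ∧ (gaps f g h).ncard ≤ (lasts f).ncard * n := by
  classical
  have key : ∀ r : Chart, ∃ c : ℤ, ∀ c', Last g (h⁻¹ • r) c' → c' = c := by
    intro r
    by_cases hr : ∃ c, Last g (h⁻¹ • r) c
    · obtain ⟨c, hc⟩ := hr
      exact ⟨c, fun c' hc' => hc'.unique hc⟩
    · exact ⟨0, fun c' hc' => absurd ⟨c', hc'⟩ hr⟩
  choose c hc using key
  refine ncard_biUnion_le (lasts_card_le hf hne).1
    (fun r => if |c r| ≤ n then (Finset.Ioc (min 0 (c r)) (max 0 (c r))).image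
      (fun s => f ^ s • r) else ∅) (fun r hr => ?_) ?_
  · split_ifs with hle
    · refine Finset.card_image_le.trans ?_
      rw [Int.card_Ioc]
      rw [abs_le] at hle
      omega
    · simp
  · rintro y ⟨r, hr, c', s, hl, rfl, hs⟩
    refine ⟨r, hr, ?_⟩
    have := hc r c' hl
    subst this
    rw [if_pos (hn r hr _ hl)]
    exact Finset.mem_image.2 ⟨s, hs, rfl⟩

/-- Mismatched moving charts are of one of three types. -/
lemma mem_of_moves (hf : IsPL f) (hg : IsPL g) (hh : IsPL h) (hc : g = h⁻¹ * f * h)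
    (hy : IsChart y) (hm : y ∈ mismatch h) (hfy : f • y ≠ y) (H : Moves f y) :
    y ∈ bumps f ∨ h⁻¹ • y ∈ bumps g ∨ y ∈ gaps f g h := by
  have hy' := hy.smul hh.inv
  have H' := H.conj hc
  have hst : ∀ t : ℤ, StdAt g (h⁻¹ • y) t ↔ h⁻¹ • f ^ t • y ∈ range std := by
    intro t
    rw [StdAt, conj_zpow hc, mul_smul, mul_smul, smul_inv_smul]
  have hfin : {t | ¬ (StdAt f y t ↔ StdAt g (h⁻¹ • y) t)}.Finite := by
    refine ((mismatch_finite hh).preimage (zpow_smul_injective hf hfy).injOn).subset ?_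
    intro t ht
    rw [mem_ofPred_eq, hst] at ht
    exact ht
  have h0 : ¬ (StdAt f y 0 ↔ StdAt g (h⁻¹ • y) 0) := by
    rw [hst, StdAt, zpow_zero, one_smul]
    exact hm
  rcases bump_or_last (H.evConst hf hy) (H'.evConst hg hy') hfin h0 with hb | hb | ⟨b, b', hb, hb', hne⟩
  · exact Or.inl ⟨hy, H.off_of_bump hb, hb⟩
  · exact Or.inr (Or.inl ⟨hy', H'.off_of_bump hb, hb⟩)
  · have hl : Last f y b := hb
    have hl' : Last g (h⁻¹ • y) b' := hb'
    refine Or.inr (Or.inr ⟨f ^ b • y, ⟨(H.livable hf hy).zpow_smul hf b, ?_⟩, b' - b, -b, ?_, ?_, ?_⟩)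
    · have := hl.zpow_smul b
      rwa [sub_self] at this
    · have := hl'.zpow_smul b
      rwa [conj_zpow hc, mul_smul, mul_smul, smul_inv_smul] at this
    · rw [zpow_neg, inv_smul_smul]
    · rw [Finset.mem_Ioc]
      omega

lemma mismatch_subset (hf : IsPL f) (hg : IsPL g) (hh : IsPL h) (hc : g = h⁻¹ * f * h)
    {D : Finset Chart} (hD : ∀ y, f • y = y → y ∉ D → (y ∈ range std ↔ h⁻¹ • y ∈ range std)) :
    mismatch h ⊆ D ∪ (std '' badOv f ∪ ((fun u => h • std u) '' badOv g ∪
      (bumps f ∪ ((h • ·) '' bumps g ∪ gaps f g h)))) := by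
  intro y hm
  have hc' : f = h⁻¹⁻¹ * g * h⁻¹ := by rw [hc]; group
  by_cases hfy : f • y = y
  · by_cases hyD : y ∈ D
    · exact Or.inl hyD
    · exact absurd (hD y hfy hyD) hm
  have hmov : IsChart y → Moves f y →
      y ∈ bumps f ∪ ((h • ·) '' bumps g ∪ gaps f g h) := by
    intro hy H
    rcases mem_of_moves hf hg hh hc hy hm hfy H with h1 | h1 | h1
    · exact Or.inl h1
    · exact Or.inr (Or.inl ⟨_, h1, smul_inv_smul _ _⟩)
    · exact Or.inr (Or.inr h1)
  have hm' := hm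
  rw [mismatch_eq] at hm'
  rcases hm' with ⟨u, -, rfl⟩ | ⟨u, -, rfl⟩
  · rcases fixed_or_moves f u with h1 | h1 | h1
    · exact Or.inr (Or.inl ⟨u, h1, rfl⟩)
    · exact absurd h1 hfy
    · exact Or.inr (Or.inr (Or.inr (hmov (isChart_std u) h1)))
  · have e : f • h • std u = h • g • std u := by
      rw [hc, mul_smul, mul_smul, smul_inv_smul]
    rcases fixed_or_moves g u with h1 | h1 | h1
    · exact Or.inr (Or.inr (Or.inl ⟨u, h1, rfl⟩))
    · exact absurd (by rw [e, h1]) hfy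
    · refine Or.inr (Or.inr (Or.inr (hmov ((isChart_std u).smul hh) ?_)))
      have := h1.conj hc'
      rwa [inv_inv] at this

/-- A count of the words on which a well-chosen conjugator is not standard. -/
lemma exists_conjugator (hf : IsPL f) (hg : IsPL g) (hh : IsPL h) (hc : g = h⁻¹ * f * h)
    (hne : f ≠ 1) : ∃ k, IsPL k ∧ g = k⁻¹ * f * k ∧ ∃ n : ℕ,
      2 * n ≤ (badOv f).ncard + (badOv g).ncard + 1 ∧
      (bad k).ncard + (bad k⁻¹).ncard ≤
        2 * ((badOv f).ncard + (badOv g).ncard + 1) +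
        (bad f \ badOv f).ncard * (badOv f).ncard + (bad g \ badOv g).ncard * (badOv g).ncard +
        (lasts f).ncard * n := by
  obtain ⟨z, hz, hcz, D, hD, hDs⟩ := exists_fixed_correction hf hg hh hc
  obtain ⟨z', hz', hcz', hfix, hcent⟩ := exists_centered_conjugator hf hg (hz.mul hh) hcz
    (lasts_card_le hf hne).1 fun y hy => hy
  set k := z' * (z * h) with hk
  have hkPL : IsPL k := hz'.mul (hz.mul hh)
  refine ⟨k, hkPL, hcz', ((badOv f).ncard + (badOv g).ncard + 1) / 2, Nat.mul_div_le _ _, ?_⟩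
  have hDk : ∀ y, f • y = y → y ∉ D → (y ∈ range std ↔ k⁻¹ • y ∈ range std) := by
    intro y hy hyD
    have e : z' • y = y := by
      funext s
      exact hfix _ (congrFun hy s)
    rw [hDs y hy hyD, hk, mul_inv_rev z', mul_smul _ z'⁻¹, inv_smul_eq_iff.2 e.symm]
  have hsub := mismatch_subset hf hg hkPL hcz' hDk
  obtain ⟨f1, c1⟩ := bumps_card_le hf
  obtain ⟨f2, c2⟩ := bumps_card_le hg
  obtain ⟨f3, c3⟩ := gaps_card_le (g := g) (h := k) hf hne
    (n := ((badOv f).ncard + (badOv g).ncard + 1) / 2) fun r hr c hl => by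
      have := hcent r hr c hl
      omega
  have f2' := f2.image (k • · : Chart → Chart)
  have c2' := ncard_image_le f2 (f := (k • · : Chart → Chart))
  have f4 := hf.badOv_finite.image std
  have c4 := ncard_image_le hf.badOv_finite (f := std)
  have f5 := hg.badOv_finite.image fun u => k • std u
  have c5 := ncard_image_le hg.badOv_finite (f := fun u => k • std u)
  have hle := ncard_le_ncard hsub
    (D.finite_toSet.union (f4.union (f5.union (f1.union (f2'.union f3)))))
  rw [ncard_mismatch hkPL] at hle
  have u1 := ncard_union_le (D : Set Chart) (std '' badOv f ∪ ((fun u => k • std u) '' badOv g ∪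
      (bumps f ∪ ((k • ·) '' bumps g ∪ gaps f g k))))
  have u2 := ncard_union_le (std '' badOv f) ((fun u => k • std u) '' badOv g ∪
      (bumps f ∪ ((k • ·) '' bumps g ∪ gaps f g k)))
  have u3 := ncard_union_le ((fun u => k • std u) '' badOv g)
      (bumps f ∪ ((k • ·) '' bumps g ∪ gaps f g k))
  have u4 := ncard_union_le (bumps f) ((k • ·) '' bumps g ∪ gaps f g k)
  have u5 := ncard_union_le ((k • · : Chart → Chart) '' bumps g) (gaps f g k)
  rw [ncard_coe_finset] at u1
  linarith

lemma wordLength_one : wordLength 1 = 0 := by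
  have := wordLength_le (w := []) (by simp)
  simpa using this

lemma wordLength_pos (hf : f ∈ ThompsonF) (hne : f ≠ 1) : 1 ≤ wordLength f := by
  by_contra h
  obtain ⟨w, hl, -, rfl⟩ := exists_geodesic hf
  have : w = [] := List.length_eq_zero_iff.1 (by omega)
  exact hne (by rw [this]; rfl)

lemma ncard_sdiff_badOv (hf : IsPL f) :
    (bad f \ badOv f).ncard + (badOv f).ncard = (bad f).ncard :=
  ncard_sdiff_add_ncard_of_subset (fun _ h => h.1) hf.fin

lemma quadratic_bound {i j a m b l L : ℝ} (hi : 1 ≤ i) (hb0 : 0 ≤ b) (hm0 : 0 ≤ m)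
    (ha0 : 0 ≤ a) (ha : m + a ≤ i + 2) (hb : l + b ≤ j + 2)
    (hL : L + 4 ≤ 2 * (2 * (a + b + 1) + m * a + l * b) + 2 * (i + 1) * (a + b + 1)) :
    L ≤ 13 * i ^ 2 + j ^ 2 + 27 * i + 3 * j + 20 := by
  have h1 : m * a ≤ (i + 2 - a) * a := mul_le_mul_of_nonneg_right (by linarith) ha0
  have h2 : l * b ≤ (j + 2 - b) * b := mul_le_mul_of_nonneg_right (by linarith) hb0
  have h3 : 0 ≤ (i + 2 - a) * (i + 3 - a) := mul_nonneg (by linarith) (by linarith)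
  nlinarith [sq_nonneg (i + j + 5 - 2 * b), sq_nonneg (j - i - 2)]

end

end Thompson

theorem conjugator_length_bound (f g : Equiv.Perm ℝ) (hf : f ∈ ThompsonF)
    (hg : g ∈ ThompsonF) (hconj : ∃ h ∈ ThompsonF, h⁻¹ * f * h = g)
    (hij : wordLength f ≤ wordLength g) :
    ∃ h ∈ ThompsonF, h⁻¹ * f * h = g ∧
      wordLength h ≤ 13 * wordLength f ^ 2 + wordLength g ^ 2 +
        27 * wordLength f + 3 * wordLength g + 20 := by
  obtain ⟨h, hh, hc⟩ := hconj
  by_cases hne : f = 1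
  · refine ⟨1, one_mem _, ?_, by rw [Thompson.wordLength_one]; omega⟩
    rw [← hc, hne]; group
  have hfPL := Thompson.isPL_of_mem hf
  have hgPL := Thompson.isPL_of_mem hg
  obtain ⟨k, hk, hkc, n, hn, hcount⟩ :=
    Thompson.exists_conjugator hfPL hgPL (Thompson.isPL_of_mem hh) hc.symm hne
  refine ⟨k, hk.mem, hkc.symm, ?_⟩
  by_cases hk1 : k = 1
  · rw [hk1, Thompson.wordLength_one]; omega
  have h1 := hk.wordLength_le_two hk1
  have h2 := (Thompson.lasts_card_le hfPL hne).2
  have h3 := Thompson.ncard_bad_le hf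
  have h4 := Thompson.ncard_bad_le hg
  have h5 := Thompson.ncard_bad_le (inv_mem hf)
  have h6 := Thompson.wordLength_inv_le hf
  have h7 := Thompson.ncard_sdiff_badOv hfPL
  have h8 := Thompson.ncard_sdiff_badOv hgPL
  have h9 : (Thompson.lasts f).ncard * (2 * n) ≤ (2 * (wordLength f + 1)) *
      ((Thompson.badOv f).ncard + (Thompson.badOv g).ncard + 1) :=
    Nat.mul_le_mul (by omega) hn
  have key := Thompson.quadratic_bound (i := wordLength f) (j := wordLength g)
    (a := (Thompson.badOv f).ncard) (m := (Thompson.bad f \ Thompson.badOv f).ncard)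
    (b := (Thompson.badOv g).ncard) (l := (Thompson.bad g \ Thompson.badOv g).ncard)
    (L := wordLength k) (by exact_mod_cast Thompson.wordLength_pos hf hne) (by positivity)
    (by positivity) (by positivity) (by exact_mod_cast h7.trans_le h3)
    (by exact_mod_cast h8.trans_le h4) (by norm_cast; linarith)
  exact_mod_cast key

end
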